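/- The partial order of the C-degrees of computably enumerable reals and the partial order of the K-degrees of computably enumerable reals are not elementarily equivalent: the C-degrees of c.e. reals contain a minimal pair, while the K-degrees of c.e. reals do not. -/

import Mathlib

open Part Filter

open scoped Classical

namespace KPaper

/-- Binary strings. -/
abbrev Str := List Bool

/-! ### Oracle (Turing) reducibility -/

/-- The functions `ℕ →. ℕ` that are partial recursive relative to an oracle `O : ℕ →. ℕ`.
This mirrors Mathlib's `Nat.Partrec`, with an extra base case for the oracle. -/
inductive RecursiveIn (O : ℕ →. ℕ) : (ℕ →. ℕ) → Prop
  | oracle : RecursiveIn O O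
  | zero : RecursiveIn O (pure 0)
  | succ : RecursiveIn O ↑Nat.succ
  | left : RecursiveIn O ↑fun n : ℕ => n.unpair.1
  | right : RecursiveIn O ↑fun n : ℕ => n.unpair.2
  | pair {f g} : RecursiveIn O f → RecursiveIn O g →
      RecursiveIn O fun n => Nat.pair <$> f n <*> g n
  | comp {f g} : RecursiveIn O f → RecursiveIn O g → RecursiveIn O fun n => g n >>= f
  | prec {f g} : RecursiveIn O f → RecursiveIn O g → RecursiveIn O (Nat.unpaired fun a n =>
      n.rec (f a) fun y IH => do let i ← IH; g (Nat.pair a (Nat.pair y i)))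
  | rfind {f} : RecursiveIn O f →
      RecursiveIn O fun a => Nat.rfind fun n => (fun m => m = 0) <$> f (Nat.pair a n)

/-- The characteristic (partial) function of a set of naturals, used as a Turing oracle. -/
noncomputable def chi (A : Set ℕ) : ℕ →. ℕ := fun n => Part.some (if n ∈ A then 1 else 0)

/-- The characteristic function of an infinite binary sequence, used as a Turing oracle. -/
def chiSeq (X : ℕ → Bool) : ℕ →. ℕ := fun n => Part.some (cond (X n) 1 0)

/-- `A` is Turing reducible to `B`. -/
noncomputable def TuringLeSet (A B : Set ℕ) : Prop := RecursiveIn (chi B) (chi A)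

/-- `A` is Turing equivalent to `B`. -/
noncomputable def TuringEquivSet (A B : Set ℕ) : Prop := TuringLeSet A B ∧ TuringLeSet B A

/-- Turing equivalence between a set and an infinite binary sequence. -/
noncomputable def TuringEquivSetSeq (A : Set ℕ) (X : ℕ → Bool) : Prop :=
  RecursiveIn (chiSeq X) (chi A) ∧ RecursiveIn (chi A) (chiSeq X)

/-- The halting problem `∅'`. -/
def haltingSet : Set ℕ := {n | ((Denumerable.ofNat Nat.Partrec.Code n).eval n).Dom}

/-- A set of naturals is computably enumerable iff it is the domain of a
partial computable function. -/
def CESet (A : Set ℕ) : Prop := ∃ f : ℕ →. ℕ, Nat.Partrec f ∧ ∀ n, n ∈ A ↔ (f n).Dom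

/-! ### Machines and Kolmogorov complexity -/

/-- A (plain) machine is a partial computable map from binary strings to binary strings. -/
def PlainMachine (M : Str →. Str) : Prop := Partrec M

/-- A prefix-free machine: a partial computable map on binary strings whose
domain is an antichain under the prefix relation. -/
def PFMachine (M : Str →. Str) : Prop :=
  Partrec M ∧ ∀ ρ₁ ρ₂ : Str, (M ρ₁).Dom → (M ρ₂).Dom → ρ₁ <+: ρ₂ → ρ₁ = ρ₂

/-- The Kolmogorov complexity of a string `σ` with respect to a machine `M`:
the least length of an `M`-description of `σ` (`⊤` if there is none). -/
noncomputable def KC (M : Str →. Str) (σ : Str) : ℕ∞ :=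
  ⨅ ρ : {ρ : Str // σ ∈ M ρ}, ((ρ : Str).length : ℕ∞)

/-- An optimal prefix-free machine: a prefix-free machine whose associated complexity
is minimal, up to an additive constant, among all prefix-free machines. -/
def OptimalPF (U : Str →. Str) : Prop :=
  PFMachine U ∧ ∀ M : Str →. Str, PFMachine M → ∃ c : ℕ, ∀ σ : Str, KC U σ ≤ KC M σ + c

/-- An optimal plain machine. -/
def OptimalPlain (V : Str →. Str) : Prop :=
  PlainMachine V ∧ ∀ M : Str →. Str, PlainMachine M → ∃ c : ℕ, ∀ σ : Str, KC V σ ≤ KC M σ + c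

/-! ### Initial segments -/

/-- The first `n` bits of the characteristic sequence of a set of naturals. -/
noncomputable def restrSet (A : Set ℕ) (n : ℕ) : Str :=
  (List.range n).map fun i => decide (i ∈ A)

/-- The first `n` bits of an infinite binary sequence. -/
def restrSeq (X : ℕ → Bool) (n : ℕ) : Str := (List.range n).map X

/-- The string `0^n`; `K(n)` is identified with `K(0^n)`. -/
def zeroStr (n : ℕ) : Str := List.replicate n false

/-! ### `≤_K`, `<_K`, `K`-triviality (and the `≤_C` analogues) -/

def KLeSet (U : Str →. Str) (A B : Set ℕ) : Prop :=
  ∃ c : ℕ, ∀ n, KC U (restrSet A n) ≤ KC U (restrSet B n) + c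

def KLtSet (U : Str →. Str) (A B : Set ℕ) : Prop := KLeSet U A B ∧ ¬ KLeSet U B A

def KTrivialSet (U : Str →. Str) (A : Set ℕ) : Prop :=
  ∃ c : ℕ, ∀ n, KC U (restrSet A n) ≤ KC U (zeroStr n) + c

def KLeSeq (U : Str →. Str) (X Y : ℕ → Bool) : Prop :=
  ∃ c : ℕ, ∀ n, KC U (restrSeq X n) ≤ KC U (restrSeq Y n) + c

def KLtSeq (U : Str →. Str) (X Y : ℕ → Bool) : Prop := KLeSeq U X Y ∧ ¬ KLeSeq U Y X

def KTrivialSeq (U : Str →. Str) (X : ℕ → Bool) : Prop :=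
  ∃ c : ℕ, ∀ n, KC U (restrSeq X n) ≤ KC U (zeroStr n) + c

/-! ### Computably enumerable reals -/

/-- The real number in `[0,1]` whose binary expansion is the sequence `X`. -/
noncomputable def realOfSeq (X : ℕ → Bool) : ℝ := ∑' i : ℕ, cond (X i) ((2 : ℝ) ^ (i + 1))⁻¹ 0

/-- `X` (identified with the real it is the binary expansion of) is a computably
enumerable real: it is the limit of a nondecreasing computable sequence of
(dyadic) rationals. -/
def CEReal (X : ℕ → Bool) : Prop :=
  ∃ f : ℕ → ℤ, Computable f ∧
    (∀ s, (f s : ℝ) / 2 ^ s ≤ (f (s + 1) : ℝ) / 2 ^ (s + 1)) ∧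
    Tendsto (fun s => (f s : ℝ) / 2 ^ s) atTop (nhds (realOfSeq X))

/-- The characteristic sequence of a set of naturals. -/
noncomputable def seqOfSet (A : Set ℕ) : ℕ → Bool := fun i => decide (i ∈ A)

/-! ### Solovay reducibility -/

/-- Solovay reducibility on c.e. reals: `X ≤_S Y` iff there are nondecreasing computable
rational approximations to `X` and `Y` and a constant `c` such that at each stage the
distance to `X` is bounded by `c` times the distance to `Y`. -/
def SolovayLe (X Y : ℕ → Bool) : Prop :=
  ∃ (c : ℕ) (f g : ℕ → ℤ), Computable f ∧ Computable g ∧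
    (∀ s, (f s : ℝ) / 2 ^ s ≤ (f (s + 1) : ℝ) / 2 ^ (s + 1)) ∧
    (∀ s, (g s : ℝ) / 2 ^ s ≤ (g (s + 1) : ℝ) / 2 ^ (s + 1)) ∧
    Tendsto (fun s => (f s : ℝ) / 2 ^ s) atTop (nhds (realOfSeq X)) ∧
    Tendsto (fun s => (g s : ℝ) / 2 ^ s) atTop (nhds (realOfSeq Y)) ∧
    ∀ s, realOfSeq X - (f s : ℝ) / 2 ^ s ≤ (c : ℝ) * (realOfSeq Y - (g s : ℝ) / 2 ^ s)


/-- `≤_C` on binary sequences, with respect to a plain machine `V`. -/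
def CLeSeq (V : Str →. Str) (X Y : ℕ → Bool) : Prop :=
  ∃ d : ℕ, ∀ n, KC V (restrSeq X n) ≤ KC V (restrSeq Y n) + d

/-- `C`-triviality (membership in the least `C`-degree). -/
def CTrivialSeq (V : Str →. Str) (X : ℕ → Bool) : Prop :=
  ∃ d : ℕ, ∀ n, KC V (restrSeq X n) ≤ KC V (zeroStr n) + d

attribute [fun_prop] Primrec
attribute [fun_prop] Primrec.const
attribute [fun_prop] Primrec.id
attribute [fun_prop] Primrec.comp
attribute [fun_prop] Primrec.pair

section PR
variable {α β γ δ : Type} [Primcodable α] [Primcodable β] [Primcodable γ] [Primcodable δ]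

@[fun_prop] theorem pr_id' : Primrec (fun x : α => x) := Primrec.id
@[fun_prop] theorem pr_fst {f : γ → α × β} (hf : Primrec f) : Primrec (fun x => (f x).1) :=
  Primrec.fst.comp hf
@[fun_prop] theorem pr_snd {f : γ → α × β} (hf : Primrec f) : Primrec (fun x => (f x).2) :=
  Primrec.snd.comp hf
theorem pr_uncurry {f : α → β → γ} (hf : Primrec₂ f) : Primrec (fun p : α × β => f p.1 p.2) := hf

-- nat
@[fun_prop] theorem pr_add {f g : γ → ℕ} (hf : Primrec f) (hg : Primrec g) :
    Primrec (fun x => f x + g x) := Primrec.nat_add.comp hf hg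
@[fun_prop] theorem pr_succ {f : γ → ℕ} (hf : Primrec f) :
    Primrec (fun x => Nat.succ (f x)) := Primrec.succ.comp hf
@[fun_prop] theorem pr_sub {f g : γ → ℕ} (hf : Primrec f) (hg : Primrec g) :
    Primrec (fun x => f x - g x) := Primrec.nat_sub.comp hf hg
@[fun_prop] theorem pr_mul {f g : γ → ℕ} (hf : Primrec f) (hg : Primrec g) :
    Primrec (fun x => f x * g x) := Primrec.nat_mul.comp hf hg
@[fun_prop] theorem pr_div {f g : γ → ℕ} (hf : Primrec f) (hg : Primrec g) :
    Primrec (fun x => f x / g x) := Primrec.nat_div.comp hf hg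
@[fun_prop] theorem pr_mod {f g : γ → ℕ} (hf : Primrec f) (hg : Primrec g) :
    Primrec (fun x => f x % g x) := Primrec.nat_mod.comp hf hg
@[fun_prop] theorem pr_min {f g : γ → ℕ} (hf : Primrec f) (hg : Primrec g) :
    Primrec (fun x => min (f x) (g x)) := Primrec.nat_min.comp hf hg
@[fun_prop] theorem pr_max {f g : γ → ℕ} (hf : Primrec f) (hg : Primrec g) :
    Primrec (fun x => max (f x) (g x)) := Primrec.nat_max.comp hf hg
@[fun_prop] theorem pr_pow {f g : γ → ℕ} (hf : Primrec f) (hg : Primrec g) :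
    Primrec (fun x => (f x) ^ (g x)) := 
  (Primrec₂.unpaired'.1 Nat.Primrec.pow).comp hf hg
@[fun_prop] theorem pr_natpair {f g : γ → ℕ} (hf : Primrec f) (hg : Primrec g) :
    Primrec (fun x => Nat.pair (f x) (g x)) := Primrec₂.natPair.comp hf hg
@[fun_prop] theorem pr_unpair {f : γ → ℕ} (hf : Primrec f) :
    Primrec (fun x => Nat.unpair (f x)) := Primrec.unpair.comp hf

-- bool
@[fun_prop] theorem pr_and {f g : γ → Bool} (hf : Primrec f) (hg : Primrec g) :
    Primrec (fun x => f x && g x) := Primrec.and.comp hf hg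
@[fun_prop] theorem pr_or {f g : γ → Bool} (hf : Primrec f) (hg : Primrec g) :
    Primrec (fun x => f x || g x) := Primrec.or.comp hf hg
@[fun_prop] theorem pr_not {f : γ → Bool} (hf : Primrec f) :
    Primrec (fun x => !(f x)) := Primrec.not.comp hf
@[fun_prop] theorem pr_lt {f g : γ → ℕ} (hf : Primrec f) (hg : Primrec g) :
    Primrec (fun x => decide (f x < g x)) := (Primrec.nat_lt.comp hf hg).decide
@[fun_prop] theorem pr_le {f g : γ → ℕ} (hf : Primrec f) (hg : Primrec g) :
    Primrec (fun x => decide (f x ≤ g x)) := (Primrec.nat_le.comp hf hg).decide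
@[fun_prop] theorem pr_eq [DecidableEq α] {f g : γ → α} (hf : Primrec f) (hg : Primrec g) :
    Primrec (fun x => decide (f x = g x)) := (Primrec.eq.comp hf hg).decide
@[fun_prop] theorem pr_cond {c : γ → Bool} {f g : γ → α} (hc : Primrec c) (hf : Primrec f)
    (hg : Primrec g) : Primrec (fun x => bif c x then f x else g x) := Primrec.cond hc hf hg

-- option
@[fun_prop] theorem pr_some {f : γ → α} (hf : Primrec f) :
    Primrec (fun x => Option.some (f x)) := Primrec.option_some.comp hf
@[fun_prop] theorem pr_obind {f : γ → Option α} {g : γ → α → Option β} (hf : Primrec f)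
    (hg : Primrec fun p : γ × α => g p.1 p.2) : Primrec (fun x => (f x).bind (g x)) :=
  Primrec.option_bind hf hg
@[fun_prop] theorem pr_omap {f : γ → Option α} {g : γ → α → β} (hf : Primrec f)
    (hg : Primrec fun p : γ × α => g p.1 p.2) : Primrec (fun x => (f x).map (g x)) :=
  Primrec.option_map hf hg
@[fun_prop] theorem pr_getD {f : γ → Option α} {g : γ → α} (hf : Primrec f)
    (hg : Primrec g) : Primrec (fun x => (f x).getD (g x)) :=
  Primrec.option_getD.comp hf hg
@[fun_prop] theorem pr_isSome {f : γ → Option α} (hf : Primrec f) :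
    Primrec (fun x => (f x).isSome) := Primrec.option_isSome.comp hf
@[fun_prop] theorem pr_elim {f : γ → Option α} {d : γ → β} {g : γ → α → β} (hf : Primrec f)
    (hd : Primrec d) (hg : Primrec fun p : γ × α => g p.1 p.2) :
    Primrec (fun x => (f x).elim (d x) (g x)) :=
  (Primrec.option_casesOn hf hd hg).of_eq fun x => by cases f x <;> rfl
@[fun_prop] theorem pr_toList {f : γ → Option α} (hf : Primrec f) :
    Primrec (fun x => (f x).toList) := Primrec.optionToList.comp hf

-- list
@[fun_prop] theorem pr_map {f : γ → List α} {g : γ → α → β} (hf : Primrec f)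
    (hg : Primrec fun p : γ × α => g p.1 p.2) : Primrec (fun x => (f x).map (g x)) :=
  Primrec.list_map hf hg
@[fun_prop] theorem pr_filterMap {f : γ → List α} {g : γ → α → Option β} (hf : Primrec f)
    (hg : Primrec fun p : γ × α => g p.1 p.2) : Primrec (fun x => (f x).filterMap (g x)) :=
  Primrec.listFilterMap hf hg
@[fun_prop] theorem pr_flatMap {f : γ → List α} {g : γ → α → List β} (hf : Primrec f)
    (hg : Primrec fun p : γ × α => g p.1 p.2) : Primrec (fun x => (f x).flatMap (g x)) :=
  Primrec.list_flatMap hf hg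
@[fun_prop] theorem pr_filter {f : γ → List α} {g : γ → α → Bool} (hf : Primrec f)
    (hg : Primrec fun p : γ × α => g p.1 p.2) : Primrec (fun x => (f x).filter (g x)) := by
  have : Primrec (fun x => (f x).filterMap (fun a => bif g x a then Option.some a else none)) := by
    fun_prop
  refine this.of_eq fun x => ?_
  induction f x with
  | nil => rfl
  | cons a l ih => simp only [List.filterMap_cons, List.filter_cons, ih]; cases g x a <;> simp
@[fun_prop] theorem pr_foldl {f : γ → List α} {i : γ → β} {g : γ → β → α → β} (hf : Primrec f)
    (hi : Primrec i) (hg : Primrec fun p : γ × β × α => g p.1 p.2.1 p.2.2) :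
    Primrec (fun x => (f x).foldl (g x) (i x)) :=
  Primrec.list_foldl (h := fun x p => g x p.1 p.2) hf hi hg
@[fun_prop] theorem pr_range {f : γ → ℕ} (hf : Primrec f) : Primrec (fun x => List.range (f x)) :=
  Primrec.list_range.comp hf
@[fun_prop] theorem pr_length {f : γ → List α} (hf : Primrec f) :
    Primrec (fun x => (f x).length) := Primrec.list_length.comp hf
@[fun_prop] theorem pr_append {f g : γ → List α} (hf : Primrec f) (hg : Primrec g) :
    Primrec (fun x => f x ++ g x) := Primrec.list_append.comp hf hg
@[fun_prop] theorem pr_cons {f : γ → α} {g : γ → List α} (hf : Primrec f) (hg : Primrec g) :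
    Primrec (fun x => f x :: g x) := Primrec.list_cons.comp hf hg
@[fun_prop] theorem pr_reverse {f : γ → List α} (hf : Primrec f) :
    Primrec (fun x => (f x).reverse) := Primrec.list_reverse.comp hf
@[fun_prop] theorem pr_head? {f : γ → List α} (hf : Primrec f) :
    Primrec (fun x => (f x).head?) := Primrec.list_head?.comp hf
@[fun_prop] theorem pr_getElem? {f : γ → List α} {g : γ → ℕ} (hf : Primrec f) (hg : Primrec g) :
    Primrec (fun x => (f x)[g x]?) := Primrec.list_getElem?.comp hf hg
@[fun_prop] theorem pr_take {f : γ → List α} {g : γ → ℕ} (hf : Primrec f) (hg : Primrec g) :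
    Primrec (fun x => (f x).take (g x)) := Primrec.list_take.comp hg hf
@[fun_prop] theorem pr_drop {f : γ → List α} {g : γ → ℕ} (hf : Primrec f) (hg : Primrec g) :
    Primrec (fun x => (f x).drop (g x)) := Primrec.list_drop.comp hg hf
@[fun_prop] theorem pr_all {f : γ → List α} {g : γ → α → Bool} (hf : Primrec f)
    (hg : Primrec fun p : γ × α => g p.1 p.2) : Primrec (fun x => (f x).all (g x)) := by
  have : Primrec (fun x => (f x).foldl (fun b a => b && g x a) true) := by fun_prop
  refine this.of_eq fun x => ?_
  have : ∀ (l : List α) b, l.foldl (fun b a => b && g x a) b = (b && l.all (g x)) := by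
    intro l; induction l with
    | nil => simp
    | cons a l ih => intro b; simp [ih, Bool.and_assoc]
  simp [this]
@[fun_prop] theorem pr_any {f : γ → List α} {g : γ → α → Bool} (hf : Primrec f)
    (hg : Primrec fun p : γ × α => g p.1 p.2) : Primrec (fun x => (f x).any (g x)) := by
  have : Primrec (fun x => (f x).foldl (fun b a => b || g x a) false) := by fun_prop
  refine this.of_eq fun x => ?_
  have : ∀ (l : List α) b, l.foldl (fun b a => b || g x a) b = (b || l.any (g x)) := by
    intro l; induction l with
    | nil => simp
    | cons a l ih => intro b; simp [ih, Bool.or_assoc]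
  simp [this]
@[fun_prop] theorem pr_find? {f : γ → List α} {g : γ → α → Bool} (hf : Primrec f)
    (hg : Primrec fun p : γ × α => g p.1 p.2) : Primrec (fun x => (f x).find? (g x)) := by
  have : Primrec (fun x => ((f x).filter (g x)).head?) := by fun_prop
  refine this.of_eq fun x => by simp
@[fun_prop] theorem pr_lsum {f : γ → List ℕ} (hf : Primrec f) : Primrec (fun x => (f x).sum) := by
  have : Primrec (fun x => (f x).foldl (fun b a => b + a) 0) := by fun_prop
  refine this.of_eq fun x => ?_
  simp [List.sum_eq_foldl]
@[fun_prop] theorem pr_replicate {f : γ → ℕ} {g : γ → α} (hf : Primrec f) (hg : Primrec g) :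
    Primrec (fun x => List.replicate (f x) (g x)) := by
  have : Primrec (fun x => (List.range (f x)).map (fun _ => g x)) := by fun_prop
  refine this.of_eq fun x => by simp
@[fun_prop] theorem pr_fsum {f : γ → ℕ} {g : γ → ℕ → ℕ} (hf : Primrec f)
    (hg : Primrec fun p : γ × ℕ => g p.1 p.2) :
    Primrec (fun x => ∑ i ∈ Finset.range (f x), g x i) := by
  have : Primrec (fun x => ((List.range (f x)).map (g x)).sum) := by fun_prop
  refine this.of_eq fun x => ?_
  induction f x with
  | zero => simp
  | succ n ih => rw [List.range_succ, Finset.sum_range_succ, ← ih]; simp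
@[fun_prop] theorem pr_natrec {f : γ → ℕ} {i : γ → β} {g : γ → ℕ → β → β} (hf : Primrec f)
    (hi : Primrec i) (hg : Primrec fun p : γ × ℕ × β => g p.1 p.2.1 p.2.2) :
    Primrec (fun x => (Nat.rec (i x) (g x) (f x) : β)) :=
  Primrec.nat_rec' (h := fun x p => g x p.1 p.2) hf hi hg
@[fun_prop] theorem pr_encode {f : γ → α} (hf : Primrec f) :
    Primrec (fun x => Encodable.encode (f x)) := Primrec.encode.comp hf
@[fun_prop] theorem pr_decode {f : γ → ℕ} (hf : Primrec f) :
    Primrec (fun x => (Encodable.decode (f x) : Option α)) := Primrec.decode.comp hf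
@[fun_prop] theorem pr_restr {f : γ → ℕ → Bool} {g : γ → ℕ} 
    (hf : Primrec fun p : γ × ℕ => f p.1 p.2) (hg : Primrec g) :
    Primrec (fun x => restrSeq (f x) (g x)) := by
  unfold restrSeq; fun_prop
@[fun_prop] theorem pr_zeroStr {g : γ → ℕ} (hg : Primrec g) :
    Primrec (fun x => zeroStr (g x)) := by
  unfold zeroStr; fun_prop
@[fun_prop] theorem pr_log2 {f : γ → ℕ} (hf : Primrec f) :
    Primrec (fun x => Nat.log 2 (f x)) := by
  have : Primrec (fun x => ((List.range (f x)).filter fun i => decide (2^(i+1) ≤ f x)).length) := by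
    fun_prop
  refine this.of_eq fun x => ?_
  have h : (List.range (f x)).filter (fun i => decide (2^(i+1) ≤ f x)) = List.range (Nat.log 2 (f x)) := by
    have h1 : Nat.log 2 (f x) ≤ f x := Nat.log_le_self 2 _
    obtain ⟨k, hk⟩ := Nat.exists_eq_add_of_le h1
    have h2 : ∀ i, 2^(i+1) ≤ f x ↔ i < Nat.log 2 (f x) := by
      intro i
      by_cases h0 : f x = 0
      · simp [h0]
      · rw [← Nat.le_log_iff_pow_le (by norm_num) h0]; omega
    simp only [h2]
    generalize Nat.log 2 (f x) = L at *
    rw [hk, List.range_add]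
    rw [List.filter_append, List.filter_eq_self.2, List.filter_eq_nil_iff.2]
    · simp
    · intro a ha; simp at ha; obtain ⟨b, hb, rfl⟩ := ha; simp
    · intro a ha; simpa using ha
  rw [h]; simp

@[fun_prop] theorem pr_evaln {f : γ → ℕ} {c : γ → Nat.Partrec.Code} {g : γ → ℕ} (hf : Primrec f)
    (hc : Primrec c) (hg : Primrec g) :
    Primrec (fun x => Nat.Partrec.Code.evaln (f x) (c x) (g x)) :=
  Nat.Partrec.Code.primrec_evaln.comp ((hf.pair hc).pair hg)

end PR

/-- history recursion -/
def hist {σ : Type} (step : List σ → σ) : ℕ → List σ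
  | 0 => []
  | s+1 => hist step s ++ [step (hist step s)]

theorem hist_length {σ : Type} (step : List σ → σ) (s : ℕ) : (hist step s).length = s := by
  induction s with
  | zero => rfl
  | succ s ih => simp [hist, ih]

theorem pr_hist {σ : Type} [Primcodable σ] {step : List σ → σ} (h : Primrec step) :
    Primrec (hist step) := by
  have : Primrec (fun s : ℕ => (Nat.rec [] (fun _ l => l ++ [step l]) s : List σ)) := by
    fun_prop
  refine this.of_eq fun s => ?_
  induction s with
  | zero => rfl
  | succ s ih => simp [hist, ← ih]

theorem hist_getElem? {σ : Type} (step : List σ → σ) (s t : ℕ) (h : t < s) :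
    (hist step s)[t]? = Option.some (step (hist step t)) := by
  induction s with
  | zero => omega
  | succ s ih =>
    simp only [hist]
    rcases Nat.lt_succ_iff_lt_or_eq.1 h with h | rfl
    · rw [List.getElem?_append_left (by simpa [hist_length] using h), ih h]
    · rw [List.getElem?_append_right (by simp [hist_length])]; simp [hist_length]

theorem hist_eq_map {σ : Type} (step : List σ → σ) (s : ℕ) :
    hist step s = (List.range s).map fun t => step (hist step t) := by
  induction s with
  | zero => rfl
  | succ s ih => rw [hist, List.range_succ, List.map_append, ← ih]; rfl

/-! restr lemmas -/
@[simp] theorem restr_length (X : ℕ → Bool) (n : ℕ) : (restrSeq X n).length = n := by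
  simp [restrSeq]
@[simp] theorem zeroStr_length (n : ℕ) : (zeroStr n).length = n := by simp [zeroStr]
theorem restr_eq_iff {X Y : ℕ → Bool} {n : ℕ} :
    restrSeq X n = restrSeq Y n ↔ ∀ i < n, X i = Y i := by
  simp [restrSeq]
theorem restr_getElem? (X : ℕ → Bool) {n i : ℕ} (h : i < n) :
    (restrSeq X n)[i]? = Option.some (X i) := by simp [restrSeq, h]
theorem restr_take (X : ℕ → Bool) {n i : ℕ} (h : i ≤ n) :
    (restrSeq X n).take i = restrSeq X i := by
  simp [restrSeq, ← List.map_take, List.take_range, h]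
theorem restr_eq_mono {X Y : ℕ → Bool} {n m : ℕ} (h : m ≤ n) (he : restrSeq X n = restrSeq Y n) :
    restrSeq X m = restrSeq Y m := by
  rw [restr_eq_iff] at *; exact fun i hi => he i (by omega)
theorem zeroStr_eq (n : ℕ) : zeroStr n = restrSeq (fun _ => false) n := by
  apply List.ext_getElem <;> simp [zeroStr, restrSeq]

theorem KC_le_iff {M : Str →. Str} {σ : Str} {k : ℕ} :
    KC M σ ≤ k ↔ ∃ ρ, σ ∈ M ρ ∧ ρ.length ≤ k := by
  unfold KC
  constructor
  · intro h
    by_contra hc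
    push Not at hc
    have : ((k+1 : ℕ) : ℕ∞) ≤ ⨅ ρ : {ρ // σ ∈ M ρ}, ((ρ : Str).length : ℕ∞) := by
      refine le_iInf fun ρ => ?_
      exact_mod_cast hc ρ.1 ρ.2
    have := this.trans h
    norm_cast at this
    omega
  · rintro ⟨ρ, h1, h2⟩
    refine (iInf_le _ (⟨ρ, h1⟩ : {ρ // σ ∈ M ρ})).trans ?_
    exact_mod_cast h2

theorem KC_le_add {M N : Str →. Str} {σ τ : Str} {c : ℕ} 
    (h : ∀ k : ℕ, KC M σ ≤ k → KC N τ ≤ (k + c : ℕ)) : KC N τ ≤ KC M σ + c := by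
  rcases eq_or_ne (KC M σ) ⊤ with h0 | h0
  · rw [h0]; simp
  · obtain ⟨k, hk⟩ := ENat.ne_top_iff_exists.1 h0
    rw [← hk]
    exact_mod_cast h k hk.ge


theorem half_mul (n : ℕ) : (1 / 2 : ℝ) ^ n * 2 ^ n = 1 := by
  rw [← mul_pow]; norm_num
theorem mul_half (n : ℕ) : (2 : ℝ) ^ n * (1 / 2) ^ n = 1 := by
  rw [← mul_pow]; norm_num

/-! ### enumerating partial recursive functions -/
section Enum
variable {α β : Type} [Primcodable α] [Primcodable β]

def codeOK (c : Nat.Partrec.Code) (n k m : ℕ) : Bool :=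
  decide (Nat.Partrec.Code.evaln k c n = Option.some m) &&
    (decide (k = 0) || !(Nat.Partrec.Code.evaln (k-1) c n).isSome)

def enumOf (α β : Type) [Primcodable α] [Primcodable β] (c : Nat.Partrec.Code) (t : ℕ) :
    Option (α × β) :=
  (Encodable.decode (α := α) t.unpair.1).bind fun a =>
    (Encodable.decode (α := β) t.unpair.2.unpair.2).bind fun b =>
      bif codeOK c (Encodable.encode a) t.unpair.2.unpair.1 (Encodable.encode b) &&
         decide (Encodable.encode a = t.unpair.1) && decide (Encodable.encode b = t.unpair.2.unpair.2)
      then Option.some (a, b) else none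

theorem pr_enumOf (c : Nat.Partrec.Code) : Primrec (enumOf α β c) := by
  unfold enumOf codeOK; fun_prop

theorem exists_enum {g : α →. β} (hg : Partrec g) :
    ∃ u : ℕ → Option (α × β), Primrec u ∧ (∀ a b, b ∈ g a ↔ ∃ t, u t = Option.some (a, b)) ∧
      (∀ t t' a b b', u t = Option.some (a, b) → u t' = Option.some (a, b') → t = t') ∧
      ∀ t a b, u t = Option.some (a, b) → Encodable.encode a ≤ t ∧ Encodable.encode b ≤ t := by
  obtain ⟨c, hc⟩ := Nat.Partrec.Code.exists_code.1 hg
  have key : ∀ a b, b ∈ g a ↔ Encodable.encode b ∈ c.eval (Encodable.encode a) := by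
    intro a b; rw [hc]; simp
  have hspec : ∀ t a b, enumOf α β c t = Option.some (a, b) ↔ ∃ k,
      t = Nat.pair (Encodable.encode a) (Nat.pair k (Encodable.encode b)) ∧
      codeOK c (Encodable.encode a) k (Encodable.encode b) = true := by
    intro t a b
    constructor
    · intro h
      unfold enumOf at h
      rw [Option.bind_eq_some_iff] at h
      obtain ⟨a', h1, h⟩ := h
      rw [Option.bind_eq_some_iff] at h
      obtain ⟨b', h2, h⟩ := h
      rw [Bool.cond_eq_ite] at h
      split_ifs at h with h3
      simp only [Option.some.injEq, Prod.mk.injEq] at h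
      obtain ⟨rfl, rfl⟩ := h
      simp only [Bool.and_eq_true, decide_eq_true_eq] at h3
      refine ⟨t.unpair.2.unpair.1, ?_, h3.1.1⟩
      rw [h3.1.2, h3.2]; simp
    · rintro ⟨k, rfl, h⟩
      simp [enumOf, h]
  have huniq : ∀ n k m k' m', codeOK c n k m = true → codeOK c n k' m' = true → k = k' ∧ m = m' := by
    have aux : ∀ n k m k' m', codeOK c n k m = true → codeOK c n k' m' = true → k ≤ k' := by
      intro n k m k' m' h h'
      by_contra hlt
      simp only [codeOK, Bool.and_eq_true, decide_eq_true_eq, Bool.or_eq_true, Bool.not_eq_true',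
        Option.isSome_eq_false_iff, Option.isNone_iff_eq_none] at h h'
      rcases h.2 with h2 | h2
      · omega
      · have := Nat.Partrec.Code.evaln_mono (show k' ≤ k - 1 by omega) h'.1
        rw [h2] at this; simp at this
    intro n k m k' m' h h'
    have e : k = k' := le_antisymm (aux _ _ _ _ _ h h') (aux _ _ _ _ _ h' h)
    subst e
    simp only [codeOK, Bool.and_eq_true, decide_eq_true_eq] at h h'
    have := h.1.symm.trans h'.1
    simp at this
    exact ⟨rfl, this⟩
  refine ⟨enumOf α β c, pr_enumOf c, ?_, ?_, ?_⟩
  · intro a b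
    rw [key, Nat.Partrec.Code.evaln_complete]
    constructor
    · intro h
      have h := Nat.find_spec h
      set h' := (Nat.Partrec.Code.evaln_complete (c := c) (n := Encodable.encode a) (x := Encodable.encode b))
      have hex : ∃ k, Encodable.encode b ∈ Nat.Partrec.Code.evaln k c (Encodable.encode a) := ⟨_, h⟩
      refine ⟨Nat.pair (Encodable.encode a) (Nat.pair (Nat.find hex) (Encodable.encode b)), ?_⟩
      rw [hspec]
      refine ⟨_, rfl, ?_⟩
      simp only [codeOK, Bool.and_eq_true, decide_eq_true_eq, Bool.or_eq_true, Bool.not_eq_true',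
        Option.isSome_eq_false_iff, Option.isNone_iff_eq_none]
      refine ⟨Nat.find_spec hex, ?_⟩
      by_cases h0 : Nat.find hex = 0
      · exact Or.inl h0
      · right
        by_contra hne
        obtain ⟨m, hm⟩ := Option.ne_none_iff_exists'.1 hne
        have := Nat.Partrec.Code.evaln_mono (show Nat.find hex - 1 ≤ Nat.find hex by omega) hm
        have h2 := Nat.find_spec hex
        rw [Option.mem_def] at this h2
        rw [this] at h2
        simp at h2
        subst h2
        exact Nat.find_min hex (show Nat.find hex - 1 < Nat.find hex by omega) hm
    · rintro ⟨t, ht⟩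
      obtain ⟨k, -, h⟩ := (hspec _ _ _).1 ht
      simp only [codeOK, Bool.and_eq_true, decide_eq_true_eq] at h
      exact ⟨k, h.1⟩
  · intro t t' a b b' h h'
    obtain ⟨k, rfl, h1⟩ := (hspec _ _ _).1 h
    obtain ⟨k', rfl, h1'⟩ := (hspec _ _ _).1 h'
    obtain ⟨rfl, h2⟩ := huniq _ _ _ _ _ h1 h1'
    rw [h2]
  · intro t a b h
    obtain ⟨k, rfl, h⟩ := (hspec _ _ _).1 h
    exact ⟨Nat.left_le_pair _ _, (Nat.right_le_pair _ _).trans (Nat.right_le_pair _ _)⟩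

end Enum

/-! ### binary value of strings -/
def bval (ρ : Str) : ℕ := ρ.foldl (fun v b => 2 * v + bif b then 1 else 0) 0

@[fun_prop] theorem pr_bval {γ : Type} [Primcodable γ] {f : γ → Str} (hf : Primrec f) :
    Primrec fun x => bval (f x) := by
  unfold bval; fun_prop

theorem bval_foldl (ρ : Str) (v : ℕ) :
    ρ.foldl (fun v b => 2 * v + bif b then 1 else 0) v = v * 2 ^ ρ.length + bval ρ := by
  unfold bval
  induction ρ generalizing v with
  | nil => simp
  | cons b ρ ih =>
    simp only [List.foldl_cons, List.length_cons]
    rw [ih, ih (2 * 0 + _)]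
    ring

theorem bval_append (ρ τ : Str) : bval (ρ ++ τ) = bval ρ * 2 ^ τ.length + bval τ := by
  rw [bval, List.foldl_append, bval_foldl]; rfl

theorem bval_lt (ρ : Str) : bval ρ < 2 ^ ρ.length := by
  induction ρ using List.reverseRecOn with
  | nil => simp [bval]
  | append_singleton ρ b ih =>
    rw [bval_append]
    have : bval [b] ≤ 1 := by cases b <;> simp [bval]
    simp only [List.length_append, List.length_singleton, pow_succ]
    omega

theorem exists_bval (k n : ℕ) (h : n < 2 ^ k) : ∃ ρ : Str, ρ.length = k ∧ bval ρ = n := by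
  induction k generalizing n with
  | zero => exact ⟨[], rfl, by simp at h; simp [h, bval]⟩
  | succ k ih =>
    obtain ⟨ρ, h1, h2⟩ := ih (n / 2) (by rw [pow_succ] at h; omega)
    refine ⟨ρ ++ [decide (n % 2 = 1)], by simp [h1], ?_⟩
    rw [bval_append, h2]
    rcases Nat.mod_two_eq_zero_or_one n with h3 | h3 <;> simp [bval, h3] <;> omega

/-! ### Kraft -/
theorem prefixfree_ud (S : Set Str) (h0 : [] ∉ S)
    (h : ∀ a ∈ S, ∀ b ∈ S, a <+: b → a = b) : InformationTheory.UniquelyDecodable S := by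
  intro L₁
  induction L₁ with
  | nil =>
    intro L₂ _ h2 he
    cases L₂ with
    | nil => rfl
    | cons b L₂ =>
      exfalso
      have hb := h2 b (by simp)
      simp at he
      exact h0 (he.1 ▸ hb)
  | cons a L₁ ih =>
    intro L₂ h1 h2 he
    cases L₂ with
    | nil =>
      exfalso
      have hb := h1 a (by simp)
      simp at he
      exact h0 (he.1 ▸ hb)
    | cons b L₂ =>
      simp only [List.flatten_cons] at he
      have hab : a = b := by
        have e1 : a <+: a ++ L₁.flatten := List.prefix_append a L₁.flatten
        have e2 : b <+: a ++ L₁.flatten := he ▸ List.prefix_append b L₂.flatten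
        have h4 : a <+: b ∨ b <+: a := (le_total a.length b.length).imp
          (List.prefix_of_prefix_length_le e1 e2) (List.prefix_of_prefix_length_le e2 e1)
        rcases h4 with h3 | h3
        · exact h a (h1 a (by simp)) b (h2 b (by simp)) h3
        · exact (h b (h2 b (by simp)) a (h1 a (by simp)) h3).symm
      subst hab
      have he' := List.append_cancel_left he
      rw [ih L₂ (fun w hw => h1 w (by simp [hw])) (fun w hw => h2 w (by simp [hw])) he']

theorem kraft (S : Finset Str) (h : ∀ a ∈ S, ∀ b ∈ S, a <+: b → a = b) :
    ∑ a ∈ S, (1 / 2 : ℝ) ^ a.length ≤ 1 := by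
  by_cases h0 : [] ∈ S
  · have : S = {[]} := by
      ext b
      simp only [Finset.mem_singleton]
      exact ⟨fun hb => (h [] h0 b hb ⟨b, rfl⟩).symm, fun hb => hb ▸ h0⟩
    rw [this]; simp
  · have := InformationTheory.kraft_mcmillan_inequality (S := S) (α := Bool)
      (prefixfree_ud _ (by simpa using h0) (by simpa using h))
    simpa using this

/-! ### Kraft–Chaitin -/
noncomputable def rw' (o : Option (ℕ × Str)) : ℝ := o.elim 0 fun p => (1 / 2 : ℝ) ^ p.1

theorem rw'_nonneg (o : Option (ℕ × Str)) : 0 ≤ rw' o := by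
  cases o <;> simp [rw']

def rlen (o : Option (ℕ × Str)) : ℕ := o.elim 0 fun p => p.1

def kcq (r : ℕ → Option (ℕ × Str)) (i : ℕ) : ℕ :=
  ((∑ j ∈ Finset.range i, (r j).elim 0 fun p => 2 ^ ((∑ j ∈ Finset.range i, rlen (r j)) - p.1)) *
    2 ^ (rlen (r i) + 1) + 2 ^ (∑ j ∈ Finset.range i, rlen (r j)) - 1) /
    2 ^ (∑ j ∈ Finset.range i, rlen (r j))

def kcm (r : ℕ → Option (ℕ × Str)) (ρ : Str) (i : ℕ) : Option Str :=
  (r i).bind fun p => bif decide (ρ.length = p.1 + 1) && decide (bval ρ = kcq r i) then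
    Option.some p.2 else none

theorem kcm_spec {r : ℕ → Option (ℕ × Str)} {ρ : Str} {i : ℕ} {σ : Str} :
    kcm r ρ i = Option.some σ ↔ ∃ ℓ, r i = Option.some (ℓ, σ) ∧ ρ.length = ℓ + 1 ∧ bval ρ = kcq r i := by
  unfold kcm
  rw [Option.bind_eq_some_iff]
  constructor
  · rintro ⟨⟨ℓ, σ'⟩, h1, h⟩
    rw [Bool.cond_eq_ite] at h
    split_ifs at h with h3
    simp at h h3
    subst h
    exact ⟨ℓ, h1, h3⟩
  · rintro ⟨ℓ, h1, h2, h3⟩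
    exact ⟨_, h1, by simp [h2, h3]⟩

theorem kcq_bounds (r : ℕ → Option (ℕ × Str)) (i : ℕ) :
    (∑ j ∈ Finset.range i, rw' (r j)) * 2 ^ (rlen (r i) + 1) ≤ kcq r i ∧
    (kcq r i : ℝ) < (∑ j ∈ Finset.range i, rw' (r j)) * 2 ^ (rlen (r i) + 1) + 1 := by
  set N := ∑ j ∈ Finset.range i, rlen (r j) with hN
  set A : ℕ := ∑ j ∈ Finset.range i, (r j).elim 0 fun p => 2 ^ (N - p.1) with hA
  have hAS : (A : ℝ) = (∑ j ∈ Finset.range i, rw' (r j)) * 2 ^ N := by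
    rw [hA, Finset.sum_mul]
    push_cast
    refine Finset.sum_congr rfl fun j hj => ?_
    have : rlen (r j) ≤ N := Finset.single_le_sum (f := fun j => rlen (r j)) (fun _ _ => Nat.zero_le _) hj
    cases h : r j with
    | none => simp [rw']
    | some p =>
      simp only [rlen, h, Option.elim] at this
      simp only [Option.elim, rw']
      push_cast
      rw [pow_sub₀ _ (by norm_num) this]
      field_simp
      rw [mul_half]
  have hq : kcq r i = (A * 2 ^ (rlen (r i) + 1) + 2 ^ N - 1) / 2 ^ N := rfl
  set B := A * 2 ^ (rlen (r i) + 1) with hB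
  have hBS : (B : ℝ) = (∑ j ∈ Finset.range i, rw' (r j)) * 2 ^ (rlen (r i) + 1) * 2 ^ N := by
    rw [hB]; push_cast; rw [hAS]; ring
  have hpos : 0 < 2 ^ N := by positivity
  have h1 : B ≤ kcq r i * 2 ^ N := by
    rw [hq]
    have := Nat.div_add_mod (B + 2 ^ N - 1) (2 ^ N)
    have h2 := Nat.mod_lt (B + 2 ^ N - 1) hpos
    rw [mul_comm]
    omega
  have h2 : kcq r i * 2 ^ N < B + 2 ^ N := by
    have := Nat.div_mul_le_self (B + 2 ^ N - 1) (2 ^ N)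
    rw [hq]; omega
  have hposR : (0 : ℝ) < 2 ^ N := by positivity
  constructor
  · have : (B : ℝ) ≤ kcq r i * 2 ^ N := by exact_mod_cast h1
    rw [hBS] at this
    exact le_of_mul_le_mul_right this hposR
  · have : (kcq r i * 2 ^ N : ℝ) < B + 2 ^ N := by exact_mod_cast h2
    rw [hBS] at this
    have h3 : (kcq r i * 2 ^ N : ℝ) < ((∑ j ∈ Finset.range i, rw' (r j)) * 2 ^ (rlen (r i) + 1) + 1) * 2 ^ N := by
      linarith
    exact lt_of_mul_lt_mul_right h3 hposR.le

theorem kc_pf {r : ℕ → Option (ℕ × Str)} {ρ ρ' : Str} {i i' : ℕ} {σ σ' : Str}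
    (h : kcm r ρ i = Option.some σ) (h' : kcm r ρ' i' = Option.some σ') (hp : ρ <+: ρ') :
    i = i' := by
  obtain ⟨ℓ, h1, h2, h3⟩ := kcm_spec.1 h
  obtain ⟨ℓ', h1', h2', h3'⟩ := kcm_spec.1 h'
  obtain ⟨τ, rfl⟩ := hp
  have hv := bval_append ρ τ
  have hτ := bval_lt τ
  have b1 := kcq_bounds r i
  have b2 := kcq_bounds r i'
  rw [← h3] at b1
  rw [← h3'] at b2
  have e1 : rlen (r i) = ℓ := by simp [rlen, h1]
  have e2 : rlen (r i') = ℓ' := by simp [rlen, h1']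
  rw [e1] at b1
  rw [e2] at b2
  have hlen : ℓ' + 1 = ℓ + 1 + τ.length := by
    rw [List.length_append] at h2'; omega
  rw [hlen] at b2
  set S := ∑ j ∈ Finset.range i, rw' (r j) with hS
  set S' := ∑ j ∈ Finset.range i', rw' (r j) with hS'
  set T : ℝ := 2 ^ τ.length with hT
  have hTpos : 1 ≤ T := one_le_pow₀ (by norm_num)
  set L : ℝ := 2 ^ (ℓ + 1) with hL
  have hLpos : 0 < L := by positivity
  have hLT : (2 : ℝ) ^ (ℓ + 1 + τ.length) = L * T := by rw [pow_add]
  rw [hLT] at b2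
  have hvR : (bval (ρ ++ τ) : ℝ) = bval ρ * T + bval τ := by rw [hv]; push_cast; rfl
  have hτR : (bval τ : ℝ) + 1 ≤ T := by
    have : bval τ + 1 ≤ 2 ^ τ.length := hτ
    rw [hT]; exact_mod_cast this
  rw [hvR] at b2
  have hmono : ∀ a b, a < b → ∑ j ∈ Finset.range a, rw' (r j) + rw' (r a) ≤ ∑ j ∈ Finset.range b, rw' (r j) := by
    intro a b hab
    rw [← Finset.sum_range_succ]
    exact Finset.sum_le_sum_of_subset_of_nonneg (Finset.range_subset_range.2 hab) fun _ _ _ => rw'_nonneg _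
  have hL2 : rw' (r i) * L = 2 := by
    simp only [h1, rw', hL, Option.elim]; rw [pow_succ]; field_simp; rw [half_mul]
  have hL2' : rw' (r i') * (L * T) = 2 := by
    rw [← hLT, ← hlen]
    simp only [h1', rw', Option.elim]; rw [pow_succ]; field_simp; rw [half_mul]
  have hτ0 : (0:ℝ) ≤ bval τ := by positivity
  rcases lt_trichotomy i i' with hlt | heq | hlt
  · exfalso
    have := hmono _ _ hlt
    have h5 : (S + rw' (r i)) * L * T ≤ S' * L * T := by gcongr
    have h6 : (bval ρ : ℝ) + 1 < S * L + 2 := by linarith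
    have h7 : ((bval ρ : ℝ) + 1) * T < (S * L + 2) * T := by gcongr
    have h8 : (S + rw' (r i)) * L * T = (S * L + 2) * T := by rw [add_mul, hL2]
    nlinarith [b2.1]
  · exact heq
  · exfalso
    have := hmono _ _ hlt
    have h5 : (S' + rw' (r i')) * (L * T) ≤ S * (L * T) := by gcongr
    rw [add_mul, hL2'] at h5
    have h6 : S * L * T ≤ bval ρ * T := by gcongr; exact b1.1
    nlinarith [b2.2]

theorem pr_kcm {r : ℕ → Option (ℕ × Str)} (hr : Primrec r) :
    Primrec fun p : Str × ℕ => kcm r p.1 p.2 := by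
  unfold kcm kcq rlen; fun_prop

theorem kc_thm {r : ℕ → Option (ℕ × Str)} (hr : Primrec r)
    (hsum : ∀ s, ∑ i ∈ Finset.range s, rw' (r i) ≤ 1) :
    ∃ M : Str →. Str, PFMachine M ∧ ∀ i ℓ σ, r i = Option.some (ℓ, σ) → KC M σ ≤ (ℓ + 1 : ℕ) := by
  refine ⟨fun ρ => Nat.rfindOpt (kcm r ρ), ⟨?_, ?_⟩, ?_⟩
  · exact Partrec.rfindOpt (Primrec.to_comp (pr_kcm hr)).to₂
  · intro ρ₁ ρ₂ h1 h2 hp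
    obtain ⟨i, σ, h1⟩ := Nat.rfindOpt_dom.1 h1
    obtain ⟨i', σ', h2⟩ := Nat.rfindOpt_dom.1 h2
    have := kc_pf h1 h2 hp
    subst this
    obtain ⟨ℓ, h1, e1, -⟩ := kcm_spec.1 h1
    obtain ⟨ℓ', h1', e2, -⟩ := kcm_spec.1 h2
    rw [h1] at h1'
    simp at h1'
    exact hp.eq_of_length (by omega)
  · intro i ℓ σ h
    have hq : kcq r i < 2 ^ (ℓ + 1) := by
      have hb := (kcq_bounds r i).2
      have e1 : rlen (r i) = ℓ := by simp [rlen, h]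
      rw [e1] at hb
      have h2 := hsum (i+1)
      rw [Finset.sum_range_succ] at h2
      have hL2 : rw' (r i) * 2 ^ (ℓ + 1) = 2 := by
        simp only [h, rw', Option.elim]; rw [pow_succ]; field_simp; rw [half_mul]
      have hpos : (0 : ℝ) < 2 ^ (ℓ + 1) := by positivity
      have : (kcq r i : ℝ) < 2 ^ (ℓ + 1) := by nlinarith
      exact_mod_cast this
    obtain ⟨ρ, h1, h2⟩ := exists_bval _ _ hq
    refine KC_le_iff.2 ⟨ρ, ?_, h1.le⟩
    have hm : kcm r ρ i = Option.some σ := kcm_spec.2 ⟨ℓ, h, h1, h2⟩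
    have hd : (Nat.rfindOpt (kcm r ρ)).Dom := Nat.rfindOpt_dom.2 ⟨i, σ, hm⟩
    obtain ⟨i', h3⟩ := Nat.rfindOpt_spec (Part.get_mem hd)
    have : i = i' := kc_pf hm h3 List.prefix_rfl
    subst this
    rw [Option.mem_def, hm] at h3
    simp at h3
    rw [h3]
    exact Part.get_mem hd

theorem kc_opt {U : Str →. Str} (hU : OptimalPF U) {r : ℕ → Option (ℕ × Str)} (hr : Primrec r)
    (hsum : ∀ s, ∑ i ∈ Finset.range s, rw' (r i) ≤ 1) :
    ∃ c : ℕ, ∀ i ℓ σ, r i = Option.some (ℓ, σ) → KC U σ ≤ (ℓ + c : ℕ) := by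
  obtain ⟨M, hM, h⟩ := kc_thm hr hsum
  obtain ⟨c, hc⟩ := hU.2 M hM
  refine ⟨c + 1, fun i ℓ σ hi => (hc σ).trans ?_⟩
  have := h i ℓ σ hi
  calc KC M σ + c ≤ ((ℓ + 1 : ℕ) : ℕ∞) + c := by gcongr
    _ = _ := by push_cast; ring

/-- version for partial recursive request functions -/
theorem kc_opt_part {U : Str →. Str} (hU : OptimalPF U) {g : ℕ →. ℕ × Str} (hg : Partrec g)
    (hsum : ∀ (F : Finset ℕ) (ℓ : ℕ → ℕ), (∀ x ∈ F, ∃ σ, (ℓ x, σ) ∈ g x) → ∑ x ∈ F, (1 / 2 : ℝ) ^ ℓ x ≤ 1) :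
    ∃ c : ℕ, ∀ x ℓ σ, (ℓ, σ) ∈ g x → KC U σ ≤ (ℓ + c : ℕ) := by
  obtain ⟨u, hu, h1, h2, -⟩ := exists_enum hg
  obtain ⟨c, hc⟩ := kc_opt hU (r := fun t => (u t).map fun p => p.2) (by fun_prop) (by
    intro s
    set V := (Finset.range s).filter fun t => (u t).isSome
    set f : ℕ → ℕ := fun t => (u t).elim 0 fun p => p.1
    have hinj : Set.InjOn f V := by
      intro t ht t' ht' e
      simp [V, Option.isSome_iff_exists] at ht ht'
      obtain ⟨-, x, ℓ, σ, ht⟩ := ht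
      obtain ⟨-, x', ℓ', σ', ht'⟩ := ht'
      simp [f, ht, ht'] at e
      subst e
      exact h2 _ _ _ _ _ ht ht'
    choose! L hL using (show ∀ x, (∃ ℓ σ, (ℓ, σ) ∈ g x) → ∃ ℓ, ∃ σ, (ℓ, σ) ∈ g x from fun x h => h)
    have e1 : ∑ i ∈ Finset.range s, rw' ((u i).map fun p => p.2) = ∑ x ∈ V.image f, (1 / 2 : ℝ) ^ L x := by
      rw [Finset.sum_image hinj, Finset.sum_filter]
      refine Finset.sum_congr rfl fun t _ => ?_
      rcases h : u t with _ | ⟨x, ℓ, σ⟩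
      · simp [rw']
      · have hm : (ℓ, σ) ∈ g x := (h1 _ _).2 ⟨t, h⟩
        obtain ⟨σ', hσ'⟩ := hL x ⟨ℓ, σ, hm⟩
        have := Part.mem_unique hm hσ'
        simp at this
        simp [rw', f, h, this.1]
    rw [e1]
    refine hsum _ _ fun x hx => ?_
    simp only [Finset.mem_image, V, Finset.mem_filter, Option.isSome_iff_exists] at hx
    obtain ⟨t, ⟨-, ⟨x', ℓ, σ⟩, ht⟩, hx⟩ := hx
    simp [f, ht] at hx
    subst hx
    exact hL _ ⟨ℓ, σ, (h1 _ _).2 ⟨t, ht⟩⟩)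
  refine ⟨c, fun x ℓ σ h => ?_⟩
  obtain ⟨t, ht⟩ := (h1 _ _).1 h
  exact hc t ℓ σ (by simp [ht])


/-! ### reals -/
noncomputable def rterm (X : ℕ → Bool) (i : ℕ) : ℝ := cond (X i) ((2 : ℝ) ^ (i + 1))⁻¹ 0

theorem rterm_nonneg (X : ℕ → Bool) (i : ℕ) : 0 ≤ rterm X i := by
  unfold rterm; cases X i <;> simp

theorem rterm_le (X : ℕ → Bool) (i : ℕ) : rterm X i ≤ (1 / 2 : ℝ) ^ i * (1 / 2) := by
  have : (1 / 2 : ℝ) ^ i * (1 / 2) = ((2 : ℝ) ^ (i + 1))⁻¹ := by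
    rw [← pow_succ]; simp
  rw [this]
  unfold rterm; cases X i <;> simp

theorem geo_summable : Summable fun i : ℕ => (1 / 2 : ℝ) ^ i * (1 / 2) :=
  (summable_geometric_of_lt_one (by norm_num) (by norm_num)).mul_right _

theorem rterm_summable (X : ℕ → Bool) : Summable (rterm X) :=
  Summable.of_nonneg_of_le (rterm_nonneg X) (rterm_le X) geo_summable

theorem realOfSeq_eq (X : ℕ → Bool) : realOfSeq X = ∑' i, rterm X i := rfl

theorem realOfSeq_nonneg (X : ℕ → Bool) : 0 ≤ realOfSeq X := tsum_nonneg (rterm_nonneg X)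

theorem geo_tsum : ∑' i : ℕ, (1 / 2 : ℝ) ^ i * (1 / 2) = 1 := by
  rw [tsum_mul_right, tsum_geometric_two]; norm_num

theorem realOfSeq_pos (X : ℕ → Bool) (i : ℕ) (h : X i = true) : 0 < realOfSeq X :=
  (rterm_summable X).tsum_pos (rterm_nonneg X) i (by unfold rterm; simp [h])

theorem realOfSeq_lt_one (X : ℕ → Bool) (i : ℕ) (h : X i = false) : realOfSeq X < 1 := by
  rw [← geo_tsum]
  refine Summable.tsum_lt_tsum (rterm_le X) (i := i) ?_ (rterm_summable X) geo_summable
  simp [rterm, h]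

theorem realOfSeq_step (X : ℕ → Bool) :
    realOfSeq X = ((bif X 0 then 1 else 0) + realOfSeq (fun i => X (i+1))) / 2 := by
  rw [realOfSeq_eq, (rterm_summable X).tsum_eq_zero_add, realOfSeq_eq, add_div, ← tsum_div_const]
  congr 1
  · unfold rterm; cases X 0 <;> simp
  · refine tsum_congr fun i => ?_
    unfold rterm; rcases h : X (i+1) with _ | _
    · simp [h]
    · simp only [h, cond_true]; rw [pow_succ]; field_simp

def vpre (X : ℕ → Bool) : ℕ → ℕ
  | 0 => 0
  | n+1 => 2 * vpre X n + bif X n then 1 else 0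

theorem realOfSeq_vpre (X : ℕ → Bool) (n : ℕ) :
    realOfSeq X * 2 ^ n = vpre X n + realOfSeq (fun i => X (i + n)) := by
  induction n with
  | zero => simp [vpre]
  | succ n ih =>
    rw [pow_succ, ← mul_assoc, ih, realOfSeq_step]
    simp only [vpre]
    push_cast
    simp only [add_comm, add_left_comm, zero_add]
    cases X n <;> simp <;> ring

theorem ce_mono {f : ℕ → ℤ} (h : ∀ s, (f s : ℝ) / 2 ^ s ≤ (f (s + 1) : ℝ) / 2 ^ (s + 1)) :
    Monotone fun s => (f s : ℝ) / 2 ^ s := monotone_nat_of_le_succ h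

theorem ce_approx {X : ℕ → Bool} (h : CEReal X) :
    ∃ G : ℕ → ℕ × ℕ, Primrec G ∧ Monotone (fun s => ((G s).1 : ℝ) / 2 ^ (G s).2) ∧
      Tendsto (fun s => ((G s).1 : ℝ) / 2 ^ (G s).2) atTop (nhds (realOfSeq X)) := by
  obtain ⟨f, hf, hmono, hlim⟩ := h
  have hmono := ce_mono hmono
  have hg : Computable fun s => (f s).toNat := by
    have h1 : Primrec (fun n : ℤ => n.toNat) := by
      have hp : Primrec fun m : ℕ => bif decide (m % 2 = 0) then m / 2 else 0 := by fun_prop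
      have : Primrec fun n : ℤ => (fun m : ℕ => bif decide (m % 2 = 0) then m / 2 else 0) (Encodable.encode n) :=
        hp.comp Primrec.encode
      refine this.of_eq fun n => ?_
      cases n with
      | ofNat n =>
        have : Encodable.encode (Int.ofNat n) = 2 * n := rfl
        show (bif decide (Encodable.encode (Int.ofNat n) % 2 = 0) then
          Encodable.encode (Int.ofNat n) / 2 else 0) = n
        rw [this]; simp
      | negSucc n =>
        have : Encodable.encode (Int.negSucc n) = 2 * n + 1 := rfl
        simp [this]
    exact h1.to_comp.comp hf
  have hgp : Nat.Partrec (fun s => Part.some (f s).toNat) := Partrec.nat_iff.1 hg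
  obtain ⟨c, hc⟩ := Nat.Partrec.Code.exists_code.1 hgp
  set ks : ℕ → Option ℕ := fun s =>
    ((List.range s).reverse.find? fun k => (Nat.Partrec.Code.evaln s c k).isSome) with hks
  set G : ℕ → ℕ × ℕ := fun s => (ks s).elim (0, 0) fun k =>
    ((Nat.Partrec.Code.evaln s c k).getD 0, k) with hG
  have hval : ∀ s k, (Nat.Partrec.Code.evaln s c k).isSome → 
      Nat.Partrec.Code.evaln s c k = Option.some (f k).toNat := by
    intro s k h
    obtain ⟨m, hm⟩ := Option.isSome_iff_exists.1 h
    have := Nat.Partrec.Code.evaln_sound hm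
    rw [hc] at this
    simp at this
    rw [hm, this]
  have hkspec : ∀ s k, ks s = Option.some k → (Nat.Partrec.Code.evaln s c k).isSome ∧
      ∀ k', (Nat.Partrec.Code.evaln s c k').isSome → k' ≤ k := by
    intro s k h
    simp only [hks] at h
    refine ⟨(List.find?_some (p := fun k => (Nat.Partrec.Code.evaln s c k).isSome) h), ?_⟩
    intro k' hk'
    have hlt : k' < s := by
      obtain ⟨m, hm⟩ := Option.isSome_iff_exists.1 hk'
      exact Nat.Partrec.Code.evaln_bound hm
    by_contra hkk
    push Not at hkk
    rw [List.find?_eq_some_iff_append] at h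
    obtain ⟨-, as, bs, h1, h2⟩ := h
    have hs : List.Pairwise (· > ·) (as ++ k :: bs) := by
      rw [← h1]; exact List.pairwise_reverse.2 (by simpa using List.pairwise_lt_range)
    have hm : k' ∈ as ++ k :: bs := by rw [← h1]; simpa using hlt
    rw [List.pairwise_append] at hs
    rcases List.mem_append.1 hm with hm | hm
    · have := h2 k' hm; simp [hk'] at this
    · rcases List.mem_cons.1 hm with hm | hm
      · omega
      · have := List.rel_of_pairwise_cons hs.2.1 hm; omega
  have hknone : ∀ s, ks s = Option.none → ∀ k, ¬ (Nat.Partrec.Code.evaln s c k).isSome := by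
    intro s h k hk
    have hlt : k < s := by
      obtain ⟨m, hm⟩ := Option.isSome_iff_exists.1 hk
      exact Nat.Partrec.Code.evaln_bound hm
    simp only [hks, List.find?_eq_none] at h
    exact h k (by simpa using hlt) hk
  have hmonoE : ∀ s s' k, s ≤ s' → (Nat.Partrec.Code.evaln s c k).isSome → (Nat.Partrec.Code.evaln s' c k).isSome := by
    intro s s' k hss h
    obtain ⟨m, hm⟩ := Option.isSome_iff_exists.1 h
    exact Option.isSome_iff_exists.2 ⟨m, Nat.Partrec.Code.evaln_mono hss hm⟩
  have hGv : ∀ s k, ks s = Option.some k → ((G s).1 : ℝ) / 2 ^ (G s).2 = max ((f k : ℝ) / 2 ^ k) 0 := by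
    intro s k h
    simp only [hG, h, Option.elim, hval s k (hkspec s k h).1, Option.getD]
    rcases le_total 0 (f k) with h0 | h0
    · have : ((f k).toNat : ℝ) = f k := by
        have := Int.toNat_of_nonneg h0
        exact_mod_cast congrArg (Int.cast (R := ℝ)) this
      rw [this, max_eq_left]
      have : (0:ℝ) ≤ f k := by exact_mod_cast h0
      positivity
    · rw [Int.toNat_of_nonpos h0, max_eq_right]
      · simp
      · have : (f k : ℝ) ≤ 0 := by exact_mod_cast h0
        exact div_nonpos_of_nonpos_of_nonneg this (by positivity)
  have hkex : ∀ k, ∀ᶠ s in atTop, ∃ k', k ≤ k' ∧ ks s = Option.some k' := by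
    intro k
    have : (f k).toNat ∈ c.eval k := by rw [hc]; simp
    obtain ⟨s0, hs0⟩ := Nat.Partrec.Code.evaln_complete.1 this
    filter_upwards [eventually_ge_atTop s0] with s hs
    have h1 := hmonoE s0 s k hs (by rw [Option.mem_def] at hs0; simp [hs0])
    rcases h : ks s with _ | k'
    · exact absurd h1 (hknone s h k)
    · exact ⟨k', (hkspec s k' h).2 k h1, rfl⟩
  refine ⟨G, ?_, ?_, ?_⟩
  · simp only [hG, hks]; fun_prop
  · intro s s' hss
    rcases h : ks s with _ | k
    · simp only [hG, h, Option.elim]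
      simp; positivity
    · have h1 := hmonoE s s' k hss (hkspec s k h).1
      rcases h' : ks s' with _ | k'
      · exact absurd h1 (hknone s' h' k)
      · have h2 := (hkspec s' k' h').2 k h1
        have := hmono h2
        simp only [hGv s k h, hGv s' k' h']
        exact max_le_max this le_rfl
  · have h0 := realOfSeq_nonneg X
    rw [Metric.tendsto_atTop] at hlim
    rw [Metric.tendsto_nhds]
    intro ε hε
    obtain ⟨N, hN⟩ := hlim ε hε
    filter_upwards [hkex N] with s ⟨k', hk1, hk2⟩
    rw [hGv s k' hk2]
    have := hN k' hk1
    rw [Real.dist_eq, abs_lt] at *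
    constructor
    · have := le_max_left ((f k' : ℝ) / 2 ^ k') 0; linarith
    · rcases max_cases ((f k' : ℝ) / 2 ^ k') 0 with h | h <;> linarith

structure Apx (X : ℕ → Bool) (Z : ℕ → ℕ → Bool) : Prop where
  pr : Primrec fun p : ℕ × ℕ => Z p.1 p.2
  lim : ∀ n, ∀ᶠ s in atTop, restrSeq (Z s) n = restrSeq X n
  noret : ∀ n s t u, s ≤ t → t ≤ u → restrSeq (Z s) n = restrSeq (Z u) n → restrSeq (Z t) n = restrSeq (Z s) n

theorem apx_const {X : ℕ → Bool} {N : ℕ} {b : Bool} (h : ∀ i ≥ N, X i = b) : Apx X (fun _ => X) := by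
  refine ⟨?_, fun n => by simp, fun _ _ _ _ _ _ _ => rfl⟩
  have : Primrec fun p : ℕ × ℕ => (restrSeq X N)[p.2]?.getD b := by fun_prop
  refine this.of_eq fun p => ?_
  by_cases hp : p.2 < N
  · rw [restr_getElem? X hp]; rfl
  · rw [List.getElem?_eq_none (by simpa using hp)]; simp [h p.2 (by omega)]

theorem bits_eq {a b n : ℕ} (ha : a < 2 ^ n) (hb : b < 2 ^ n)
    (h : ∀ i < n, (a / 2 ^ (n - 1 - i)) % 2 = (b / 2 ^ (n - 1 - i)) % 2) : a = b := by
  apply Nat.eq_of_testBit_eq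
  intro i
  by_cases hi : i < n
  · have := h (n - 1 - i) (by omega)
    rw [show n - 1 - (n - 1 - i) = i by omega] at this
    rw [Nat.testBit_eq_decide_div_mod_eq, Nat.testBit_eq_decide_div_mod_eq, this]
  · push Not at hi
    rw [Nat.testBit_eq_false_of_lt (ha.trans_le (Nat.pow_le_pow_right (by norm_num) hi)),
      Nat.testBit_eq_false_of_lt (hb.trans_le (Nat.pow_le_pow_right (by norm_num) hi))]

theorem vpre_lt (X : ℕ → Bool) (n : ℕ) : vpre X n < 2 ^ n := by
  induction n with
  | zero => simp [vpre]
  | succ n ih => rw [vpre, pow_succ]; cases X n <;> simp <;> omega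

theorem vpre_div (X : ℕ → Bool) (n i : ℕ) : vpre X (n + i) / 2 ^ i = vpre X n := by
  induction i with
  | zero => simp
  | succ i ih =>
    rw [pow_succ', ← Nat.div_div_eq_div_mul, ← ih, ← add_assoc, vpre]
    congr 1
    cases X (n+i) <;> simp <;> omega

theorem vpre_mod (X : ℕ → Bool) (n : ℕ) : X n = decide (vpre X (n+1) % 2 = 1) := by
  rw [vpre]; cases X n <;> simp <;> omega

theorem ceReal_apx {X : ℕ → Bool} (h : CEReal X) : ∃ Z, Apx X Z := by
  by_cases hc : ∃ N b, ∀ i ≥ N, X i = b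
  · obtain ⟨N, b, h⟩ := hc
    exact ⟨_, apx_const h⟩
  push Not at hc
  obtain ⟨G, hG, hmono, hlim⟩ := ce_approx h
  set x := realOfSeq X
  have hle : ∀ s, ((G s).1 : ℝ) / 2 ^ (G s).2 ≤ x := fun s => hmono.ge_of_tendsto hlim s
  set fl : ℕ → ℕ → ℕ := fun s n => (G s).1 * 2 ^ n / 2 ^ (G s).2 with hfl
  have hx1 : x < 1 := by
    obtain ⟨i, -, hi⟩ := hc 0 true
    exact realOfSeq_lt_one X i (by simpa using hi)
  have hflle : ∀ s n, (fl s n : ℝ) ≤ ((G s).1 : ℝ) / 2 ^ (G s).2 * 2 ^ n := by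
    intro s n
    have : (fl s n : ℝ) ≤ (((G s).1 * 2 ^ n : ℕ) : ℝ) / ((2 ^ (G s).2 : ℕ) : ℝ) := Nat.cast_div_le
    push_cast at this
    rw [div_mul_eq_mul_div]; exact this
  have hfllt : ∀ s n, ((G s).1 : ℝ) / 2 ^ (G s).2 * 2 ^ n < fl s n + 1 := by
    intro s n
    have : (G s).1 * 2 ^ n < (fl s n + 1) * 2 ^ (G s).2 := by
      have := Nat.lt_div_mul_add (a := (G s).1 * 2 ^ n) (b := 2 ^ (G s).2) (by positivity)
      simp only [hfl]; rw [add_mul]; simpa using this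
    rw [div_mul_eq_mul_div, div_lt_iff₀ (by positivity)]
    exact_mod_cast this
  have hfl1 : ∀ s n, fl s n < 2 ^ n := by
    intro s n
    have h1 := hflle s n
    have h2 : ((G s).1 : ℝ) / 2 ^ (G s).2 * 2 ^ n < 1 * 2 ^ n := by
      have := (hle s).trans_lt hx1
      gcongr
    have : (fl s n : ℝ) < 2 ^ n := by linarith
    exact_mod_cast this
  have hflmono : ∀ n s t, s ≤ t → fl s n ≤ fl t n := by
    intro n s t hst
    have h1 := hflle s n
    have h2 := hfllt t n
    have h3 : ((G s).1 : ℝ) / 2 ^ (G s).2 * 2 ^ n ≤ ((G t).1 : ℝ) / 2 ^ (G t).2 * 2 ^ n := by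
      have := hmono hst
      simp only at this
      gcongr
    have : (fl s n : ℝ) < fl t n + 1 := by linarith
    have : fl s n < fl t n + 1 := by exact_mod_cast this
    omega
  have hfldiv : ∀ s n i, i < n → fl s n / 2 ^ (n - 1 - i) = fl s (i+1) := by
    intro s n i hi
    simp only [hfl]
    rw [Nat.div_div_eq_div_mul]
    obtain ⟨d, rfl⟩ := Nat.exists_eq_add_of_lt hi
    rw [show i + d + 1 - 1 - i = d by omega, show i + d + 1 = (i + 1) + d by ring, pow_add, ← mul_assoc]
    exact Nat.mul_div_mul_right _ _ (by positivity)
  set Z : ℕ → ℕ → Bool := fun s i => decide (fl s (i+1) % 2 = 1) with hZ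
  have hZeq : ∀ n s t, restrSeq (Z s) n = restrSeq (Z t) n ↔ fl s n = fl t n := by
    intro n s t
    rw [restr_eq_iff]
    constructor
    · intro h
      refine bits_eq (hfl1 s n) (hfl1 t n) fun i hi => ?_
      rw [hfldiv s n i hi, hfldiv t n i hi]
      have := h i hi
      simp only [hZ, decide_eq_decide] at this
      omega
    · intro h i hi
      simp only [hZ]
      rw [← hfldiv s n i hi, ← hfldiv t n i hi, h]
  refine ⟨Z, ?_, ?_, ?_⟩
  · simp only [hZ, hfl]; fun_prop
  · intro n
    have hv : (vpre X n : ℝ) / 2 ^ n < x := by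
      rw [div_lt_iff₀ (by positivity), realOfSeq_vpre]
      obtain ⟨i, hi, hi'⟩ := hc n false
      have := realOfSeq_pos (fun i => X (i + n)) (i - n) (by simp [Nat.sub_add_cancel hi, hi'])
      linarith
    have hv2 : x * 2 ^ n < vpre X n + 1 := by
      rw [realOfSeq_vpre]
      obtain ⟨i, hi, hi'⟩ := hc n true
      have := realOfSeq_lt_one (fun i => X (i + n)) (i - n) (by simp [Nat.sub_add_cancel hi, hi'])
      linarith
    filter_upwards [hlim.eventually (lt_mem_nhds hv)] with s hs
    have e : fl s n = vpre X n := by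
      have h1 := hflle s n
      have h2 := hfllt s n
      have h3 : ((G s).1 : ℝ) / 2 ^ (G s).2 * 2 ^ n ≤ x * 2 ^ n := by
        have := hle s
        gcongr
      rw [div_lt_iff₀ (by positivity)] at hs
      have a1 : (fl s n : ℝ) < vpre X n + 1 := by linarith
      have a2 : (vpre X n : ℝ) < fl s n + 1 := by linarith
      have a1 : fl s n < vpre X n + 1 := by exact_mod_cast a1
      have a2 : vpre X n < fl s n + 1 := by exact_mod_cast a2
      omega
    rw [restr_eq_iff]
    intro i hi
    simp only [hZ]
    rw [vpre_mod X i, ← hfldiv s n i hi, e]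
    have := vpre_div X (i+1) (n - 1 - i)
    rw [show i + 1 + (n - 1 - i) = n by omega] at this
    rw [this]
  · intro n s t u hst htu he
    rw [hZeq] at *
    exact le_antisymm (he ▸ hflmono n t u htu) (hflmono n s t hst)

theorem ceReal_of_ce {X : ℕ → Bool} {a : ℕ → ℕ → Bool} (ha : Primrec fun p : ℕ × ℕ => a p.1 p.2)
    (hmono : ∀ s t i, s ≤ t → a s i = true → a t i = true)
    (hX : ∀ i, X i = true ↔ ∃ s, a s i = true) : CEReal X := by
  set f : ℕ → ℕ := fun s => ∑ i ∈ Finset.range s, bif a s i then 2 ^ (s - 1 - i) else 0 with hf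
  have hfs : ∀ s, (f s : ℝ) / 2 ^ s = ∑ i ∈ Finset.range s, rterm (a s) i := by
    intro s
    simp only [hf]
    push_cast
    rw [Finset.sum_div]
    refine Finset.sum_congr rfl fun i hi => ?_
    have hi := Finset.mem_range.1 hi
    unfold rterm
    cases a s i
    · simp
    · simp only [cond_true]
      obtain ⟨d, rfl⟩ := Nat.exists_eq_add_of_lt hi
      rw [show i + d + 1 - 1 - i = d by omega, show i + d + 1 = (i + 1) + d by ring, pow_add]
      push_cast
      field_simp
  refine ⟨fun s => (f s : ℤ), ?_, ?_, ?_⟩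
  · have h1 : Primrec f := by simp only [hf]; fun_prop
    have h2 : Primrec (fun n : ℕ => (n : ℤ)) := by
      rw [← Primrec.encode_iff]
      have : Primrec (fun n : ℕ => 2 * n) := by fun_prop
      exact this
    exact (h2.comp h1).to_comp
  · intro s
    push_cast
    rw [hfs, hfs, Finset.sum_range_succ]
    have := rterm_nonneg (a (s+1)) s
    refine le_add_of_le_of_nonneg (Finset.sum_le_sum fun i _ => ?_) this
    unfold rterm
    rcases h : a s i with _ | _
    · cases a (s+1) i <;> simp
    · rw [hmono s (s+1) i (by omega) h]
  · push_cast
    simp only [hfs]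
    rw [realOfSeq_eq]
    have hs : ∀ s, ∑ i ∈ Finset.range s, rterm (a s) i = ∑' i, if i < s then rterm (a s) i else 0 := by
      intro s
      rw [tsum_eq_sum (s := Finset.range s)]
      · refine Finset.sum_congr rfl fun i hi => ?_
        rw [if_pos (Finset.mem_range.1 hi)]
      · intro i hi
        rw [if_neg (by simpa using hi)]
    simp only [hs]
    refine tendsto_tsum_of_dominated_convergence geo_summable ?_ ?_
    · intro i
      refine tendsto_const_nhds.congr' ?_
      by_cases hXi : X i = true
      · obtain ⟨s0, hs0⟩ := (hX i).1 hXi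
        filter_upwards [eventually_ge_atTop s0, eventually_gt_atTop i] with s h1 h2
        rw [if_pos h2]
        unfold rterm
        rw [hXi, hmono s0 s i h1 hs0]
      · have : ∀ s, a s i = false := by
          intro s
          by_contra h
          exact hXi ((hX i).2 ⟨s, by simpa using h⟩)
        refine Eventually.of_forall fun s => ?_
        simp [rterm, this, hXi]
    · refine Eventually.of_forall fun s i => ?_
      split_ifs
      · rw [Real.norm_of_nonneg (rterm_nonneg _ _)]; exact rterm_le _ _
      · simp


/-! ### first value -/
def firstSome {β : Type} (n : ℕ) (g : ℕ → Option β) : Option β := ((List.range n).filterMap g).head?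

@[fun_prop] theorem pr_firstSome {γ β : Type} [Primcodable γ] [Primcodable β] {n : γ → ℕ}
    {g : γ → ℕ → Option β} (hn : Primrec n) (hg : Primrec fun p : γ × ℕ => g p.1 p.2) :
    Primrec fun x => firstSome (n x) (g x) := by
  unfold firstSome; fun_prop

theorem firstSome_succ {β : Type} (n : ℕ) (g : ℕ → Option β) :
    firstSome (n+1) g = (firstSome n g).elim (g n) Option.some := by
  unfold firstSome
  rw [List.range_succ, List.filterMap_append, List.head?_append]
  rcases h : (List.filterMap g (List.range n)).head? with _ | v
  · simp
  · simp

theorem firstSome_eq_none {β : Type} {n : ℕ} {g : ℕ → Option β} :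
    firstSome n g = Option.none ↔ ∀ i < n, g i = Option.none := by
  simp [firstSome]

theorem firstSome_eq_some {β : Type} {n : ℕ} {g : ℕ → Option β} {v : β} :
    firstSome n g = Option.some v ↔ ∃ i < n, g i = Option.some v ∧ ∀ j < i, g j = Option.none := by
  induction n with
  | zero => simp [firstSome]
  | succ n ih =>
    rw [firstSome_succ]
    rcases h : firstSome n g with _ | v'
    · rw [firstSome_eq_none] at h
      simp only [Option.elim]
      constructor
      · intro hv; exact ⟨n, by omega, hv, h⟩
      · rintro ⟨i, hi, hv, -⟩
        rcases Nat.lt_succ_iff_lt_or_eq.1 hi with hi | rfl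
        · rw [h i hi] at hv; simp at hv
        · exact hv
    · simp only [Option.elim]
      rw [← h, ih]
      constructor
      · rintro ⟨i, hi, h⟩; exact ⟨i, by omega, h⟩
      · rintro ⟨i, hi, hv, hj⟩
        refine ⟨i, ?_, hv, hj⟩
        by_contra hin
        have : i = n := by omega
        subst this
        rw [firstSome_eq_none.2 hj] at h
        simp at h

abbrev Rec := Str × Option (ℕ × ℕ × ℕ)

def mpMem (h : List Rec) (p y : ℕ) : Bool :=
  h.any fun r => r.2.elim false fun a =>
    decide (a.1 % 2 = p) && decide (a.2.1 ≤ y) && decide (y ≤ a.2.2)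

def mpPhi (h : List Rec) (p c x : ℕ) : Option ℕ :=
  firstSome h.length fun w => Nat.Partrec.Code.evaln w.unpair.2 (Denumerable.ofNat Nat.Partrec.Code c)
    (Nat.pair x (Encodable.encode (restrSeq (mpMem h p) w.unpair.1)))

def mpAgree (h : List Rec) (e x : ℕ) : Bool :=
  (mpPhi h 0 e.unpair.1 x).isSome && decide (mpPhi h 0 e.unpair.1 x = mpPhi h 1 e.unpair.2 x)

def mpCnt (h : List Rec) (τ : Str) : ℕ :=
  (h.filter fun r => decide (r.1.take τ.length = τ)).length

def mpSig (h : List Rec) (e : ℕ) : Str :=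
  Nat.rec [] (fun e τ => τ ++ [!((List.range (mpCnt h (τ ++ [false]) + 1)).all (mpAgree h e))]) e

def leftB (e : ℕ) (α β : Str) : Bool :=
  (List.range (e+1)).any fun i =>
    decide (α.take i = β.take i) && decide (α[i]? = Option.some false) && decide (β[i]? = Option.some true)

def mpCond (h : List Rec) (σ : Str) (e x : ℕ) : Bool :=
  !(h.any fun r => r.2.elim false fun a => decide (a.1 = e)) &&
  (Nat.Partrec.Code.evaln h.length (Denumerable.ofNat Nat.Partrec.Code (e/2)) x).isSome &&
  !(mpMem h (e % 2) x) &&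
  ((List.range h.length).all fun t => !(leftB e (h[t]?.elim [] fun r => r.1) σ) || decide (t < x)) &&
  decide (e ≤ ((List.range x).filter fun y => !(mpMem h (e % 2) y)).length)

def mpAct (h : List Rec) (σ : Str) : Option (ℕ × ℕ × ℕ) :=
  firstSome h.length fun e => (firstSome h.length fun x =>
    bif mpCond h σ e x then Option.some x else Option.none).map fun x => (e, x, h.length)

def mpStep (h : List Rec) : Rec := (mpSig h h.length, mpAct h (mpSig h h.length))

section prim
variable {γ : Type} [Primcodable γ] 
@[fun_prop] theorem pr_code {f : γ → ℕ} (hf : Primrec f) :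
    Primrec fun x => Denumerable.ofNat Nat.Partrec.Code (f x) := (Primrec.ofNat _).comp hf
@[fun_prop] theorem pr_mpMem {h : γ → List Rec} {p y : γ → ℕ} (hh : Primrec h) (hp : Primrec p)
    (hy : Primrec y) : Primrec fun x => mpMem (h x) (p x) (y x) := by unfold mpMem; fun_prop
@[fun_prop] theorem pr_mpPhi {h : γ → List Rec} {p c y : γ → ℕ} (hh : Primrec h) (hp : Primrec p)
    (hc : Primrec c) (hy : Primrec y) : Primrec fun x => mpPhi (h x) (p x) (c x) (y x) := by
  unfold mpPhi; fun_prop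
@[fun_prop] theorem pr_mpAgree {h : γ → List Rec} {e y : γ → ℕ} (hh : Primrec h) (he : Primrec e)
    (hy : Primrec y) : Primrec fun x => mpAgree (h x) (e x) (y x) := by unfold mpAgree; fun_prop
@[fun_prop] theorem pr_mpCnt {h : γ → List Rec} {τ : γ → Str} (hh : Primrec h) (hτ : Primrec τ) :
    Primrec fun x => mpCnt (h x) (τ x) := by unfold mpCnt; fun_prop
@[fun_prop] theorem pr_mpSig {h : γ → List Rec} {e : γ → ℕ} (hh : Primrec h) (he : Primrec e) :
    Primrec fun x => mpSig (h x) (e x) := by unfold mpSig; fun_prop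
@[fun_prop] theorem pr_leftB {e : γ → ℕ} {α β : γ → Str} (he : Primrec e) (hα : Primrec α)
    (hβ : Primrec β) : Primrec fun x => leftB (e x) (α x) (β x) := by unfold leftB; fun_prop
@[fun_prop] theorem pr_mpCond {h : γ → List Rec} {σ : γ → Str} {e y : γ → ℕ} (hh : Primrec h)
    (hσ : Primrec σ) (he : Primrec e)
    (hy : Primrec y) : Primrec fun x => mpCond (h x) (σ x) (e x) (y x) := by unfold mpCond; fun_prop
@[fun_prop] theorem pr_mpAct {h : γ → List Rec} {σ : γ → Str} (hh : Primrec h)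
    (hσ : Primrec σ) : Primrec fun x => mpAct (h x) (σ x) := by unfold mpAct; fun_prop
theorem pr_mpStep : Primrec mpStep := by unfold mpStep; fun_prop
end prim

def mpH (s : ℕ) : List Rec := hist mpStep s
@[fun_prop] theorem pr_mpH {γ : Type} [Primcodable γ] {s : γ → ℕ} (hs : Primrec s) :
    Primrec fun x => mpH (s x) := (pr_hist pr_mpStep).comp hs
def mpSg (s : ℕ) : Str := mpSig (mpH s) s
def mpA (s : ℕ) : Option (ℕ × ℕ × ℕ) := mpAct (mpH s) (mpSg s)
def mpZ (p s y : ℕ) : Bool := mpMem (mpH s) p y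

theorem mpH_length (s : ℕ) : (mpH s).length = s := hist_length _ _
theorem mpH_eq (s : ℕ) : mpH s = (List.range s).map fun t => (mpSg t, mpA t) := by
  rw [mpH, hist_eq_map]
  refine List.map_congr_left fun t _ => ?_
  simp only [mpStep, mpSg, mpA, mpH, hist_length]

theorem mpA_spec {s e x t : ℕ} (h : mpA s = Option.some (e, x, t)) :
    t = s ∧ e < s ∧ x < s ∧ mpCond (mpH s) (mpSg s) e x = true := by
  unfold mpA mpAct at h
  rw [mpH_length, firstSome_eq_some] at h
  obtain ⟨e', he', h, -⟩ := h
  rw [Option.map_eq_some_iff] at h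
  obtain ⟨x', h, h2⟩ := h
  simp only [Prod.mk.injEq] at h2
  obtain ⟨rfl, rfl, rfl⟩ := h2
  rw [firstSome_eq_some] at h
  obtain ⟨x, hx, h, -⟩ := h
  rw [Bool.cond_eq_ite] at h
  split_ifs at h with h3
  simp at h
  subst h
  exact ⟨rfl, he', hx, h3⟩

theorem mpA_ex {s e x : ℕ} (he : e < s) (hx : x < s) (h : mpCond (mpH s) (mpSg s) e x = true) :
    ∃ e' ≤ e, ∃ x', mpA s = Option.some (e', x', s) := by
  rcases hA : mpA s with _ | ⟨e', x', t⟩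
  · exfalso
    unfold mpA mpAct at hA
    rw [mpH_length, firstSome_eq_none] at hA
    have := hA e he
    simp only [Option.map_eq_none_iff] at this
    rw [firstSome_eq_none] at this
    have := this x hx
    simp [h] at this
  · have h1 := mpA_spec hA
    obtain ⟨rfl, -⟩ := h1
    refine ⟨e', ?_, x', rfl⟩
    by_contra hlt
    unfold mpA mpAct at hA
    rw [mpH_length, firstSome_eq_some] at hA
    obtain ⟨e'', he'', h2, h3⟩ := hA
    rw [Option.map_eq_some_iff] at h2
    obtain ⟨x', h2, h4⟩ := h2
    simp only [Prod.mk.injEq] at h4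
    obtain ⟨rfl, rfl, -⟩ := h4
    have := h3 e (by omega)
    simp only [Option.map_eq_none_iff] at this
    rw [firstSome_eq_none] at this
    have := this x hx
    simp [h] at this

theorem mpZ_iff {p s y : ℕ} : mpZ p s y = true ↔
    ∃ t < s, ∃ e x, mpA t = Option.some (e, x, t) ∧ e % 2 = p ∧ x ≤ y ∧ y ≤ t := by
  unfold mpZ mpMem
  rw [mpH_eq, List.any_map, List.any_eq_true]
  constructor
  · rintro ⟨t, ht, h⟩
    simp only [Function.comp] at h
    rcases hA : mpA t with _ | ⟨e, x, t'⟩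
    · rw [hA] at h; simp at h
    · rw [hA] at h
      obtain ⟨rfl, -⟩ := mpA_spec hA
      simp at h
      exact ⟨_, by simpa using ht, e, x, hA, h.1.1, h.1.2, h.2⟩
  · rintro ⟨t, ht, e, x, hA, h1, h2, h3⟩
    refine ⟨t, by simpa using ht, ?_⟩
    simp [hA, h1, h2, h3]

theorem mpZ_mono {p s t y : ℕ} (hst : s ≤ t) (h : mpZ p s y = true) : mpZ p t y = true := by
  rw [mpZ_iff] at *
  obtain ⟨u, hu, h⟩ := h
  exact ⟨u, by omega, h⟩

theorem mpCond_iff {s e x : ℕ} : mpCond (mpH s) (mpSg s) e x = true ↔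
    (∀ t < s, ∀ x' t', mpA t ≠ Option.some (e, x', t')) ∧
    (Nat.Partrec.Code.evaln s (Denumerable.ofNat Nat.Partrec.Code (e/2)) x).isSome ∧
    mpZ (e % 2) s x = false ∧ (∀ t < s, leftB e (mpSg t) (mpSg s) = true → t < x) ∧
    e ≤ ((List.range x).filter fun y => !(mpZ (e % 2) s y)).length := by
  unfold mpCond
  simp only [Bool.and_eq_true, mpH_length, Bool.not_eq_true', and_assoc, List.any_eq_false, decide_eq_true_eq]
  refine and_congr ?_ (and_congr Iff.rfl (and_congr Iff.rfl (and_congr ?_ Iff.rfl)))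
  · rw [mpH_eq]
    constructor
    · intro h t ht x' t' hA
      have := h (mpSg t, mpA t) (by simp; exact ⟨t, ht, rfl, rfl⟩)
      simp [hA] at this
    · intro h r hr
      simp at hr
      obtain ⟨t, ht, rfl⟩ := hr
      rcases hA : mpA t with _ | ⟨e', x', t'⟩
      · simp
      · simp; rintro rfl; exact h t ht _ _ hA
  · rw [List.all_eq_true]
    refine forall_congr' fun t => ?_
    simp only [List.mem_range]
    refine forall_congr' fun ht => ?_
    have : (mpH s)[t]? = Option.some (mpSg t, mpA t) := by
      rw [mpH_eq]; simp [ht]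
    rw [this]
    simp only [Option.elim]
    cases leftB e (mpSg t) (mpSg s) <;> simp

theorem mpSig_succ (h : List Rec) (e : ℕ) : mpSig h (e+1) =
    mpSig h e ++ [!((List.range (mpCnt h (mpSig h e ++ [false]) + 1)).all (mpAgree h e))] := rfl

theorem mpSig_length (h : List Rec) (e : ℕ) : (mpSig h e).length = e := by
  induction e with
  | zero => rfl
  | succ e ih => rw [mpSig_succ]; simp [ih]

theorem mpSig_take (h : List Rec) {e s : ℕ} (hes : e ≤ s) : (mpSig h s).take e = mpSig h e := by
  induction s with
  | zero => simp at hes; subst hes; rfl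
  | succ s ih =>
    rcases Nat.le_succ_iff.1 hes with h1 | rfl
    · rw [mpSig_succ, List.take_append_of_le_length (by rw [mpSig_length]; exact h1), ih h1]
    · rw [List.take_of_length_le (by rw [mpSig_length])]

theorem mpSg_length (s : ℕ) : (mpSg s).length = s := mpSig_length _ _

theorem leftB_iff {e : ℕ} {α β : Str} : leftB e α β = true ↔
    ∃ i ≤ e, α.take i = β.take i ∧ α[i]? = Option.some false ∧ β[i]? = Option.some true := by
  unfold leftB
  simp only [List.any_eq_true, List.mem_range, Bool.and_eq_true, decide_eq_true_eq, Nat.lt_succ_iff, and_assoc]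

theorem leftB_take {e : ℕ} {α β : Str} {m n : ℕ} (hm : e < m) (hn : e < n) :
    leftB e (α.take m) (β.take n) = leftB e α β := by
  rw [Bool.eq_iff_iff, leftB_iff, leftB_iff]
  refine exists_congr fun i => and_congr_right fun hi => ?_
  rw [List.take_take, List.take_take, min_eq_left (by omega), min_eq_left (by omega),
    List.getElem?_take_of_lt (by omega), List.getElem?_take_of_lt (by omega)]

theorem leftB_mono {e e' : ℕ} {α β : Str} (h : e ≤ e') (hl : leftB e α β = true) : leftB e' α β = true := by
  rw [leftB_iff] at *
  obtain ⟨i, hi, h2⟩ := hl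
  exact ⟨i, by omega, h2⟩

theorem leftB_total {e : ℕ} {α β : Str} (ha : α.length = e + 1) (hb : β.length = e + 1) (hne : α ≠ β) :
    leftB e α β = true ∨ leftB e β α = true := by
  have hex : ∃ i : ℕ, α[i]? ≠ β[i]? := by
    by_contra h
    push Not at h
    exact hne (List.ext_getElem? h)
  have h1 := Nat.find_spec hex
  have h2 : ∀ j < Nat.find hex, α[j]? = β[j]? := fun j hj => by simpa using Nat.find_min hex hj
  set i := Nat.find hex
  have hi : i ≤ e := by
    by_contra hi
    apply h1
    rw [List.getElem?_eq_none (by omega), List.getElem?_eq_none (by omega)]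
  have ht : α.take i = β.take i := by
    apply List.ext_getElem?
    intro j
    by_cases hj : j < i
    · rw [List.getElem?_take_of_lt hj, List.getElem?_take_of_lt hj, h2 j hj]
    · rw [List.getElem?_eq_none (by simp; omega), List.getElem?_eq_none (by simp; omega)]
  rw [List.getElem?_eq_getElem (by omega), List.getElem?_eq_getElem (by omega)] at h1
  rw [leftB_iff, leftB_iff]
  have ea : α[i]? = Option.some α[i] := List.getElem?_eq_getElem (by omega)
  have eb : β[i]? = Option.some β[i] := List.getElem?_eq_getElem (by omega)
  rcases ha' : α[i] with _ | _ <;> rcases hb' : β[i] with _ | _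
  · simp [ha', hb'] at h1
  · exact Or.inl ⟨i, hi, ht, by rw [ea, ha'], by rw [eb, hb']⟩
  · exact Or.inr ⟨i, hi, ht.symm, by rw [eb, hb'], by rw [ea, ha']⟩
  · simp [ha', hb'] at h1


theorem computable_of_search {α β : Type} [Primcodable α] [Primcodable β] {f : α → β}
    {g : α → ℕ → Option β} (hg : Computable₂ g) (h1 : ∀ x s y, g x s = Option.some y → y = f x)
    (h2 : ∀ x, ∃ s y, g x s = Option.some y) : Computable f := by
  refine Partrec.of_eq_tot (Partrec.rfindOpt hg) fun x => ?_
  have hd : (Nat.rfindOpt (g x)).Dom := by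
    rw [Nat.rfindOpt_dom]; exact h2 x
  obtain ⟨n, hn⟩ := Nat.rfindOpt_spec (Part.get_mem hd)
  have := h1 x n _ hn
  rw [← this]
  exact Part.get_mem hd

noncomputable def mpLim (p i : ℕ) : Bool := decide (∃ s, mpZ p s i = true)

theorem mpLim_iff {p i : ℕ} : mpLim p i = true ↔ ∃ s, mpZ p s i = true := by simp [mpLim]

theorem mpLim_of {p s i : ℕ} (h : mpZ p s i = true) : mpLim p i = true := mpLim_iff.2 ⟨s, h⟩

theorem mpZ_false {p s i : ℕ} (h : mpLim p i = false) : mpZ p s i = false := by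
  rcases h1 : mpZ p s i with _ | _
  · rfl
  · rw [mpLim_of h1] at h; simp at h

theorem mpZ_bound {p s i : ℕ} (h : s ≤ i) : mpZ p s i = false := by
  rcases h1 : mpZ p s i with _ | _
  · rfl
  · rw [mpZ_iff] at h1
    obtain ⟨t, ht, e, x, _, _, _, h2⟩ := h1
    omega

theorem mpZ_diff {p r t y : ℕ} (hrt : r ≤ t) (h : mpZ p r y ≠ mpZ p t y) :
    ∃ t', r ≤ t' ∧ t' < t ∧ ∃ e x, mpA t' = Option.some (e, x, t') ∧ e % 2 = p ∧ x ≤ y ∧ y ≤ t' := by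
  have h1 : mpZ p r y = false := by
    rcases h1 : mpZ p r y with _ | _
    · rfl
    · rw [h1, mpZ_mono hrt h1] at h; exact absurd rfl h
  have h2 : mpZ p t y = true := by
    rcases h2 : mpZ p t y with _ | _
    · rw [h1, h2] at h; exact absurd rfl h
    · rfl
  rw [mpZ_iff] at h2
  obtain ⟨t', ht', e, x, hA, hp, hx, hy⟩ := h2
  refine ⟨t', ?_, ht', e, x, hA, hp, hx, hy⟩
  by_contra hlt
  have : mpZ p r y = true := mpZ_iff.2 ⟨t', by omega, e, x, hA, hp, hx, hy⟩
  rw [h1] at this; simp at this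

theorem mp_ev (p m : ℕ) : ∀ᶠ s in atTop, ∀ i < m, mpZ p s i = mpLim p i := by
  induction m with
  | zero => simp
  | succ m ih =>
    have : ∀ᶠ s in atTop, mpZ p s m = mpLim p m := by
      rcases h : mpLim p m with _ | _
      · exact Eventually.of_forall fun s => mpZ_false h
      · obtain ⟨s0, h0⟩ := mpLim_iff.1 h
        filter_upwards [eventually_ge_atTop s0] with s hs using mpZ_mono hs h0
    filter_upwards [ih, this] with s h1 h2 i hi
    rcases Nat.lt_succ_iff_lt_or_eq.1 hi with h | rfl
    · exact h1 i h
    · exact h2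

theorem mp_true (p K : ℕ) : ∃ k ≥ K, ∀ i < k, mpZ p k i = mpLim p i := by
  by_cases hex : ∃ x, ∃ s ≥ K, ∃ e, mpA s = Option.some (e, x, s) ∧ e % 2 = p
  · obtain ⟨s, hs, e, hA, hp⟩ := Nat.find_spec hex
    have hmin := fun y hy => Nat.find_min hex (m := y) hy
    set x := Nat.find hex
    refine ⟨s+1, by omega, fun i hi => ?_⟩
    rcases h : mpLim p i with _ | _
    · exact mpZ_false h
    · obtain ⟨t, ht⟩ := mpLim_iff.1 h
      by_cases hts : t ≤ s + 1
      · exact mpZ_mono hts ht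
      by_contra hne
      obtain ⟨t', h1, h2, e', x', hA', hp', hx', hy'⟩ := mpZ_diff (r := s+1) (t := t) (p := p) (y := i) (by omega) (by rw [ht]; exact hne)
      have hxx : x ≤ x' := by
        by_contra hlt
        exact hmin x' (by omega) ⟨t', by omega, e', hA', hp'⟩
      exact hne (mpZ_iff.2 ⟨s, by omega, e, x, hA, hp, by omega, by omega⟩)
  · refine ⟨K, le_rfl, fun i hi => ?_⟩
    rcases h : mpLim p i with _ | _
    · exact mpZ_false h
    · obtain ⟨t, ht⟩ := mpLim_iff.1 h
      by_cases hts : t ≤ K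
      · exact mpZ_mono hts ht
      by_contra hne
      obtain ⟨t', h1, h2, e', x', hA', hp', -⟩ := mpZ_diff (r := K) (t := t) (p := p) (y := i) (by omega) (by rw [ht]; exact hne)
      exact hex ⟨x', t', h1, e', hA', hp'⟩

theorem mp_once {e s t x y s' t' : ℕ} (h1 : mpA s = Option.some (e, x, s')) (h2 : mpA t = Option.some (e, y, t')) :
    s = t := by
  by_contra hne
  rcases Nat.lt_or_gt_of_ne hne with h | h
  · exact (mpCond_iff.1 (mpA_spec h2).2.2.2).1 s h _ _ h1
  · exact (mpCond_iff.1 (mpA_spec h1).2.2.2).1 t h _ _ h2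

theorem mp_quiet (n : ℕ) : ∀ᶠ s in atTop, ∀ e x t, mpA s = Option.some (e, x, t) → n ≤ e := by
  induction n with
  | zero => simp
  | succ n ih =>
    have : ∀ᶠ s in atTop, ∀ x t, mpA s ≠ Option.some (n, x, t) := by
      by_cases hex : ∃ s x t, mpA s = Option.some (n, x, t)
      · obtain ⟨s, x, t, h⟩ := hex
        filter_upwards [eventually_gt_atTop s] with s' hs' x' t' h'
        have := mp_once h h'
        omega
      · push Not at hex
        exact Eventually.of_forall hex
    filter_upwards [ih, this] with s h1 h2 e x t hA
    have := h1 e x t hA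
    rcases Nat.lt_or_eq_of_le this with h | rfl
    · exact h
    · exact absurd hA (h2 x t)

def nonCnt (a : ℕ → Bool) (m : ℕ) : ℕ := ((List.range m).filter fun y => !(a y)).length

theorem nonCnt_succ (a : ℕ → Bool) (m : ℕ) : nonCnt a (m+1) = nonCnt a m + (bif a m then 0 else 1) := by
  unfold nonCnt
  rw [List.range_succ, List.filter_append]
  cases h : a m <;> simp [h]

theorem nonCnt_congr {a b : ℕ → Bool} {m : ℕ} (h : ∀ i < m, a i = b i) : nonCnt a m = nonCnt b m := by
  unfold nonCnt
  congr 1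
  refine List.filter_congr fun i hi => ?_
  rw [h i (by simpa using hi)]

theorem nonCnt_mono (a : ℕ → Bool) : Monotone (nonCnt a) :=
  monotone_nat_of_le_succ fun n => by rw [nonCnt_succ]; omega

theorem nonCnt_le (a : ℕ → Bool) (m : ℕ) : nonCnt a m ≤ m := by
  unfold nonCnt
  refine (List.length_filter_le _ _).trans ?_
  simp

theorem nonCnt_anti {a b : ℕ → Bool} (h : ∀ i, a i = true → b i = true) (m : ℕ) : nonCnt b m ≤ nonCnt a m := by
  induction m with
  | zero => simp [nonCnt]
  | succ m ih =>
    rw [nonCnt_succ, nonCnt_succ]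
    have := h m
    cases ha : a m <;> cases hb : b m <;> simp_all <;> omega

theorem nonCnt_stage (p s n : ℕ) : ∃ m, n ≤ nonCnt (mpZ p s) m := by
  refine ⟨s + n, ?_⟩
  induction n with
  | zero => omega
  | succ n ih =>
    rw [← add_assoc, nonCnt_succ, mpZ_bound (by omega)]
    simp; omega

theorem mp_coinf (p n : ℕ) : ∃ m, n ≤ nonCnt (mpLim p) m := by
  obtain ⟨s0, hs0⟩ := eventually_atTop.1 (mp_quiet n)
  have hex := nonCnt_stage p s0 n
  have hm := Nat.find_spec hex
  have hmin := fun y hy => Nat.find_min hex (m := y) hy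
  set m := Nat.find hex
  have key : ∀ s ≥ s0, ∀ i < m, mpZ p s i = mpZ p s0 i := by
    intro s hs
    induction s, hs using Nat.le_induction with
    | base => intros; rfl
    | succ s hs ih =>
      intro i hi
      by_contra hne
      rw [← ih i hi] at hne
      obtain ⟨t', h1, h2, e, x, hA, hp, hx, hy⟩ := mpZ_diff (r := s) (t := s+1) (p := p) (y := i) (by omega) (Ne.symm hne)
      obtain rfl : t' = s := by omega
      have h3 := (mpCond_iff.1 (mpA_spec hA).2.2.2).2.2.2.2
      have h4 := hs0 _ hs _ _ _ hA
      rw [hp] at h3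
      change e ≤ nonCnt (mpZ p t') x at h3
      rw [nonCnt_congr (b := mpZ p s0) (fun j hj => ih j (by omega))] at h3
      exact hmin x (by omega) (by omega)
  refine ⟨m, ?_⟩
  obtain ⟨s1, hs1⟩ := eventually_atTop.1 (mp_ev p m)
  rw [nonCnt_congr (b := mpZ p s0)]
  · exact hm
  · intro i hi
    rw [← hs1 (max s0 s1) (by omega) i hi, key _ (by omega) i hi]

theorem mp_big (p N n : ℕ) : ∃ x ≥ N, mpLim p x = false ∧ n ≤ nonCnt (mpLim p) x := by
  obtain ⟨m, hm⟩ := mp_coinf p n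
  obtain ⟨m', hm'⟩ := mp_coinf p (max N m + 1)
  by_contra hno
  push Not at hno
  have h1 : ∀ x ≥ max N m, mpLim p x = true := by
    intro x hx
    by_contra h
    have := hno x (by omega) (by simpa using h)
    have := nonCnt_mono (mpLim p) (show m ≤ x by omega)
    omega
  have h2 : ∀ x, nonCnt (mpLim p) x ≤ max N m := by
    intro x
    by_cases hx : x ≤ max N m
    · exact (nonCnt_le _ _).trans hx
    · obtain ⟨d, rfl⟩ : ∃ d, x = max N m + d := ⟨x - max N m, by omega⟩
      clear hx
      induction d with
      | zero => exact nonCnt_le _ _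
      | succ d ih => rw [← add_assoc, nonCnt_succ, h1 _ (by omega)]; simpa using ih
  have := h2 m'
  omega

/-- true path -/
def TP (e : ℕ) (τ : Str) : Prop := τ.length = e ∧ (∃ᶠ s in atTop, (mpSg s).take e = τ) ∧
  ∀ᶠ s in atTop, ∀ i < e, ¬ ((mpSg s).take i = τ.take i ∧ (mpSg s)[i]? = Option.some false ∧ τ[i]? = Option.some true)

theorem take_succ_b {l : Str} {e : ℕ} (h : e < l.length) : ∃ b, l[e]? = Option.some b ∧ l.take (e+1) = l.take e ++ [b] :=
  ⟨l[e], List.getElem?_eq_getElem h, by rw [List.take_add_one, List.getElem?_eq_getElem h]; rfl⟩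

theorem TP_false {e : ℕ} {τ : Str} (h : TP e τ) (hf : ∃ᶠ s in atTop, (mpSg s).take (e+1) = τ ++ [false]) :
    TP (e+1) (τ ++ [false]) := by
  obtain ⟨h1, h2, h3⟩ := h
  refine ⟨by simp [h1], hf, ?_⟩
  filter_upwards [h3] with s hs i hi hc
  rcases Nat.lt_succ_iff_lt_or_eq.1 hi with hi | rfl
  · rw [List.take_append_of_le_length (by omega), List.getElem?_append_left (by omega)] at hc
    exact hs i hi hc
  · subst h1
    simp at hc

theorem TP_true {e : ℕ} {τ : Str} (h : TP e τ) (hf : ¬ ∃ᶠ s in atTop, (mpSg s).take (e+1) = τ ++ [false]) :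
    TP (e+1) (τ ++ [true]) := by
  obtain ⟨h1, h2, h3⟩ := h
  rw [not_frequently] at hf
  refine ⟨by simp [h1], ?_, ?_⟩
  · refine (h2.and_eventually (hf.and (eventually_gt_atTop e))).mono fun s hs => ?_
    obtain ⟨b, hb, hb2⟩ := take_succ_b (l := mpSg s) (e := e) (by rw [mpSg_length]; exact hs.2.2)
    rcases b with _ | _
    · rw [hs.1] at hb2; exact absurd hb2 hs.2.1
    · rw [hb2, hs.1]
  filter_upwards [h3, hf, eventually_gt_atTop e] with s hs hf hse i hi hc
  rcases Nat.lt_succ_iff_lt_or_eq.1 hi with hi | rfl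
  · rw [List.take_append_of_le_length (by omega), List.getElem?_append_left (by omega)] at hc
    exact hs i hi hc
  · obtain ⟨b, hb, hb2⟩ := take_succ_b (l := mpSg s) (e := i) (by rw [mpSg_length]; exact hse)
    rw [hc.2.1] at hb
    obtain rfl : false = b := by simpa using hb
    rw [hc.1, List.take_append_of_le_length (by omega), List.take_of_length_le (l := τ) (by omega)] at hb2
    exact hf hb2

theorem TP_ex (e : ℕ) : ∃ τ, TP e τ := by
  induction e with
  | zero => exact ⟨[], rfl, by simpa using frequently_atTop.2 fun a => ⟨a, le_rfl, trivial⟩, by simp⟩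
  | succ e ih =>
    obtain ⟨τ, h⟩ := ih
    by_cases hf : ∃ᶠ s in atTop, (mpSg s).take (e+1) = τ ++ [false]
    · exact ⟨_, TP_false h hf⟩
    · exact ⟨_, TP_true h hf⟩

theorem TP_left {e : ℕ} {τ : Str} (h : TP (e+1) τ) : ∀ᶠ s in atTop, leftB e (mpSg s) τ = false := by
  filter_upwards [h.2.2] with s hs
  rcases hl : leftB e (mpSg s) τ with _ | _
  · rfl
  · obtain ⟨i, hi, hl⟩ := leftB_iff.1 hl
    exact absurd hl (hs i (by omega))

theorem leftB_right {e : ℕ} {α β τ : Str} (h : β.take (e+1) = τ) : leftB e α β = leftB e α τ := by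
  subst h
  rw [← leftB_take (α := α) (β := β) (Nat.lt_succ_self e) (Nat.lt_succ_self e),
    ← leftB_take (α := α) (β := β.take (e+1)) (Nat.lt_succ_self e) (Nat.lt_succ_self e), List.take_take, min_self]

theorem leftB_left {e : ℕ} {α β τ : Str} (h : α.take (e+1) = τ) : leftB e α β = leftB e τ β := by
  subst h
  rw [← leftB_take (α := α) (β := β) (Nat.lt_succ_self e) (Nat.lt_succ_self e),
    ← leftB_take (α := α.take (e+1)) (β := β) (Nat.lt_succ_self e) (Nat.lt_succ_self e), List.take_take, min_self]

theorem mp_notce {p : ℕ} (hp : p < 2) (c : Nat.Partrec.Code) : ¬ ∀ x, (c.eval x).Dom ↔ mpLim p x = false := by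
  intro hc
  set e := 2 * Encodable.encode c + p with he
  have hep : e % 2 = p := by omega
  have hec : Denumerable.ofNat Nat.Partrec.Code (e/2) = c := by
    rw [show e / 2 = Encodable.encode c by omega]; exact Denumerable.ofNat_encode c
  have hno : ∀ t x t', mpA t ≠ Option.some (e, x, t') := by
    intro t x t' hA
    obtain ⟨rfl, _, hx, hcond⟩ := mpA_spec hA
    have h1 := (mpCond_iff.1 hcond).2.1
    rw [hec, Option.isSome_iff_exists] at h1
    obtain ⟨v, hv⟩ := h1
    have h2 : (c.eval x).Dom := Part.dom_iff_mem.2 ⟨v, Nat.Partrec.Code.evaln_sound hv⟩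
    rw [hc] at h2
    have h3 : mpZ p (t'+1) x = true := mpZ_iff.2 ⟨t', by omega, e, x, hA, hep, le_rfl, by omega⟩
    rw [mpZ_false h2] at h3
    simp at h3
  obtain ⟨τ, hτ⟩ := TP_ex (e+1)
  obtain ⟨s0, hs0⟩ := eventually_atTop.1 (TP_left hτ)
  obtain ⟨x, hx, hxl, hxc⟩ := mp_big p s0 e
  obtain ⟨v, hv⟩ := Part.dom_iff_mem.1 ((hc x).2 hxl)
  obtain ⟨k, hk⟩ := Nat.Partrec.Code.evaln_complete.1 hv
  obtain ⟨s, hsτ, hq, hsx, hse, hsk⟩ := (hτ.2.1.and_eventually ((mp_quiet (e+1)).and ((eventually_gt_atTop x).and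
    ((eventually_gt_atTop e).and (eventually_ge_atTop k))))).exists
  have hcond : mpCond (mpH s) (mpSg s) e x = true := by
    rw [mpCond_iff]
    refine ⟨fun t _ x' t' => hno t x' t', ?_, ?_, ?_, ?_⟩
    · rw [hec]
      have := Nat.Partrec.Code.evaln_mono hsk hk
      rw [Option.mem_def] at this
      rw [this]; rfl
    · rw [hep]; exact mpZ_false hxl
    · intro t ht hl
      rw [leftB_right hsτ] at hl
      by_contra hlt
      rw [hs0 t (by omega)] at hl
      simp at hl
    · rw [hep]
      exact hxc.trans (nonCnt_anti (fun i hi => mpLim_of hi) x)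
  obtain ⟨e', he', x', hA⟩ := mpA_ex hse hsx hcond
  have := hq _ _ _ hA
  omega

theorem mp_notcomp {p : ℕ} (hp : p < 2) : ¬ Computable (mpLim p) := by
  intro hc
  have h1 : Partrec fun x => (bif mpLim p x then Part.none else Part.some 0 : Part ℕ) :=
    Partrec.cond hc Partrec.none (Computable.const 0).partrec
  obtain ⟨c, h2⟩ := Nat.Partrec.Code.exists_code.1 (Partrec.nat_iff.1 h1)
  refine mp_notce hp c fun x => ?_
  rw [h2]
  rcases h : mpLim p x with _ | _ <;> simp [h]

def Good (c : Nat.Partrec.Code) (A : ℕ → Bool) (f : ℕ → ℕ) : Prop :=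
  ∀ x, (∃ k, f x ∈ c.eval (Nat.pair x (Encodable.encode (restrSeq A k)))) ∧
    ∀ k y, y ∈ c.eval (Nat.pair x (Encodable.encode (restrSeq A k))) → y = f x

theorem mpPhi_iff {s p c x v : ℕ} : mpPhi (mpH s) p c x = Option.some v ↔
    ∃ w < s, Nat.Partrec.Code.evaln w.unpair.2 (Denumerable.ofNat Nat.Partrec.Code c)
    (Nat.pair x (Encodable.encode (restrSeq (mpZ p s) w.unpair.1))) = Option.some v ∧
    ∀ j < w, Nat.Partrec.Code.evaln j.unpair.2 (Denumerable.ofNat Nat.Partrec.Code c)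
    (Nat.pair x (Encodable.encode (restrSeq (mpZ p s) j.unpair.1))) = Option.none := by
  unfold mpPhi
  rw [firstSome_eq_some, mpH_length]
  rfl

theorem mpPhi_keep {r t p c x v : ℕ} (hrt : r ≤ t) (hk : ∀ i < r, mpZ p t i = mpZ p r i)
    (h : mpPhi (mpH r) p c x = Option.some v) : mpPhi (mpH t) p c x = Option.some v := by
  rw [mpPhi_iff] at *
  obtain ⟨w, hw, h1, h2⟩ := h
  have : ∀ j ≤ w, restrSeq (mpZ p t) j.unpair.1 = restrSeq (mpZ p r) j.unpair.1 := by
    intro j hj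
    rw [restr_eq_iff]
    intro i hi
    have := Nat.unpair_left_le j
    exact hk i (by omega)
  refine ⟨w, by omega, by rw [this w le_rfl]; exact h1, fun j hj => by rw [this j hj.le]; exact h2 j hj⟩

theorem mpPhi_lim {p : ℕ} {c : ℕ} {f : ℕ → ℕ} (hg : Good (Denumerable.ofNat Nat.Partrec.Code c) (mpLim p) f) (x : ℕ) :
    ∀ᶠ s in atTop, mpPhi (mpH s) p c x = Option.some (f x) := by
  obtain ⟨⟨k, hk⟩, h2⟩ := hg x
  have hex : ∃ w : ℕ, ∃ v, Nat.Partrec.Code.evaln w.unpair.2 (Denumerable.ofNat Nat.Partrec.Code c)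
    (Nat.pair x (Encodable.encode (restrSeq (mpLim p) w.unpair.1))) = Option.some v := by
    obtain ⟨n, hn⟩ := Nat.Partrec.Code.evaln_complete.1 hk
    exact ⟨Nat.pair k n, f x, by simpa using hn⟩
  obtain ⟨v, hv⟩ := Nat.find_spec hex
  have hmin := fun y hy => Nat.find_min hex (m := y) hy
  set w := Nat.find hex
  have hvf : v = f x := h2 _ _ (Nat.Partrec.Code.evaln_sound hv)
  subst hvf
  filter_upwards [mp_ev p w, eventually_gt_atTop w] with s hs hsw
  have : ∀ j ≤ w, restrSeq (mpZ p s) j.unpair.1 = restrSeq (mpLim p) j.unpair.1 := by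
    intro j hj
    rw [restr_eq_iff]
    intro i hi
    have := Nat.unpair_left_le j
    exact hs i (by omega)
  rw [mpPhi_iff]
  refine ⟨w, hsw, by rw [this w le_rfl]; exact hv, fun j hj => ?_⟩
  rw [this j hj.le]
  have := hmin j hj
  push Not at this
  exact Option.eq_none_iff_forall_ne_some.2 this

theorem mpCnt_eq (s : ℕ) (τ : Str) : mpCnt (mpH s) τ =
    ((List.range s).filter fun r => decide ((mpSg r).take τ.length = τ)).length := by
  unfold mpCnt
  rw [mpH_eq, List.filter_map, List.length_map]
  rfl

theorem mpCnt_succ (s : ℕ) (τ : Str) : mpCnt (mpH (s+1)) τ =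
    mpCnt (mpH s) τ + if (mpSg s).take τ.length = τ then 1 else 0 := by
  rw [mpCnt_eq, mpCnt_eq, List.range_succ, List.filter_append, List.length_append]
  congr 1
  by_cases h : (mpSg s).take τ.length = τ
  · rw [if_pos h]; simp [h]
  · rw [if_neg h]; simp [h]

theorem mpCnt_mono (τ : Str) : Monotone fun s => mpCnt (mpH s) τ :=
  monotone_nat_of_le_succ fun s => by rw [mpCnt_succ]; omega

theorem mpSg_take_succ {s e : ℕ} (he : e < s) : (mpSg s).take (e+1) = (mpSg s).take e ++
    [!((List.range (mpCnt (mpH s) ((mpSg s).take e ++ [false]) + 1)).all (mpAgree (mpH s) e))] := by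
  unfold mpSg
  rw [mpSig_take _ (by omega), mpSig_take _ (by omega), mpSig_succ]

theorem mpAgree_iff {s e x : ℕ} : mpAgree (mpH s) e x = true ↔
    ∃ v, mpPhi (mpH s) 0 e.unpair.1 x = Option.some v ∧ mpPhi (mpH s) 1 e.unpair.2 x = Option.some v := by
  unfold mpAgree
  rw [Bool.and_eq_true, Option.isSome_iff_exists, decide_eq_true_eq]
  constructor
  · rintro ⟨⟨v, h⟩, h2⟩; exact ⟨v, h, h2 ▸ h⟩
  · rintro ⟨v, h, h2⟩; exact ⟨⟨v, h⟩, by rw [h, h2]⟩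

theorem mp_freq {e : ℕ} {τ : Str} {f : ℕ → ℕ} (hτ : TP e τ)
    (h0 : Good (Denumerable.ofNat Nat.Partrec.Code e.unpair.1) (mpLim 0) f)
    (h1 : Good (Denumerable.ofNat Nat.Partrec.Code e.unpair.2) (mpLim 1) f) :
    ∃ᶠ s in atTop, (mpSg s).take (e+1) = τ ++ [false] := by
  by_contra hf
  rw [not_frequently, eventually_atTop] at hf
  obtain ⟨s0, hs0⟩ := hf
  have hl : (τ ++ [false]).length = e + 1 := by simp [hτ.1]
  have hb : ∀ s, mpCnt (mpH s) (τ ++ [false]) ≤ mpCnt (mpH s0) (τ ++ [false]) := by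
    intro s
    by_cases hs : s ≤ s0
    · exact mpCnt_mono _ hs
    · obtain ⟨d, rfl⟩ : ∃ d, s = s0 + d := ⟨s - s0, by omega⟩
      clear hs
      induction d with
      | zero => exact le_rfl
      | succ d ih => rw [← add_assoc, mpCnt_succ, hl, if_neg (hs0 _ (by omega))]; simpa using ih
  set N := mpCnt (mpH s0) (τ ++ [false])
  have hag : ∀ᶠ s in atTop, ∀ x < N + 1, mpAgree (mpH s) e x = true := by
    have : ∀ x, ∀ᶠ s in atTop, mpAgree (mpH s) e x = true := fun x => by
      filter_upwards [mpPhi_lim h0 x, mpPhi_lim h1 x] with s h h'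
      exact mpAgree_iff.2 ⟨_, h, h'⟩
    have h2 := (Finset.eventually_all (Finset.range (N+1))).2 fun x _ => this x
    filter_upwards [h2] with s hs x hx using hs x (by simpa using hx)
  obtain ⟨s, hs, hag, hse, hss⟩ := (hτ.2.1.and_eventually (hag.and ((eventually_gt_atTop e).and (eventually_ge_atTop s0)))).exists
  apply hs0 s hss
  rw [mpSg_take_succ hse, hs]
  congr 2
  rw [Bool.not_eq_false']
  rw [List.all_eq_true]
  intro x hx
  simp at hx
  have := hb s
  exact hag x (by omega)

theorem mp_min {c1 c2 : Nat.Partrec.Code} {f : ℕ → ℕ} (h0 : Good c1 (mpLim 0) f) (h1 : Good c2 (mpLim 1) f) :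
    Computable f := by
  set e := Nat.pair (Encodable.encode c1) (Encodable.encode c2) with he
  have e1 : Denumerable.ofNat Nat.Partrec.Code e.unpair.1 = c1 := by
    rw [he, Nat.unpair_pair]; exact Denumerable.ofNat_encode c1
  have e2 : Denumerable.ofNat Nat.Partrec.Code e.unpair.2 = c2 := by
    rw [he, Nat.unpair_pair]; exact Denumerable.ofNat_encode c2
  rw [← e1] at h0
  rw [← e2] at h1
  clear_value e
  obtain ⟨τ, hτ⟩ := TP_ex e
  have hfreq := mp_freq hτ h0 h1
  have hτ0 := TP_false hτ hfreq
  set τ0 := τ ++ [false] with hτ0d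
  obtain ⟨s0, hs0⟩ := eventually_atTop.1 ((TP_left hτ0).and ((mp_quiet (e+1)).and (eventually_gt_atTop e)))
  -- agreement at stages on the path
  have hag : ∀ s ≥ s0, (mpSg s).take (e+1) = τ0 → ∀ x ≤ mpCnt (mpH s) τ0, mpAgree (mpH s) e x = true := by
    intro s hs hst x hx
    have hte : (mpSg s).take e = τ := by
      have : ((mpSg s).take (e+1)).take e = τ := by rw [hst, hτ0d, List.take_append_of_le_length (by rw [hτ.1]), List.take_of_length_le (by rw [hτ.1])]
      rwa [List.take_take, min_eq_left (by omega)] at this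
    have h3 := mpSg_take_succ (s := s) (e := e) (hs0 s hs).2.2
    rw [hte, hst, hτ0d] at h3
    have h4 := List.append_cancel_left h3
    simp only [List.cons.injEq, and_true] at h4
    have h5 := h4.symm
    rw [Bool.not_eq_false'] at h5
    rw [List.all_eq_true] at h5
    exact h5 x (by rw [hτ0d] at hx; simp; omega)
  have key : ∀ s ≥ s0, (mpSg s).take (e+1) = τ0 → ∀ x ≤ mpCnt (mpH s) τ0, ∀ v,
      mpPhi (mpH s) 0 e.unpair.1 x = Option.some v → ∀ t ≥ s, (mpSg t).take (e+1) = τ0 →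
      mpPhi (mpH t) 0 e.unpair.1 x = Option.some v ∧ mpPhi (mpH t) 1 e.unpair.2 x = Option.some v := by
    intro s hs hst x hx v hv t
    induction t using Nat.strong_induction_on with
    | _ t ih =>
    intro hts htt
    have hat : mpAgree (mpH t) e x = true := hag t (by omega) htt x (hx.trans (mpCnt_mono τ0 hts))
    obtain ⟨v', hv0, hv1⟩ := mpAgree_iff.1 hat
    suffices hvv : v' = v by subst hvv; exact ⟨hv0, hv1⟩
    rcases Nat.lt_or_eq_of_le hts with hlt | rfl
    swap
    · rw [hv] at hv0; simpa using hv0.symm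
    -- last earlier stage on the path
    have hP : ∃ r, s ≤ r ∧ r < t ∧ (mpSg r).take (e+1) = τ0 ∧ ∀ r', r < r' → r' < t → (mpSg r').take (e+1) ≠ τ0 := by
      have hne : ((Finset.range t).filter fun r => s ≤ r ∧ (mpSg r).take (e+1) = τ0).Nonempty :=
        ⟨s, by simp [hlt, hst]⟩
      have hm := Finset.max'_mem _ hne
      have hmx := Finset.le_max' ((Finset.range t).filter fun r => s ≤ r ∧ (mpSg r).take (e+1) = τ0)
      set r := Finset.max' _ hne
      simp only [Finset.mem_filter, Finset.mem_range] at hm hmx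
      refine ⟨r, hm.2.1, hm.1, hm.2.2, fun r' h1 h2 h3 => ?_⟩
      have := hmx r' ⟨h2, by omega, h3⟩
      omega
    obtain ⟨r, hsr, hrt, hrτ, hbet⟩ := hP
    obtain ⟨hr0, hr1⟩ := ih r hrt hsr hrτ
    -- restraint
    have hres : ∀ t', r < t' → t' < t → ∀ e' x' , mpA t' = Option.some (e', x', t') → r < x' := by
      intro t' h1 h2 e' x' hA
      have h3 := (hs0 t' (by omega)).2.1 _ _ _ hA
      have h4 := (mpCond_iff.1 (mpA_spec hA).2.2.2).2.2.2.1 r h1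
      apply h4
      refine leftB_mono (e := e) (by omega) ?_
      rw [leftB_left hrτ]
      have h5 : ((mpSg t').take (e+1)).length = e + 1 := by
        rw [List.length_take, mpSg_length, min_eq_left]; exact (hs0 t' (by omega)).2.2
      rcases leftB_total hτ0.1 h5 (Ne.symm (hbet t' h1 h2)) with h6 | h6
      · rw [leftB_right rfl]; exact h6
      · rw [← leftB_left (α := mpSg t') rfl, (hs0 t' (by omega)).1] at h6
        simp at h6
    have hkeep : ∀ p, (∀ e' x', mpA r = Option.some (e', x', r) → e' % 2 ≠ p) → ∀ i < r, mpZ p t i = mpZ p r i := by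
      intro p hpar i hi
      by_contra hne
      obtain ⟨t', g1, g2, e', x', hA, g3, g4, g5⟩ := mpZ_diff hrt.le (Ne.symm hne)
      rcases Nat.lt_or_eq_of_le g1 with g | rfl
      · have := hres t' g g2 e' x' hA
        omega
      · exact hpar e' x' hA g3
    by_cases hpar : ∃ e' x', mpA r = Option.some (e', x', r) ∧ e' % 2 = 0
    · obtain ⟨e', x', hA, hp⟩ := hpar
      have := mpPhi_keep hrt.le (hkeep 1 fun e'' x'' hA' => by
        rw [hA] at hA'; simp at hA'; omega) hr1
      rw [hv1] at this; simpa using this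
    · push Not at hpar
      have := mpPhi_keep hrt.le (hkeep 0 hpar) hr0
      rw [hv0] at this; simpa using this
  refine computable_of_search (g := fun x s => bif decide (s0 ≤ s) && decide ((mpSig (mpH s) s).take (e+1) = τ0) &&
    decide (x ≤ mpCnt (mpH s) τ0) then mpPhi (mpH s) 0 e.unpair.1 x else Option.none) ?_ ?_ ?_
  · have : Primrec fun q : ℕ × ℕ => bif decide (s0 ≤ q.2) && decide ((mpSig (mpH q.2) q.2).take (e+1) = τ0) &&
      decide (q.1 ≤ mpCnt (mpH q.2) τ0) then mpPhi (mpH q.2) 0 e.unpair.1 q.1 else Option.none := by fun_prop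
    exact this.to_comp
  · intro x s y h
    rw [Bool.cond_eq_ite] at h
    split_ifs at h with h2
    simp only [Bool.and_eq_true, decide_eq_true_eq] at h2
    obtain ⟨t, ht, hl, hts⟩ := (hfreq.and_eventually ((mpPhi_lim h0 x).and (eventually_ge_atTop s))).exists
    have := (key s h2.1.1 h2.1.2 x h2.2 y h t hts ht).1
    rw [hl] at this; simpa using this.symm
  · intro x
    have hcnt : ∃ s1, x ≤ mpCnt (mpH s1) τ0 := by
      have : ∀ n, ∃ s1, n ≤ mpCnt (mpH s1) τ0 := by
        intro n
        induction n with
        | zero => exact ⟨0, by omega⟩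
        | succ n ih =>
          obtain ⟨s1, hs1⟩ := ih
          obtain ⟨t, ht, hts⟩ := (hfreq.and_eventually (eventually_ge_atTop s1)).exists
          refine ⟨t+1, ?_⟩
          rw [mpCnt_succ, hτ0.1, if_pos ht]
          have := mpCnt_mono τ0 hts
          simp only at this
          omega
      exact this x
    obtain ⟨s1, hs1⟩ := hcnt
    obtain ⟨t, ht, hl, hts, hts0⟩ := (hfreq.and_eventually ((mpPhi_lim h0 x).and ((eventually_ge_atTop s1).and (eventually_ge_atTop s0)))).exists
    refine ⟨t, f x, ?_⟩
    have h3 : (decide (s0 ≤ t) && decide ((mpSig (mpH t) t).take (e+1) = τ0) && decide (x ≤ mpCnt (mpH t) τ0)) = true := by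
      simp only [Bool.and_eq_true, decide_eq_true_eq]
      exact ⟨⟨hts0, ht⟩, hs1.trans (mpCnt_mono τ0 hts)⟩
    simp only [h3, cond_true]
    exact hl


/-! ### class-based handling of variable functions -/
def ap1 {α β : Type} (f : α → β) (a : α) : β := f a
def ap2 {α α' β : Type} (f : α → α' → β) (a : α) (b : α') : β := f a b
def rs (Z : ℕ → ℕ → Bool) (s n : ℕ) : Str := restrSeq (Z s) n
theorem ap1_def {α β : Type} (f : α → β) (a : α) : ap1 f a = f a := rfl
theorem ap2_def {α α' β : Type} (f : α → α' → β) (a : α) (b : α') : ap2 f a b = f a b := rfl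
theorem rs_def (Z : ℕ → ℕ → Bool) (s n : ℕ) : rs Z s n = restrSeq (Z s) n := rfl
section
variable {γ : Type} [Primcodable γ] {α α' β : Type} [Primcodable α] [Primcodable α'] [Primcodable β] 
class PR1 (f : α → β) : Prop where
  pr : Primrec f
class PR2 (f : α → α' → β) : Prop where
  pr : Primrec fun p : α × α' => f p.1 p.2
@[fun_prop] theorem pr_ap1 {f : α → β} [hf : PR1 f] {a : γ → α} (ha : Primrec a) :
    Primrec fun x => ap1 f (a x) := hf.pr.comp ha
@[fun_prop] theorem pr_ap2 {f : α → α' → β} [hf : PR2 f] {a : γ → α} {b : γ → α'} (ha : Primrec a)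
    (hb : Primrec b) : Primrec fun x => ap2 f (a x) (b x) := hf.pr.comp (ha.pair hb)
@[fun_prop] theorem pr_rs {Z : ℕ → ℕ → Bool} [hZ : PR2 Z] {s n : γ → ℕ} (hs : Primrec s) (hn : Primrec n) :
    Primrec fun x => rs Z (s x) (n x) := by
  unfold rs
  refine pr_restr (f := fun x => Z (s x)) ?_ hn
  exact hZ.pr.comp ((hs.comp Primrec.fst).pair Primrec.snd)
end

/-! ### few short programs -/
def strLe : ℕ → Finset Str
  | 0 => {[]}
  | L+1 => insert [] ((strLe L).image (List.cons true) ∪ (strLe L).image (List.cons false))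

theorem mem_strLe {ρ : Str} : ∀ {L : ℕ}, ρ.length ≤ L → ρ ∈ strLe L := by
  induction ρ with
  | nil => intro L _; cases L <;> simp [strLe]
  | cons b ρ ih =>
    intro L h
    cases L with
    | zero => simp at h
    | succ L => 
      have := ih (L := L) (by simpa using h)
      cases b <;> simp [strLe, this]

theorem strLe_card (L : ℕ) : (strLe L).card < 2 ^ (L+1) := by
  induction L with
  | zero => simp [strLe]
  | succ L ih =>
    unfold strLe
    have h1 := Finset.card_insert_le ([] : Str) ((strLe L).image (List.cons true) ∪ (strLe L).image (List.cons false))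
    have h2 := Finset.card_union_le ((strLe L).image (List.cons true)) ((strLe L).image (List.cons false))
    have h3 := Finset.card_image_le (s := strLe L) (f := List.cons true)
    have h4 := Finset.card_image_le (s := strLe L) (f := List.cons false)
    rw [pow_succ]
    omega

section CH
variable (v : ℕ → Option (Str × Str)) (Z : ℕ → ℕ → Bool) (c : ℕ)

def chHit (σ : Str) (L t : ℕ) : Bool :=
  (ap1 v t).elim false fun q => decide (q.2 = σ) && decide (q.1.length ≤ L)

def chVer (s k : ℕ) : Bool := (List.range (2^k)).all fun m => (List.range s).any fun t =>
  chHit v (rs Z s (2^k+m)) (k+c) t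

def chNew (s k : ℕ) : Bool := chVer v Z c s k && !((List.range s).any fun s' =>
  chVer v Z c s' k && decide (rs Z s' (2^k) = rs Z s (2^k)))

def chCnt (S k : ℕ) : ℕ := ((List.range S).filter fun s => chNew v Z c s k).length

theorem chCnt_succ (S k : ℕ) : chCnt v Z c (S+1) k = chCnt v Z c S k + bif chNew v Z c S k then 1 else 0 := by
  unfold chCnt
  rw [List.range_succ, List.filter_append, List.length_append]
  congr 1
  cases h : chNew v Z c S k <;> simp [h]

theorem chCnt_mono (k : ℕ) : Monotone fun S => chCnt v Z c S k :=
  monotone_nat_of_le_succ fun s => by rw [chCnt_succ]; omega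

variable {v Z c}

theorem chVer_iff {s k : ℕ} : chVer v Z c s k = true ↔
    ∀ m < 2^k, ∃ t < s, ∃ ρ, v t = Option.some (ρ, restrSeq (Z s) (2^k+m)) ∧ ρ.length ≤ k + c := by
  unfold chVer chHit
  simp only [rs_def, ap1_def, List.all_eq_true, List.mem_range, List.any_eq_true]
  refine forall_congr' fun m => forall_congr' fun hm => exists_congr fun t => and_congr_right fun ht => ?_
  rcases h : v t with _ | ⟨ρ, σ⟩
  · simp
  · simp only [Option.elim, Bool.and_eq_true, decide_eq_true_eq, Option.some.injEq, Prod.mk.injEq]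
    constructor
    · rintro ⟨h1, h2⟩; exact ⟨ρ, ⟨rfl, of_decide_eq_true h1⟩, h2⟩
    · rintro ⟨ρ', ⟨rfl, h1⟩, h2⟩; exact ⟨decide_eq_true h1, h2⟩

theorem chCnt_le {V : Str →. Str} (hv : ∀ a b, b ∈ V a ↔ ∃ t, v t = Option.some (a, b)) (S k : ℕ) :
    chCnt v Z c S k ≤ 2 ^ (c+1) := by
  set T := (Finset.range S).filter fun s => chNew v Z c s k = true with hT
  have hTc : chCnt v Z c S k = T.card := by
    rw [hT, Finset.card_def, Finset.filter_val, Finset.range_val, Multiset.range, Multiset.filter_coe, Multiset.coe_card]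
    unfold chCnt
    congr 2
    funext s
    simp
  have hver : ∀ s ∈ T, chVer v Z c s k = true := by
    intro s hs
    have := (Finset.mem_filter.1 hs).2
    unfold chNew at this
    rw [Bool.and_eq_true] at this
    exact this.1
  have hdist : ∀ s ∈ T, ∀ s' ∈ T, s < s' → restrSeq (Z s) (2^k) ≠ restrSeq (Z s') (2^k) := by
    intro s hs s' hs' hlt heq
    have := (Finset.mem_filter.1 hs').2
    unfold chNew at this
    rw [Bool.and_eq_true, Bool.not_eq_true', List.any_eq_false] at this
    exact this.2 s (by simpa using hlt) (by simp [hver s hs, heq, rs_def])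
  have hch : ∀ s m, ∃ ρ : Str, s ∈ T → m < 2^k → restrSeq (Z s) (2^k+m) ∈ V ρ ∧ ρ.length ≤ k + c := by
    intro s m
    by_cases h : s ∈ T ∧ m < 2^k
    · obtain ⟨t, _, ρ, h1, h2⟩ := chVer_iff.1 (hver s h.1) m h.2
      exact ⟨ρ, fun _ _ => ⟨(hv _ _).2 ⟨t, h1⟩, h2⟩⟩
    · exact ⟨[], fun h1 h2 => absurd ⟨h1, h2⟩ h⟩
  choose R hR using hch
  have hcard : (T ×ˢ Finset.range (2^k)).card ≤ (strLe (k+c)).card := by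
    refine Finset.card_le_card_of_injOn (fun q => R q.1 q.2) ?_ ?_
    · intro q hq
      simp only [Finset.coe_product, Set.mem_prod, Finset.mem_coe, Finset.mem_range] at hq
      exact mem_strLe (hR _ _ hq.1 hq.2).2
    · rintro ⟨s, m⟩ hq ⟨s', m'⟩ hq' heq
      simp only [Finset.coe_product, Set.mem_prod, Finset.mem_coe, Finset.mem_range] at hq hq'
      simp only at heq
      have h1 := (hR _ _ hq.1 hq.2).1
      have h2 := (hR _ _ hq'.1 hq'.2).1
      rw [heq] at h1
      have h3 := Part.mem_unique h1 h2
      have h4 : m = m' := by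
        have := congrArg List.length h3
        simp at this
        exact this
      subst h4
      have h5 := restr_eq_mono (m := 2^k) (by omega) h3
      have h6 : s = s' := by
        rcases Nat.lt_trichotomy s s' with h | h | h
        · exact absurd h5 (hdist s hq.1 s' hq'.1 h)
        · exact h
        · exact absurd h5.symm (hdist s' hq'.1 s hq.1 h)
      rw [h6]
  rw [Finset.card_product, Finset.card_range, ← hTc] at hcard
  have h1 := strLe_card (k+c)
  have h2 : 2 ^ (k+c+1) = 2 ^ (c+1) * 2^k := by rw [← pow_add]; congr 1; omega
  rw [h2] at h1
  by_contra hlt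
  push Not at hlt
  have := Nat.mul_le_mul_right (2^k) hlt.le
  omega
end CH

section
variable {γ : Type} [Primcodable γ] {v : ℕ → Option (Str × Str)} {Z : ℕ → ℕ → Bool} [PR1 v] [PR2 Z]
@[fun_prop] theorem pr_chHit {σ : γ → Str} {L t : γ → ℕ} (hσ : Primrec σ) (hL : Primrec L) (ht : Primrec t) :
    Primrec fun x => chHit v (σ x) (L x) (t x) := by unfold chHit; fun_prop
@[fun_prop] theorem pr_chVer {c s k : γ → ℕ} (hc : Primrec c) (hs : Primrec s) (hk : Primrec k) :
    Primrec fun x => chVer v Z (c x) (s x) (k x) := by unfold chVer; fun_prop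
@[fun_prop] theorem pr_chNew {c s k : γ → ℕ} (hc : Primrec c) (hs : Primrec s) (hk : Primrec k) :
    Primrec fun x => chNew v Z (c x) (s x) (k x) := by unfold chNew; fun_prop
@[fun_prop] theorem pr_chCnt {c s k : γ → ℕ} (hc : Primrec c) (hs : Primrec s) (hk : Primrec k) :
    Primrec fun x => chCnt v Z (c x) (s x) (k x) := by unfold chCnt; fun_prop
end

theorem ch_lemma {V : Str →. Str} (hV : Partrec V) {X : ℕ → Bool} {Z : ℕ → ℕ → Bool} (hZ : Apx X Z) (c : ℕ)
    {P : ℕ → Prop} (hP : ∀ K, ∃ k ≥ K, P k)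
    (hc : ∀ k, P k → ∀ m < 2^k, KC V (restrSeq X (2^k+m)) ≤ (k + c : ℕ)) :
    ∃ C : Nat.Partrec.Code, (∀ k x y, P k → y ∈ C.eval (Nat.pair x k) → y = Encodable.encode (X x)) ∧
      ∀ x, ∃ k, P k ∧ (C.eval (Nat.pair x k)).Dom := by
  obtain ⟨v, hvp, hv, -, -⟩ := exists_enum hV
  have hZp := hZ.pr
  have hbig : ∀ k, P k → ∀ᶠ s in atTop, chVer v Z c s k = true ∧ restrSeq (Z s) (2^k) = restrSeq X (2^k) := by
    intro k hk
    have h1 : ∀ m < 2^k, ∃ t, ∃ ρ, v t = Option.some (ρ, restrSeq X (2^k+m)) ∧ ρ.length ≤ k + c := by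
      intro m hm
      obtain ⟨ρ, h1, h2⟩ := KC_le_iff.1 (hc k hk m hm)
      obtain ⟨t, ht⟩ := (hv _ _).1 h1
      exact ⟨t, ρ, ht, h2⟩
    choose! T hT using h1
    filter_upwards [hZ.lim (2^k+2^k), (Finset.eventually_all (Finset.range (2^k))).2 fun m _ => eventually_gt_atTop (T m)] with s hs hs2
    refine ⟨chVer_iff.2 fun m hm => ?_, restr_eq_mono (Nat.le_add_right _ _) hs⟩
    refine ⟨T m, hs2 m (by simpa using hm), ?_⟩
    rw [restr_eq_mono (m := 2^k+m) (by omega) hs]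
    exact hT m hm
  -- the limsup
  have hr : ∃ r, (∀ K, ∃ k ≥ K, P k ∧ ∃ S, r ≤ chCnt v Z c S k) ∧
      ¬ (∀ K, ∃ k ≥ K, P k ∧ ∃ S, r + 1 ≤ chCnt v Z c S k) := by
    by_contra hno
    push Not at hno
    have : ∀ r, ∀ K, ∃ k ≥ K, P k ∧ ∃ S, r ≤ chCnt v Z c S k := by
      intro r
      induction r with
      | zero => intro K; obtain ⟨k, h1, h2⟩ := hP K; exact ⟨k, h1, h2, 0, by omega⟩
      | succ r ih => exact hno r ih
    obtain ⟨k, _, _, S, hS⟩ := this (2^(c+1)+1) 0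
    have := chCnt_le (Z := Z) (c := c) hv S k
    omega
  obtain ⟨r, hr1, hr2⟩ := hr
  push Not at hr2
  obtain ⟨k0, hk0⟩ := hr2
  have hpr : Primrec fun q : ℕ × ℕ => (bif decide (k0 ≤ q.1.unpair.2) && decide (q.1.unpair.1 < 2^q.1.unpair.2) &&
      decide (r ≤ chCnt v Z c q.2 q.1.unpair.2) then Option.some (Encodable.encode (Z q.2 q.1.unpair.1)) else Option.none) := by
    have : PR1 v := ⟨hvp⟩
    have : PR2 Z := ⟨hZp⟩
    simp only [← ap2_def Z]
    fun_prop
  have hpart := Partrec.rfindOpt (f := fun a b : ℕ => (bif decide (k0 ≤ a.unpair.2) && decide (a.unpair.1 < 2^a.unpair.2) &&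
      decide (r ≤ chCnt v Z c b a.unpair.2) then Option.some (Encodable.encode (Z b a.unpair.1)) else Option.none)) hpr.to_comp
  obtain ⟨C, hC⟩ := Nat.Partrec.Code.exists_code.1 (Partrec.nat_iff.1 hpart)
  refine ⟨C, ?_, ?_⟩
  · intro k x y hk hy
    rw [hC] at hy
    obtain ⟨S, hS⟩ := Nat.rfindOpt_spec hy
    simp only [Nat.unpair_pair, Bool.cond_eq_ite, Option.mem_def] at hS
    split_ifs at hS with h
    simp only [Bool.and_eq_true, decide_eq_true_eq] at h
    obtain ⟨⟨h1, h2⟩, h3⟩ := h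
    simp only [Option.some.injEq] at hS
    rw [← hS]
    congr 1
    suffices hs : restrSeq (Z S) (2^k) = restrSeq X (2^k) from restr_eq_iff.1 hs x h2
    obtain ⟨u0, hu0⟩ := eventually_atTop.1 (hbig k hk)
    by_cases hex : ∃ S' < S, chVer v Z c S' k = true ∧ restrSeq (Z S') (2^k) = restrSeq X (2^k)
    · obtain ⟨S', hlt, _, hX⟩ := hex
      have := hZ.noret (2^k) S' S (max S u0) hlt.le (by omega) (by rw [hX, (hu0 _ (by omega)).2])
      rw [this, hX]
    · exfalso
      have hex2 : ∃ u, chVer v Z c u k = true ∧ restrSeq (Z u) (2^k) = restrSeq X (2^k) := ⟨u0, hu0 u0 le_rfl⟩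
      have hu := Nat.find_spec hex2
      have hmin := fun y hy => Nat.find_min hex2 (m := y) hy
      set u := Nat.find hex2
      have huS : S ≤ u := by
        by_contra hlt; exact hex ⟨u, by omega, hu⟩
      have hnew : chNew v Z c u k = true := by
        unfold chNew
        rw [Bool.and_eq_true, Bool.not_eq_true', List.any_eq_false]
        refine ⟨hu.1, fun s hs hh => ?_⟩
        simp only [Bool.and_eq_true, decide_eq_true_eq] at hh
        exact hmin s (by simpa using hs) ⟨hh.1, hh.2.trans hu.2⟩
      have h4 := hk0 k h1 hk (u+1)
      rw [chCnt_succ, hnew] at h4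
      have := chCnt_mono v Z c k huS
      simp at this h4
      omega
  · intro x
    obtain ⟨k, hk, hPk, S, hS⟩ := hr1 (max k0 x)
    refine ⟨k, hPk, ?_⟩
    rw [hC, Nat.rfindOpt_dom]
    have hx : x < 2^k := lt_of_le_of_lt (by omega) (Nat.lt_two_pow_self (n := k))
    refine ⟨S, Encodable.encode (Z S x), ?_⟩
    simp only [Nat.unpair_pair, Option.mem_def]
    rw [decide_eq_true (show k0 ≤ k by omega), decide_eq_true hx, decide_eq_true hS]
    rfl

theorem comp_of_code {X : ℕ → Bool} {C : Nat.Partrec.Code}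
    (h1 : ∀ k x y, y ∈ C.eval (Nat.pair x k) → y = Encodable.encode (X x))
    (h2 : ∀ x, ∃ k, (C.eval (Nat.pair x k)).Dom) : Computable fun x => Encodable.encode (X x) := by
  refine computable_of_search (g := fun x w => Nat.Partrec.Code.evaln w.unpair.2 C (Nat.pair x w.unpair.1)) ?_ ?_ ?_
  · have : Primrec fun q : ℕ × ℕ => Nat.Partrec.Code.evaln q.2.unpair.2 C (Nat.pair q.1 q.2.unpair.1) := by fun_prop
    exact this.to_comp
  · intro x s y h
    exact h1 _ _ _ (Nat.Partrec.Code.evaln_sound h)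
  · intro x
    obtain ⟨k, hk⟩ := h2 x
    obtain ⟨y, hy⟩ := Part.dom_iff_mem.1 hk
    obtain ⟨n, hn⟩ := Nat.Partrec.Code.evaln_complete.1 hy
    exact ⟨Nat.pair k n, y, by simpa using hn⟩

theorem comp_of_enc {X : ℕ → Bool} (h : Computable fun x => Encodable.encode (X x)) : Computable X := by
  have h2 : Computable fun n : ℕ => (Encodable.decode (α := Bool) n).getD false :=
    (Primrec.option_getD.comp Primrec.decode (Primrec.const false)).to_comp
  refine (h2.comp h).of_eq fun x => ?_
  simp

theorem comp_restr {X : ℕ → Bool} (h : Computable X) : Computable fun n => restrSeq X n := by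
  have : Computable fun n : ℕ => Nat.rec (motive := fun _ => Str) [] (fun y ih => ih ++ [X y]) n := by
    refine Computable.nat_rec (f := fun n : ℕ => n) (g := fun _ => []) (h := fun _ p => p.2 ++ [X p.1]) Computable.id (Computable.const _) ?_
    exact Computable.list_concat.comp (Computable.snd.comp Computable.snd) (h.comp (Computable.fst.comp Computable.snd))
  refine this.of_eq fun n => ?_
  induction n with
  | zero => rfl
  | succ n ih =>
    simp only at ih ⊢
    rw [ih]
    simp [restrSeq, List.range_succ]

theorem ctriv_of_comp {V : Str →. Str} (hV : OptimalPlain V) {X : ℕ → Bool} (h : Computable X) : CTrivialSeq V X := by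
  have hM : PlainMachine fun ρ => (V ρ).map fun σ => restrSeq X σ.length := by
    refine Partrec.map hV.1 ?_
    exact (comp_restr h).comp (Computable.list_length.comp Computable.snd)
  obtain ⟨c, hc⟩ := hV.2 _ hM
  refine ⟨c, fun n => KC_le_add fun k hk => ?_⟩
  obtain ⟨ρ, h1, h2⟩ := KC_le_iff.1 hk
  have : KC (fun ρ => (V ρ).map fun σ => restrSeq X σ.length) (restrSeq X n) ≤ (k:ℕ) := by
    refine KC_le_iff.2 ⟨ρ, ?_, h2⟩
    rw [Part.mem_map_iff]
    exact ⟨_, h1, by simp⟩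
  refine (hc _).trans ?_
  push_cast
  gcongr

theorem plain_bound {V : Str →. Str} (hV : OptimalPlain V) {M : Str → Str} (hM : Computable M) :
    ∃ c, ∀ k m, m < 2^k → ∀ σ, (∀ ρ : Str, ρ.length = k → bval ρ = m → M ρ = σ) → KC V σ ≤ (k + c : ℕ) := by
  obtain ⟨c, hc⟩ := hV.2 (fun ρ => Part.some (M ρ)) hM.partrec
  refine ⟨c, fun k m hm σ h => ?_⟩
  obtain ⟨ρ, h1, h2⟩ := exists_bval k m hm
  refine (hc σ).trans ?_
  push_cast
  gcongr
  exact KC_le_iff.2 ⟨ρ, by rw [Part.mem_some_iff, h ρ h1 h2], h1.le⟩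

theorem zero_bound {V : Str →. Str} (hV : OptimalPlain V) : ∃ c, ∀ k m, m < 2^k → KC V (zeroStr (2^k+m)) ≤ (k + c : ℕ) := by
  have : Primrec fun ρ : Str => zeroStr (2^ρ.length + bval ρ) := by fun_prop
  obtain ⟨c, hc⟩ := plain_bound hV this.to_comp
  exact ⟨c, fun k m hm => hc k m hm _ fun ρ h1 h2 => by rw [h1, h2]⟩

theorem comp_of_ctriv {V : Str →. Str} (hV : OptimalPlain V) {X : ℕ → Bool} (hX : CEReal X) (h : CTrivialSeq V X) :
    Computable X := by
  obtain ⟨Z, hZ⟩ := ceReal_apx hX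
  obtain ⟨c, hc⟩ := zero_bound hV
  obtain ⟨d, hd⟩ := h
  obtain ⟨C, h1, h2⟩ := ch_lemma hV.1 hZ (c + d) (P := fun _ => True) (fun K => ⟨K, le_rfl, trivial⟩) (by
    intro k _ m hm
    refine (hd _).trans ?_
    rw [← add_assoc, Nat.cast_add (k+c) d]
    gcongr
    exact hc k m hm)
  exact comp_of_enc (comp_of_code (fun k x y => h1 k x y trivial) (fun x => by
    obtain ⟨k, _, h⟩ := h2 x; exact ⟨k, h⟩))

/-! ### the pair -/
def mpB (p s i : ℕ) : Bool := decide (i = 2^(Nat.log 2 i)) && decide (1 ≤ Nat.log 2 i) && mpZ p s (Nat.log 2 i - 1)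
noncomputable def mpL (p i : ℕ) : Bool := decide (i = 2^(Nat.log 2 i)) && decide (1 ≤ Nat.log 2 i) && mpLim p (Nat.log 2 i - 1)

theorem mpL_pow (p j : ℕ) : mpL p (2^(j+1)) = mpLim p j := by
  unfold mpL
  rw [Nat.log_pow (by norm_num)]
  simp

@[fun_prop] theorem pr_mpZ {γ : Type} [Primcodable γ] {p s y : γ → ℕ} (hp : Primrec p) (hs : Primrec s) (hy : Primrec y) :
    Primrec fun x => mpZ (p x) (s x) (y x) := by unfold mpZ; fun_prop

@[fun_prop] theorem pr_mpB {γ : Type} [Primcodable γ] {p s y : γ → ℕ} (hp : Primrec p) (hs : Primrec s) (hy : Primrec y) :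
    Primrec fun x => mpB (p x) (s x) (y x) := by unfold mpB; fun_prop

theorem mpL_ce (p : ℕ) : CEReal (mpL p) := by
  refine ceReal_of_ce (a := mpB p) (by fun_prop) ?_ ?_
  · intro s t i hst h
    simp only [mpB, Bool.and_eq_true] at *
    exact ⟨h.1, mpZ_mono hst h.2⟩
  · intro i
    simp only [mpB, mpL, Bool.and_eq_true, mpLim_iff, exists_and_left]

theorem mpL_nontriv {V : Str →. Str} (hV : OptimalPlain V) {p : ℕ} (hp : p < 2) : ¬ CTrivialSeq V (mpL p) := by
  intro h
  have h1 := comp_of_ctriv hV (mpL_ce p) h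
  have h2 : Primrec fun j : ℕ => 2^(j+1) := by fun_prop
  exact mp_notcomp hp ((h1.comp h2.to_comp).of_eq fun j => mpL_pow p j)

def mpTrue (p k : ℕ) : Prop := restrSeq (mpZ p k) k = restrSeq (mpLim p) k

theorem mpL_bound {V : Str →. Str} (hV : OptimalPlain V) (p : ℕ) : ∃ c, ∀ k, mpTrue p k → ∀ m < 2^k,
    KC V (restrSeq (mpL p) (2^k+m)) ≤ (k + c : ℕ) := by
  have : Primrec fun ρ : Str => restrSeq (mpB p ρ.length) (2^ρ.length + bval ρ) := by fun_prop
  obtain ⟨c, hc⟩ := plain_bound hV this.to_comp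
  refine ⟨c, fun k hk m hm => hc k m hm _ fun ρ h1 h2 => ?_⟩
  rw [h1, h2, restr_eq_iff]
  intro i hi
  unfold mpB mpL
  by_cases hl : 1 ≤ Nat.log 2 i
  · rw [restr_eq_iff.1 hk]
    have : Nat.log 2 i < k + 1 := Nat.log_lt_of_lt_pow (by rintro rfl; simp at hl) (by rw [pow_succ]; omega)
    omega
  · simp [hl]

theorem mpL_good {V : Str →. Str} (hV : OptimalPlain V) (p : ℕ) {X : ℕ → Bool} (hX : CEReal X) (h : CLeSeq V X (mpL p)) :
    ∃ c, Good c (mpLim p) fun x => Encodable.encode (X x) := by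
  obtain ⟨Z, hZ⟩ := ceReal_apx hX
  obtain ⟨c, hc⟩ := mpL_bound hV p
  obtain ⟨d, hd⟩ := h
  obtain ⟨C, h1, h2⟩ := ch_lemma hV.1 hZ (c + d) (P := mpTrue p) (fun K => by
      obtain ⟨k, h1, h2⟩ := mp_true p K
      exact ⟨k, h1, restr_eq_iff.2 h2⟩) (by
    intro k hk m hm
    refine (hd _).trans ?_
    rw [← add_assoc, Nat.cast_add (k+c) d]
    gcongr
    exact hc k hk m hm)
  have hpr : Primrec fun q : ℕ => (Encodable.decode (α := Str) q.unpair.2).elim false fun α => decide (restrSeq (mpZ p α.length) α.length = α) := by fun_prop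
  have hpr2 : Primrec fun q : ℕ => (Encodable.decode (α := Str) q.unpair.2).elim 0 fun α => Nat.pair q.unpair.1 α.length := by fun_prop
  have hpart : Partrec fun q : ℕ => bif (Encodable.decode (α := Str) q.unpair.2).elim false fun α => decide (restrSeq (mpZ p α.length) α.length = α)
      then C.eval ((Encodable.decode (α := Str) q.unpair.2).elim 0 fun α => Nat.pair q.unpair.1 α.length) else Part.none := by
    refine Partrec.cond hpr.to_comp ?_ Partrec.none
    exact (Nat.Partrec.Code.eval_part.comp (Computable.const C) hpr2.to_comp)
  obtain ⟨C', hC'⟩ := Nat.Partrec.Code.exists_code.1 (Partrec.nat_iff.1 hpart)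
  have hev : ∀ x k y, y ∈ C'.eval (Nat.pair x (Encodable.encode (restrSeq (mpLim p) k))) ↔ mpTrue p k ∧ y ∈ C.eval (Nat.pair x k) := by
    intro x k y
    rw [hC']
    simp only [Nat.unpair_pair, Encodable.encodek, Option.elim, restr_length]
    unfold mpTrue
    by_cases ht : restrSeq (mpZ p k) k = restrSeq (mpLim p) k
    · simp [ht]
    · simp [ht]
  refine ⟨C', fun x => ⟨?_, ?_⟩⟩
  · obtain ⟨k, hk, hd⟩ := h2 x
    obtain ⟨y, hy⟩ := Part.dom_iff_mem.1 hd
    refine ⟨k, (hev _ _ _).2 ⟨hk, ?_⟩⟩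
    simp only [← h1 k x y hk hy]
    exact hy
  · intro k y hy
    have := (hev _ _ _).1 hy
    exact h1 k x y this.1 this.2

theorem part1 {V : Str →. Str} (hV : OptimalPlain V) :
    ∃ A D : ℕ → Bool, CEReal A ∧ CEReal D ∧ ¬ CTrivialSeq V A ∧ ¬ CTrivialSeq V D ∧
        ∀ X : ℕ → Bool, CEReal X → CLeSeq V X A → CLeSeq V X D → CTrivialSeq V X := by
  refine ⟨mpL 0, mpL 1, mpL_ce 0, mpL_ce 1, mpL_nontriv hV (by norm_num), mpL_nontriv hV (by norm_num), ?_⟩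
  intro X hX h0 h1
  obtain ⟨c0, g0⟩ := mpL_good hV 0 hX h0
  obtain ⟨c1, g1⟩ := mpL_good hV 1 hX h1
  exact ctriv_of_comp hV (comp_of_enc (mp_min g0 g1))


/-! ### Part 2 : tokens and masses -/
structure UE (U : Str →. Str) (u : ℕ → Option (Str × Str)) : Prop where
  pr : Primrec u
  mem : ∀ a b, b ∈ U a ↔ ∃ t, u t = Option.some (a, b)
  inj : ∀ t t' a b b', u t = Option.some (a, b) → u t' = Option.some (a, b') → t = t'
  bd : ∀ t a b, u t = Option.some (a, b) → a.length ≤ t ∧ b.length ≤ t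
  pf : ∀ ρ₁ ρ₂ : Str, (U ρ₁).Dom → (U ρ₂).Dom → ρ₁ <+: ρ₂ → ρ₁ = ρ₂

theorem exists_UE {U : Str →. Str} (hU : OptimalPF U) : ∃ u, UE U u := by
  obtain ⟨u, h1, h2, h3, h4⟩ := exists_enum hU.1.1
  exact ⟨u, h1, h2, h3, fun t a b h => ⟨(Encodable.length_le_encode a).trans (h4 t a b h).1,
    (Encodable.length_le_encode b).trans (h4 t a b h).2⟩, hU.1.2⟩

section tok
variable (u : ℕ → Option (Str × Str)) (Z : ℕ → ℕ → Bool)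
def pl (t : ℕ) : ℕ := (ap1 u t).elim 0 fun p => p.1.length
def sl (t : ℕ) : ℕ := (ap1 u t).elim 0 fun p => p.2.length
def zs (t : ℕ) : Bool := (ap1 u t).elim false fun p => decide (p.2 = zeroStr p.2.length)
def cur (s t : ℕ) : Bool := (ap1 u t).elim false fun p => decide (p.2 = rs Z s p.2.length)
noncomputable def wt (t : ℕ) : ℝ := (u t).elim 0 fun p => (1/2 : ℝ) ^ p.1.length
def mN (s n : ℕ) : ℕ := ∑ t ∈ Finset.range s, bif (cur u Z s t && decide (n ≤ sl u t)) then 2^(s - pl u t) else 0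
noncomputable def mR (s n : ℕ) : ℝ :=
  ∑ t ∈ (Finset.range s).filter (fun t => cur u Z s t = true ∧ n ≤ sl u t), wt u t

section
variable {u Z} [PR1 u] [PR2 Z] {γ : Type} [Primcodable γ] {s t n : γ → ℕ}
@[fun_prop] theorem pr_pl (ht : Primrec t) : Primrec fun x => pl u (t x) := by unfold pl; fun_prop
@[fun_prop] theorem pr_sl (ht : Primrec t) : Primrec fun x => sl u (t x) := by unfold sl; fun_prop
@[fun_prop] theorem pr_zs (ht : Primrec t) : Primrec fun x => zs u (t x) := by unfold zs; fun_prop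
@[fun_prop] theorem pr_cur (hs : Primrec s) (ht : Primrec t) : Primrec fun x => cur u Z (s x) (t x) := by
  unfold cur; fun_prop
@[fun_prop] theorem pr_mN (hs : Primrec s) (hn : Primrec n) : Primrec fun x => mN u Z (s x) (n x) := by
  unfold mN; fun_prop
end

variable {u Z}

theorem wt_nonneg (t : ℕ) : 0 ≤ wt u t := by
  unfold wt; cases u t <;> simp

theorem wt_eq {t : ℕ} {p} (h : u t = Option.some p) : wt u t = (1/2:ℝ)^(pl u t) := by
  simp [wt, pl, ap1, h]

theorem zs_iff {t : ℕ} : zs u t = true ↔ ∃ ρ, u t = Option.some (ρ, zeroStr (sl u t)) := by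
  unfold zs sl ap1
  rcases h : u t with _ | ⟨ρ, σ⟩
  · simp
  · simp only [Option.elim, Option.some.injEq, Prod.mk.injEq]
    exact ⟨fun h => ⟨ρ, rfl, of_decide_eq_true h⟩, fun ⟨_, _, h⟩ => decide_eq_true h⟩

theorem cur_iff {s t : ℕ} : cur u Z s t = true ↔ ∃ ρ, u t = Option.some (ρ, restrSeq (Z s) (sl u t)) := by
  unfold cur sl ap1 rs
  rcases h : u t with _ | ⟨ρ, σ⟩
  · simp
  · simp only [Option.elim, Option.some.injEq, Prod.mk.injEq]
    exact ⟨fun h => ⟨ρ, rfl, of_decide_eq_true h⟩, fun ⟨_, _, h⟩ => decide_eq_true h⟩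

theorem cur_wt {s t : ℕ} (h : cur u Z s t = true) : wt u t = (1/2:ℝ)^(pl u t) := by
  obtain ⟨ρ, h⟩ := cur_iff.1 h; exact wt_eq h
theorem zs_wt {t : ℕ} (h : zs u t = true) : wt u t = (1/2:ℝ)^(pl u t) := by
  obtain ⟨ρ, h⟩ := zs_iff.1 h; exact wt_eq h

variable {U : Str →. Str}
theorem UE.pl_le (hu : UE U u) (t : ℕ) : pl u t ≤ t := by
  unfold pl ap1
  rcases h : u t with _ | ⟨ρ, σ⟩
  · simp
  · exact (hu.bd _ _ _ h).1
theorem UE.sl_le (hu : UE U u) (t : ℕ) : sl u t ≤ t := by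
  unfold sl ap1
  rcases h : u t with _ | ⟨ρ, σ⟩
  · simp
  · exact (hu.bd _ _ _ h).2

theorem UE.kraft (hu : UE U u) (F : Finset ℕ) : ∑ t ∈ F, wt u t ≤ 1 := by
  set V := F.filter fun t => (u t).isSome
  set f : ℕ → Str := fun t => (u t).elim [] fun p => p.1
  have h1 : ∑ t ∈ F, wt u t = ∑ t ∈ V, (1/2:ℝ)^(f t).length := by
    rw [Finset.sum_filter]
    refine Finset.sum_congr rfl fun t _ => ?_
    unfold wt
    rcases h : u t with _ | ⟨ρ, σ⟩ <;> simp [f, h]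
  have hinj : Set.InjOn f V := by
    intro t ht t' ht' e
    simp [V, Option.isSome_iff_exists] at ht ht'
    obtain ⟨-, a, b, ht⟩ := ht
    obtain ⟨-, a', b', ht'⟩ := ht'
    simp [f, ht, ht'] at e
    subst e
    exact hu.inj _ _ _ _ _ ht ht'
  rw [h1, ← Finset.sum_image (f := fun a : Str => (1/2:ℝ)^a.length) (g := f) hinj]
  apply KPaper.kraft
  have hd : ∀ a ∈ V.image f, (U a).Dom := by
    intro a ha
    simp [V, Option.isSome_iff_exists] at ha
    obtain ⟨t, ⟨-, a', b, ht⟩, rfl⟩ := ha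
    simp only [f, ht, Option.elim]
    exact Part.dom_iff_mem.2 ⟨b, (hu.mem _ _).2 ⟨t, ht⟩⟩
  exact fun a ha b hb hab => hu.pf a b (hd a ha) (hd b hb) hab

theorem UE.mN_eq (hu : UE U u) (s n : ℕ) : (mN u Z s n : ℝ) = 2^s * mR u Z s n := by
  unfold mN mR
  rw [Finset.mul_sum, Finset.sum_filter]
  push_cast
  refine Finset.sum_congr rfl fun t ht => ?_
  by_cases h : cur u Z s t = true ∧ n ≤ sl u t
  · rw [if_pos h, cur_wt h.1, h.1, decide_eq_true h.2]
    have := (hu.pl_le t).trans (Finset.mem_range.1 ht).le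
    simp only [Bool.and_self, cond_true]
    push_cast
    obtain ⟨k, hk⟩ := Nat.exists_eq_add_of_le this
    rw [hk, Nat.add_sub_cancel_left, pow_add, mul_comm (2^_) (2^k), mul_assoc, ← mul_pow]
    norm_num
  · rw [if_neg h]
    have : (cur u Z s t && decide (n ≤ sl u t)) = false := by
      rw [← Bool.not_eq_true, Bool.and_eq_true, decide_eq_true_eq]; exact h
    rw [this]; simp

theorem UE.prog (hu : UE U u) {σ : Str} {k : ℕ} (h : KC U σ ≤ k) : ∃ t ρ, u t = Option.some (ρ, σ) ∧ ρ.length ≤ k := by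
  obtain ⟨ρ, h1, h2⟩ := KC_le_iff.1 h
  obtain ⟨t, ht⟩ := (hu.mem _ _).1 h1
  exact ⟨t, ρ, ht, h2⟩
theorem UE.zprog (hu : UE U u) {n k : ℕ} (h : KC U (zeroStr n) ≤ k) : ∃ t, zs u t = true ∧ sl u t = n ∧ pl u t ≤ k := by
  obtain ⟨t, ρ, ht, h2⟩ := hu.prog h
  have e : sl u t = n := by simp [sl, ap1, ht]
  refine ⟨t, zs_iff.2 ⟨ρ, by rw [e, ht]⟩, e, by simpa [pl, ap1, ht] using h2⟩
theorem UE.KC_le (hu : UE U u) {t : ℕ} {ρ σ} (h : u t = Option.some (ρ, σ)) : KC U σ ≤ (pl u t : ℕ) := by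
  refine KC_le_iff.2 ⟨ρ, (hu.mem _ _).2 ⟨t, h⟩, ?_⟩
  simp [pl, ap1, h]
end tok


/-! ### the recursive procedure -/
abbrev Qy := ℕ × ℕ × ℕ × ℕ
abbrev En := ℕ × ℕ × ℕ
abbrev LS := ℕ × List En

def cc (k : ℕ) : ℕ := 2^(k+2)

section proc
variable (u : ℕ → Option (Str × Str)) (A D : ℕ → ℕ → Bool)
def rs2 (r s n : ℕ) : Str := bif decide (r % 2 = 0) then rs A s n else rs D s n
def actB (r τ : ℕ) (e : En) : Bool := decide (rs2 A D r τ (2^e.2.1) = rs2 A D r e.2.2 (2^e.2.1))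
def sucT (r τ : ℕ) (e : En) : ℕ := bif actB A D r τ e then 0 else 2^(τ - pl u e.1)
def sucN (r : ℕ) (S : LS) : ℕ := (S.2.map fun e => sucT u A D r S.1 e).sum
def doneB (k r : ℕ) (S : LS) : Bool := decide (2^(cc k) * 2^S.1 ≤ sucN u A D r S)
def freeB (r : ℕ) (S : LS) (j : ℕ) : Bool := S.2.all fun e => !(decide (e.1 = j) && actB A D r S.1 e)
def eligB (k r ℓ : ℕ) (S : LS) (j : ℕ) : Bool :=
  zs u j && (decide (pl u j + ℓ + cc k + k ≤ S.1) && freeB A D r S j)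
def nextJ (k r ℓ : ℕ) (S : LS) : Option ℕ :=
  (List.range (S.1+1)).find? fun j => eligB u A D k r ℓ S j
def launch (k r ℓ : ℕ) (S : LS) : Option ℕ :=
  bif doneB u A D k r S then Option.none else nextJ u A D k r ℓ S
def idle (k r : ℕ) (S : LS) : LS := bif doneB u A D k r S then S else (S.1+1, S.2)
def respB (k ℓ t0 τ : ℕ) : Bool :=
  decide (2^τ ≤ (mN u A τ (2^t0) + mN u D τ (2^t0)) * 2^(k+ℓ))
def subQ (k r ℓ : ℕ) (S : LS) (j : ℕ) : Qy := (k, r, pl u j + ℓ + cc k, S.1)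

def stepP (T : Qy →. ℕ) (k r ℓ : ℕ) (S : LS) : Part LS :=
  Option.casesOn (launch u A D k r ℓ S) (Part.some (idle u A D k r S)) fun j =>
    (T (subQ u k r ℓ S j)).map fun t' => (t', (j, S.1, t') :: S.2)
def LSn (T : Qy →. ℕ) (k r ℓ t0 i : ℕ) : Part LS :=
  Nat.rec (Part.some (t0, [])) (fun _ ih => ih.bind fun S => stepP u A D T k r ℓ S) i
def loopR (T : Qy →. ℕ) (k r ℓ t0 : ℕ) : Part ℕ :=
  (Nat.rfind fun i => (LSn u A D T k r ℓ t0 i).map fun S => doneB u A D k r S).bind fun i =>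
    (LSn u A D T k r ℓ t0 i).map fun S => S.1
def startT (T : Qy →. ℕ) (q : Qy) : Part ℕ :=
  Nat.casesOn q.2.1 (Part.some q.2.2.2) fun r => loopR u A D T q.1 r q.2.2.1 q.2.2.2
def bodyT (T : Qy →. ℕ) (q : Qy) : Part ℕ :=
  (startT u A D T q).bind fun τ0 =>
    Nat.rfind fun τ => Part.some (decide (τ0 < τ) && respB u A D q.1 q.2.2.1 q.2.2.2 τ)
def subAt (T : Qy →. ℕ) (q : Qy) (i : ℕ) : Part Qy :=
  Nat.casesOn q.2.1 Part.none fun r => (LSn u A D T q.1 r q.2.2.1 q.2.2.2 i).bind fun S =>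
    Part.ofOption ((launch u A D q.1 r q.2.2.1 S).map fun j => subQ u q.1 r q.2.2.1 S j)
def Wn (T : Qy →. ℕ) (q : Qy) (L : List ℕ) (n : ℕ) : Part Qy :=
  Nat.rec (Part.some q) (fun m ih => ih.bind fun q' => subAt u A D T q' (L[m]?.getD 0)) n

section
variable {u A D} [PR1 u] [PR2 A] [PR2 D] {γ : Type} [Primcodable γ] {k r ℓ s n t0 j : γ → ℕ} {e : γ → En}
  {S : γ → LS}
@[fun_prop] theorem pr_cc (hk : Primrec k) : Primrec fun x => cc (k x) := by unfold cc; fun_prop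
@[fun_prop] theorem pr_rs2 (hr : Primrec r) (hs : Primrec s) (hn : Primrec n) :
    Primrec fun x => rs2 A D (r x) (s x) (n x) := by unfold rs2; fun_prop
@[fun_prop] theorem pr_actB (hr : Primrec r) (hs : Primrec s) (he : Primrec e) :
    Primrec fun x => actB A D (r x) (s x) (e x) := by unfold actB; fun_prop
@[fun_prop] theorem pr_sucT (hr : Primrec r) (hs : Primrec s) (he : Primrec e) :
    Primrec fun x => sucT u A D (r x) (s x) (e x) := by unfold sucT; fun_prop
@[fun_prop] theorem pr_sucN (hr : Primrec r) (hS : Primrec S) :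
    Primrec fun x => sucN u A D (r x) (S x) := by unfold sucN; fun_prop
@[fun_prop] theorem pr_doneB (hk : Primrec k) (hr : Primrec r) (hS : Primrec S) :
    Primrec fun x => doneB u A D (k x) (r x) (S x) := by unfold doneB; fun_prop
@[fun_prop] theorem pr_freeB (hr : Primrec r) (hS : Primrec S) (hj : Primrec j) :
    Primrec fun x => freeB A D (r x) (S x) (j x) := by unfold freeB; fun_prop
@[fun_prop] theorem pr_eligB (hk : Primrec k) (hr : Primrec r) (hl : Primrec ℓ) (hS : Primrec S) (hj : Primrec j) :
    Primrec fun x => eligB u A D (k x) (r x) (ℓ x) (S x) (j x) := by unfold eligB; fun_prop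
@[fun_prop] theorem pr_nextJ (hk : Primrec k) (hr : Primrec r) (hl : Primrec ℓ) (hS : Primrec S) :
    Primrec fun x => nextJ u A D (k x) (r x) (ℓ x) (S x) := by unfold nextJ; fun_prop
@[fun_prop] theorem pr_launch (hk : Primrec k) (hr : Primrec r) (hl : Primrec ℓ) (hS : Primrec S) :
    Primrec fun x => launch u A D (k x) (r x) (ℓ x) (S x) := by unfold launch; fun_prop
@[fun_prop] theorem pr_idle (hk : Primrec k) (hr : Primrec r) (hS : Primrec S) :
    Primrec fun x => idle u A D (k x) (r x) (S x) := by unfold idle; fun_prop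
@[fun_prop] theorem pr_respB (hk : Primrec k) (hl : Primrec ℓ) (hs : Primrec s) (hn : Primrec n) :
    Primrec fun x => respB u A D (k x) (ℓ x) (s x) (n x) := by unfold respB; fun_prop
@[fun_prop] theorem pr_subQ (hk : Primrec k) (hr : Primrec r) (hl : Primrec ℓ) (hS : Primrec S) (hj : Primrec j) :
    Primrec fun x => subQ u (k x) (r x) (ℓ x) (S x) (j x) := by unfold subQ; fun_prop

variable {T : γ → Qy →. ℕ} 
theorem pa_stepP (hT : Partrec₂ T) (hk : Primrec k) (hr : Primrec r) (hl : Primrec ℓ) (hS : Primrec S) :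
    Partrec fun x => stepP u A D (T x) (k x) (r x) (ℓ x) (S x) := by
  unfold stepP
  refine Partrec.optionCasesOn_right (o := fun x => launch u A D (k x) (r x) (ℓ x) (S x)) 
    (f := fun x => idle u A D (k x) (r x) (S x)) 
    (g := fun x j => (T x (subQ u (k x) (r x) (ℓ x) (S x) j)).map fun t' => (t', (j, (S x).1, t') :: (S x).2))
    (Primrec.to_comp (by fun_prop)) (Primrec.to_comp (by fun_prop)) ?_
  refine Partrec.map (f := fun p : γ × ℕ => T p.1 (subQ u (k p.1) (r p.1) (ℓ p.1) (S p.1) p.2))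
    (g := fun p t' => (t', (p.2, (S p.1).1, t') :: (S p.1).2)) ?_ (Primrec.to_comp ?_)
  · exact Partrec.comp (f := fun p : γ × Qy => T p.1 p.2)
      (g := fun p : γ × ℕ => (p.1, subQ u (k p.1) (r p.1) (ℓ p.1) (S p.1) p.2)) hT
      (Primrec.to_comp (Primrec.fst.pair (pr_subQ (hk.comp Primrec.fst) (hr.comp Primrec.fst)
        (hl.comp Primrec.fst) (hS.comp Primrec.fst) Primrec.snd)))
  · have := hS.comp ((Primrec.fst (α := γ) (β := ℕ)).comp (Primrec.fst (α := γ × ℕ) (β := ℕ)))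
    fun_prop

theorem pT_fst {β : Type} [Primcodable β] (hT : Partrec₂ T) : Partrec₂ fun (p : γ × β) => T p.1 :=
  Partrec.comp (f := fun p : γ × Qy => T p.1 p.2) (g := fun p : (γ × β) × Qy => (p.1.1, p.2)) hT
    (Primrec.to_comp (by fun_prop))

theorem pa_LSn (hT : Partrec₂ T) (hk : Primrec k) (hr : Primrec r) (hl : Primrec ℓ) (ht : Primrec t0)
    (hn : Primrec n) : Partrec fun x => LSn u A D (T x) (k x) (r x) (ℓ x) (t0 x) (n x) := by
  have h1 : Partrec₂ (fun (x : γ) (p : ℕ × LS) => stepP u A D (T x) (k x) (r x) (ℓ x) p.2) :=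
    pa_stepP (γ := γ × (ℕ × LS)) (T := fun p => T p.1) (S := fun p => p.2.2) (k := fun p => k p.1)
      (r := fun p => r p.1) (ℓ := fun p => ℓ p.1) (pT_fst hT)
      (hk.comp Primrec.fst) (hr.comp Primrec.fst) (hl.comp Primrec.fst) (Primrec.snd.comp Primrec.snd)
  have h2 : Partrec (fun x => Part.some (t0 x, ([] : List En))) :=
    Primrec.to_comp (f := fun x => (t0 x, ([] : List En))) (by fun_prop)
  exact Partrec.nat_rec (f := n) hn.to_comp h2 h1

theorem pa_loopR (hT : Partrec₂ T) (hk : Primrec k) (hr : Primrec r) (hl : Primrec ℓ) (ht : Primrec t0) :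
    Partrec fun x => loopR u A D (T x) (k x) (r x) (ℓ x) (t0 x) := by
  unfold loopR
  have h1 : Partrec₂ fun (x : γ) (i : ℕ) => LSn u A D (T x) (k x) (r x) (ℓ x) (t0 x) i :=
    pa_LSn (T := fun p : γ × ℕ => T p.1) (n := fun p : γ × ℕ => p.2) (pT_fst hT)
      (hk.comp Primrec.fst) (hr.comp Primrec.fst) (hl.comp Primrec.fst) (ht.comp Primrec.fst) Primrec.snd
  refine Partrec.bind (Partrec.rfind ?_) ?_
  · refine Partrec.map (f := fun p : γ × ℕ => LSn u A D (T p.1) (k p.1) (r p.1) (ℓ p.1) (t0 p.1) p.2)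
      (g := fun p S => doneB u A D (k p.1) (r p.1) S) h1 ?_
    exact (pr_doneB (hk.comp (Primrec.fst.comp Primrec.fst)) (hr.comp (Primrec.fst.comp Primrec.fst)) Primrec.snd).to_comp
  · refine Partrec.map (f := fun p : γ × ℕ => LSn u A D (T p.1) (k p.1) (r p.1) (ℓ p.1) (t0 p.1) p.2)
      (g := fun p S => S.1) h1 ?_
    exact Primrec.to_comp (by fun_prop)

theorem pa_startT {q : γ → Qy} (hT : Partrec₂ T) (hq : Primrec q) :
    Partrec fun x => startT u A D (T x) (q x) := by
  have hq' : Primrec fun p : γ × ℕ => q p.1 := hq.comp Primrec.fst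
  have h1 : Partrec₂ (fun (x : γ) (r : ℕ) => loopR u A D (T x) (q x).1 r (q x).2.2.1 (q x).2.2.2) :=
    pa_loopR (γ := γ × ℕ) (T := fun p => T p.1) (k := fun p => (q p.1).1) (r := fun p => p.2)
    (ℓ := fun p => (q p.1).2.2.1) (t0 := fun p => (q p.1).2.2.2) (pT_fst hT)
    (pr_fst hq') Primrec.snd (pr_fst (pr_snd (pr_snd hq'))) (pr_snd (pr_snd (pr_snd hq')))
  have h2 : Computable fun x => (q x).2.2.2 := Primrec.to_comp (by fun_prop)
  have h3 : Computable fun x => (q x).2.1 := Primrec.to_comp (by fun_prop)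
  exact Partrec.nat_casesOn_right h3 h2 h1

theorem pa_bodyT {q : γ → Qy} (hT : Partrec₂ T) (hq : Primrec q) :
    Partrec fun x => bodyT u A D (T x) (q x) := by
  unfold bodyT
  refine Partrec.bind (pa_startT hT hq) (Partrec.rfind ?_)
  have hq' : Primrec fun p : (γ × ℕ) × ℕ => q p.1.1 := hq.comp (Primrec.fst.comp Primrec.fst)
  exact Primrec.to_comp (pr_and (pr_lt (Primrec.snd.comp Primrec.fst) Primrec.snd) (pr_respB
    (pr_fst hq') (pr_fst (pr_snd (pr_snd hq'))) (pr_snd (pr_snd (pr_snd hq'))) Primrec.snd))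

theorem pa_subAt {q : γ → Qy} (hT : Partrec₂ T) (hq : Computable q) (hn : Computable n) :
    Partrec fun x => subAt u A D (T x) (q x) (n x) := by
  have key : Partrec fun p : γ × (Qy × ℕ) => subAt u A D (T p.1) p.2.1 p.2.2 := by
    have h1 : Partrec fun x : (γ × (Qy × ℕ)) × ℕ =>
        LSn u A D (T x.1.1) x.1.2.1.1 x.2 x.1.2.1.2.2.1 x.1.2.1.2.2.2 x.1.2.2 :=
      pa_LSn (γ := (γ × (Qy × ℕ)) × ℕ) (T := fun x => T x.1.1) (k := fun x => x.1.2.1.1)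
        (r := fun x => x.2) (ℓ := fun x => x.1.2.1.2.2.1) (t0 := fun x => x.1.2.1.2.2.2) (n := fun x => x.1.2.2)
        (pT_fst (pT_fst hT)) (by fun_prop) (by fun_prop) (by fun_prop) (by fun_prop) (by fun_prop)
    have h2 : Partrec₂ (fun (x : (γ × (Qy × ℕ)) × ℕ) (S : LS) => Part.ofOption
       ((launch u A D x.1.2.1.1 x.2 x.1.2.1.2.2.1 S).map fun j => subQ u x.1.2.1.1 x.2 x.1.2.1.2.2.1 S j)) := by
      refine Computable.ofOption (f := fun x : ((γ × (Qy × ℕ)) × ℕ) × LS => 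
       ((launch u A D x.1.1.2.1.1 x.1.2 x.1.1.2.1.2.2.1 x.2).map fun j => subQ u x.1.1.2.1.1 x.1.2 x.1.1.2.1.2.2.1 x.2 j)) ?_
      exact Primrec.to_comp (by fun_prop)
    have h3 : Partrec₂ fun (p : γ × (Qy × ℕ)) (r : ℕ) => 
      (LSn u A D (T p.1) p.2.1.1 r p.2.1.2.2.1 p.2.1.2.2.2 p.2.2).bind fun S =>
        Part.ofOption ((launch u A D p.2.1.1 r p.2.1.2.2.1 S).map fun j => subQ u p.2.1.1 r p.2.1.2.2.1 S j) :=
      h1.bind h2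
    have h4 : Partrec fun p : γ × (Qy × ℕ) => Part.ofOption (Nat.casesOn p.2.1.2.1 Option.none Option.some : Option ℕ) := by
      refine Computable.ofOption (Primrec.to_comp ?_)
      exact Primrec.nat_casesOn (f := fun p : γ × (Qy × ℕ) => p.2.1.2.1) (g := fun _ => (Option.none : Option ℕ))
        (h := fun _ r => Option.some r)
        (by fun_prop) (by fun_prop) (Primrec.option_some.comp Primrec.snd)
    refine (h4.bind h3).of_eq fun p => ?_
    unfold subAt
    rcases p.2.1.2.1 with _ | r <;> simp
  exact key.comp ((Computable.id).pair (hq.pair hn))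

theorem pa_Wn {q : γ → Qy} {L : γ → List ℕ} (hT : Partrec₂ T) (hq : Primrec q) (hL : Primrec L) (hn : Primrec n) :
    Partrec fun x => Wn u A D (T x) (q x) (L x) (n x) := by
  have hL' : Primrec fun p : γ × (ℕ × Qy) => L p.1 := hL.comp Primrec.fst
  have h1 : Partrec₂ (fun (x : γ) (p : ℕ × Qy) => subAt u A D (T x) p.2 ((L x)[p.1]?.getD 0)) :=
    pa_subAt (γ := γ × (ℕ × Qy)) (T := fun p => T p.1) (q := fun p => p.2.2)
      (n := fun p => (L p.1)[p.2.1]?.getD 0) (pT_fst hT) (Primrec.to_comp (by fun_prop))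
      (Primrec.to_comp (pr_getD (pr_getElem? hL' (by fun_prop)) (by fun_prop)))
  have h2 : Partrec (fun x => Part.some (q x)) := hq.to_comp
  exact Partrec.nat_rec (f := n) hn.to_comp h2 h1
end

theorem exists_T {u A D} (hu : Primrec u) (hA : Primrec fun p : ℕ × ℕ => A p.1 p.2) 
    (hD : Primrec fun p : ℕ × ℕ => D p.1 p.2) : ∃ T : Qy →. ℕ, Partrec T ∧ ∀ q, T q = bodyT u A D T q := by
  have : PR1 u := ⟨hu⟩
  have : PR2 A := ⟨hA⟩
  have : PR2 D := ⟨hD⟩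
  have h0 : Partrec₂ fun (x : Nat.Partrec.Code × ℕ) (q : Qy) => x.1.eval (Encodable.encode q) :=
    Nat.Partrec.Code.eval_part.comp (Computable.fst.comp Computable.fst) (Computable.encode.comp Computable.snd)
  have h1 : Partrec₂ fun (C : Nat.Partrec.Code) (n : ℕ) => 
      bodyT u A D (fun q => C.eval (Encodable.encode q)) (Denumerable.ofNat Qy n) :=
    pa_bodyT (γ := Nat.Partrec.Code × ℕ) (q := fun x => Denumerable.ofNat Qy x.2) h0 ((Primrec.ofNat Qy).comp Primrec.snd)
  obtain ⟨C, hC⟩ := Nat.Partrec.Code.fixed_point₂ h1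
  refine ⟨fun q => C.eval (Encodable.encode q), ?_, fun q => ?_⟩
  · exact Nat.Partrec.Code.eval_part.comp (Computable.const C) Computable.encode
  · have := congrFun hC (Encodable.encode q)
    rw [Denumerable.ofNat_encode] at this
    exact this
end proc


def zz {α : Type} (A D : α) (r : ℕ) : α := if r % 2 = 0 then A else D

theorem rs2_eq (A D : ℕ → ℕ → Bool) (r s n : ℕ) : rs2 A D r s n = restrSeq (zz A D r s) n := by
  unfold rs2 zz rs
  by_cases h : r % 2 = 0 <;> simp [h]

structure Ctx (U : Str →. Str) (u : ℕ → Option (Str × Str)) (X Y : ℕ → Bool) (A D : ℕ → ℕ → Bool)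
    (T : Qy →. ℕ) : Prop where
  hu : UE U u
  hA : Apx X A
  hD : Apx Y D
  pT : Partrec T
  eqT : ∀ q, T q = bodyT u A D T q

section sem
variable {U : Str →. Str} {u : ℕ → Option (Str × Str)} {X Y : ℕ → Bool} {A D : ℕ → ℕ → Bool}
    {T : Qy →. ℕ} 

theorem Ctx.apx (H : Ctx U u X Y A D T) (r : ℕ) : Apx (zz X Y r) (zz A D r) := by
  unfold zz; split_ifs
  · exact H.hA
  · exact H.hD

theorem actB_iff {r τ : ℕ} {e : En} : actB A D r τ e = true ↔
    restrSeq (zz A D r τ) (2^e.2.1) = restrSeq (zz A D r e.2.2) (2^e.2.1) := by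
  unfold actB; rw [rs2_eq, rs2_eq]; exact decide_eq_true_iff

theorem Ctx.act_anti (H : Ctx U u X Y A D T) {r τ τ' : ℕ} {e : En} (h1 : e.2.2 ≤ τ) (h2 : τ ≤ τ')
    (h : actB A D r τ' e = true) : actB A D r τ e = true := by
  rw [actB_iff] at h ⊢
  exact (H.apx r).noret _ _ _ _ h1 h2 h.symm

theorem LSn_succ {k r ℓ t0 i : ℕ} {S' : LS} : S' ∈ LSn u A D T k r ℓ t0 (i+1) ↔
    ∃ S ∈ LSn u A D T k r ℓ t0 i, S' ∈ stepP u A D T k r ℓ S := by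
  show S' ∈ (LSn u A D T k r ℓ t0 i).bind _ ↔ _
  simp only [Part.mem_bind_iff]

theorem mem_stepP {k r ℓ : ℕ} {S S' : LS} : S' ∈ stepP u A D T k r ℓ S ↔
    (launch u A D k r ℓ S = Option.none ∧ S' = idle u A D k r S) ∨
    ∃ j t', launch u A D k r ℓ S = Option.some j ∧ t' ∈ T (k, r, pl u j + ℓ + cc k, S.1) ∧
      S' = (t', (j, S.1, t') :: S.2) := by
  unfold stepP
  rcases launch u A D k r ℓ S with _ | j
  · simp
  · simp only [subQ, Part.mem_map_iff]
    constructor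
    · rintro ⟨t', h1, rfl⟩; exact Or.inr ⟨j, t', rfl, h1, rfl⟩
    · rintro (⟨h, _⟩ | ⟨j', t', h, h1, rfl⟩)
      · cases h
      · cases h; exact ⟨t', h1, rfl⟩

theorem launch_some {k r ℓ : ℕ} {S : LS} {j : ℕ} (h : launch u A D k r ℓ S = Option.some j) :
    doneB u A D k r S = false ∧ j ≤ S.1 ∧ zs u j = true ∧ pl u j + ℓ + cc k + k ≤ S.1 ∧
      (∀ e ∈ S.2, e.1 = j → actB A D r S.1 e = false) := by
  unfold launch at h
  rcases hd : doneB u A D k r S with _ | _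
  · rw [hd, cond_false] at h
    unfold nextJ at h
    have h1 := List.find?_some h
    have h2 := List.mem_of_find?_eq_some h
    unfold eligB freeB at h1
    simp only [Bool.and_eq_true, decide_eq_true_eq, List.all_eq_true, Bool.not_eq_true', Bool.and_eq_false_iff,
      decide_eq_false_iff_not] at h1
    refine ⟨rfl, by simp at h2; omega, h1.1, h1.2.1, fun e he hj => ?_⟩
    rcases h1.2.2 e he with h | h
    · exact absurd hj h
    · exact h
  · rw [hd, cond_true] at h; cases h

theorem launch_ne_none {k r ℓ : ℕ} {S : LS} {j : ℕ} (hd : doneB u A D k r S = false) (h1 : j ≤ S.1)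
    (h2 : zs u j = true) (h3 : pl u j + ℓ + cc k + k ≤ S.1) (h4 : ∀ e ∈ S.2, e.1 = j → actB A D r S.1 e = false) :
    ∃ j' ≤ j, launch u A D k r ℓ S = Option.some j' := by
  unfold launch
  rw [hd, cond_false]
  have hj : eligB u A D k r ℓ S j = true := by
    unfold eligB freeB
    simp only [Bool.and_eq_true, decide_eq_true_eq, List.all_eq_true, Bool.not_eq_true', Bool.and_eq_false_iff,
      decide_eq_false_iff_not]
    refine ⟨h2, h3, fun e he => ?_⟩
    by_cases hh : e.1 = j
    · exact Or.inr (h4 e he hh)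
    · exact Or.inl hh
  unfold nextJ
  rcases h : (List.range (S.1+1)).find? (fun j => eligB u A D k r ℓ S j) with _ | j'
  · rw [List.find?_eq_none] at h
    exact absurd hj (h j (by simp; omega))
  · refine ⟨j', ?_, rfl⟩
    rw [List.find?_range_eq_some] at h
    by_contra hh
    have := h.2.2 j (by omega)
    rw [hj] at this; simp at this

theorem mem_subAt {k r ℓ t0 i : ℕ} {q : Qy} : q ∈ subAt u A D T (k, r+1, ℓ, t0) i ↔
    ∃ S ∈ LSn u A D T k r ℓ t0 i, ∃ j, launch u A D k r ℓ S = Option.some j ∧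
      q = (k, r, pl u j + ℓ + cc k, S.1) := by
  show q ∈ (LSn u A D T k r ℓ t0 i).bind _ ↔ _
  rw [Part.mem_bind_iff]
  refine exists_congr fun S => and_congr_right fun _ => ?_
  simp only [Part.mem_ofOption, Option.mem_def, Option.map_eq_some_iff, subQ]
  exact exists_congr fun j => and_congr_right fun _ => eq_comm

theorem not_mem_subAt_zero {k ℓ t0 i : ℕ} {q : Qy} : q ∉ subAt u A D T (k, 0, ℓ, t0) i :=
  Part.notMem_none q

theorem Ctx.mem_T (H : Ctx U u X Y A D T) {k r ℓ t0 t1 : ℕ} (h : t1 ∈ T (k, r, ℓ, t0)) :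
    ∃ τ0 ∈ startT u A D T (k, r, ℓ, t0), τ0 < t1 ∧ respB u A D k ℓ t0 t1 = true := by
  rw [H.eqT] at h
  unfold bodyT at h
  rw [Part.mem_bind_iff] at h
  obtain ⟨τ0, h1, h2⟩ := h
  refine ⟨τ0, h1, ?_⟩
  have := Nat.rfind_spec h2
  simpa using this

theorem Ctx.T_dom (H : Ctx U u X Y A D T) {k r ℓ t0 τ0 τ : ℕ} (h : τ0 ∈ startT u A D T (k, r, ℓ, t0))
    (h1 : τ0 < τ) (h2 : respB u A D k ℓ t0 τ = true) : ∃ t1, t1 ∈ T (k, r, ℓ, t0) := by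
  rw [H.eqT]
  unfold bodyT
  simp only [Part.mem_bind_iff]
  rw [exists_comm]
  refine ⟨τ0, ?_⟩
  simp only [h, true_and]
  rw [← Part.dom_iff_mem]
  refine Nat.rfind_dom.2 ?_
  exact ⟨τ, by simp [h1, h2], fun _ => trivial⟩

theorem mem_start_zero {k ℓ t0 τ0 : ℕ} : τ0 ∈ startT u A D T (k, 0, ℓ, t0) ↔ τ0 = t0 := by
  show τ0 ∈ Part.some t0 ↔ _
  simp

theorem mem_start_succ {k r ℓ t0 τ0 : ℕ} (h : τ0 ∈ startT u A D T (k, r+1, ℓ, t0)) : 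
    ∃ i, ∃ S ∈ LSn u A D T k r ℓ t0 i, doneB u A D k r S = true ∧ τ0 = S.1 := by
  change τ0 ∈ loopR u A D T k r ℓ t0 at h
  unfold loopR at h
  rw [Part.mem_bind_iff] at h
  obtain ⟨i, h1, h2⟩ := h
  rw [Part.mem_map_iff] at h2
  obtain ⟨S, h2, rfl⟩ := h2
  refine ⟨i, S, h2, ?_, rfl⟩
  have := Nat.rfind_spec h1
  rw [Part.mem_map_iff] at this
  obtain ⟨S', h3, h4⟩ := this
  rw [Part.mem_unique h2 h3]; exact h4

theorem LSn_dom_of_le {k r ℓ t0 i i' : ℕ} (h : i' ≤ i) (hd : (LSn u A D T k r ℓ t0 i).Dom) :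
    (LSn u A D T k r ℓ t0 i').Dom := by
  induction i with
  | zero => obtain rfl : i' = 0 := by omega
            exact hd
  | succ i ih =>
    rcases eq_or_lt_of_le h with rfl | h
    · exact hd
    · refine ih (by omega) ?_
      obtain ⟨S', hS'⟩ := Part.dom_iff_mem.1 hd
      obtain ⟨S, hS, -⟩ := LSn_succ.1 hS'
      exact Part.dom_iff_mem.2 ⟨S, hS⟩

theorem start_succ_dom {k r ℓ t0 i : ℕ} {S : LS} (hS : S ∈ LSn u A D T k r ℓ t0 i)
    (hd : doneB u A D k r S = true) : ∃ τ0, τ0 ∈ startT u A D T (k, r+1, ℓ, t0) := by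
  have : (loopR u A D T k r ℓ t0).Dom := by
    unfold loopR
    have h1 : (Nat.rfind fun i => (LSn u A D T k r ℓ t0 i).map fun S => doneB u A D k r S).Dom := by
      refine Nat.rfind_dom.2 ?_
      refine ⟨i, (Part.mem_map_iff _).2 ⟨S, hS, hd⟩, fun {m} hm => ?_⟩
      exact LSn_dom_of_le hm.le (Part.dom_iff_mem.2 ⟨S, hS⟩)
    obtain ⟨i0, hi0⟩ := Part.dom_iff_mem.1 h1
    have := Nat.rfind_spec hi0
    obtain ⟨S', h3, h4⟩ := (Part.mem_map_iff _).1 this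
    exact Part.dom_iff_mem.2 ⟨S'.1, Part.mem_bind_iff.2 ⟨i0, hi0, (Part.mem_map_iff _).2 ⟨S', h3, rfl⟩⟩⟩
  exact Part.dom_iff_mem.1 this

/-! invariants -/
variable (u A D T) in
structure Inv (k r ℓ t0 : ℕ) (S : LS) : Prop where
  ge : t0 ≤ S.1
  ent : ∀ e ∈ S.2, t0 ≤ e.2.1 ∧ e.2.1 < e.2.2 ∧ e.2.2 ≤ S.1 ∧ e.1 ≤ e.2.1 ∧ zs u e.1 = true ∧ 
    pl u e.1 + ℓ + cc k + k ≤ e.2.1 ∧ e.2.2 ∈ T (k, r, pl u e.1 + ℓ + cc k, e.2.1) ∧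
    ∃ i', (k, r, pl u e.1 + ℓ + cc k, e.2.1) ∈ subAt u A D T (k, r+1, ℓ, t0) i'
  pw : S.2.Pairwise fun e e' => e'.2.2 ≤ e.2.1
  act : S.2.Pairwise fun e e' => e.1 = e'.1 → actB A D r S.1 e' = false

theorem Ctx.inv_of (H : Ctx U u X Y A D T) {r : ℕ} (hgt : ∀ k ℓ t0 t1, t1 ∈ T (k, r, ℓ, t0) → t0 < t1)
    {k ℓ t0 : ℕ} : ∀ {i : ℕ} {S : LS}, S ∈ LSn u A D T k r ℓ t0 i → Inv u A D T k r ℓ t0 S := by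
  intro i
  induction i with
  | zero => 
    intro S hS
    change S ∈ Part.some (t0, []) at hS
    rw [Part.mem_some_iff] at hS
    subst hS
    exact ⟨le_rfl, by simp, by simp, by simp⟩
  | succ i ih =>
    intro S' hS'
    obtain ⟨S, hS, hst⟩ := LSn_succ.1 hS'
    have I := ih hS
    rcases mem_stepP.1 hst with ⟨-, rfl⟩ | ⟨j, t', hl, ht', rfl⟩
    · unfold idle
      rcases doneB u A D k r S with _ | _
      · refine ⟨I.ge.trans (Nat.le_succ _), fun e he => ?_, I.pw, ?_⟩
        · obtain ⟨h1, h2, h3, h4⟩ := I.ent e he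
          exact ⟨h1, h2, h3.trans (Nat.le_succ _), h4⟩
        · refine I.act.imp_of_mem fun {a b} ha hb h hab => ?_
          by_contra hh
          rw [Bool.not_eq_false] at hh
          have := H.act_anti (I.ent b hb).2.2.1 (Nat.le_succ _) hh
          rw [h hab] at this; cases this
      · exact I
    · obtain ⟨h1, h2, h3, h4, h5⟩ := launch_some hl
      have hlt := hgt _ _ _ _ ht'
      refine ⟨I.ge.trans hlt.le, fun e he => ?_, ?_, ?_⟩
      · rcases List.mem_cons.1 he with rfl | he
        · exact ⟨I.ge, hlt, le_rfl, h2, h3, h4, ht', i, mem_subAt.2 ⟨S, hS, j, hl, rfl⟩⟩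
        · obtain ⟨h1, h2, h3, h4⟩ := I.ent e he
          exact ⟨h1, h2, h3.trans hlt.le, h4⟩
      · exact List.pairwise_cons.2 ⟨fun e he => (I.ent e he).2.2.1, I.pw⟩
      · have hb : ∀ e ∈ S.2, actB A D r S.1 e = false → actB A D r t' e = false := by
          intro e he h
          by_contra hh
          rw [Bool.not_eq_false] at hh
          have := H.act_anti (I.ent e he).2.2.1 hlt.le hh
          rw [h] at this; cases this
        refine List.pairwise_cons.2 ⟨fun e he hj => hb e he (h5 e he hj.symm), ?_⟩
        exact I.act.imp_of_mem fun {a b} ha hb' h hab => hb b hb' (h hab)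

theorem Ctx.T_gt (H : Ctx U u X Y A D T) : ∀ r k ℓ t0 t1, t1 ∈ T (k, r, ℓ, t0) → t0 < t1 := by
  intro r
  induction r with
  | zero =>
    intro k ℓ t0 t1 h
    obtain ⟨τ0, h1, h2, -⟩ := H.mem_T h
    rw [mem_start_zero] at h1; omega
  | succ r ih =>
    intro k ℓ t0 t1 h
    obtain ⟨τ0, h1, h2, -⟩ := H.mem_T h
    obtain ⟨i, S, hS, -, rfl⟩ := mem_start_succ h1
    exact lt_of_le_of_lt (H.inv_of ih hS).ge h2

theorem Ctx.inv (H : Ctx U u X Y A D T) {k r ℓ t0 i : ℕ} {S : LS} (h : S ∈ LSn u A D T k r ℓ t0 i) :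
   Inv u A D T k r ℓ t0 S := H.inv_of (H.T_gt r) h
end sem

section sem
variable {U : Str →. Str} {u : ℕ → Option (Str × Str)} {X Y : ℕ → Bool} {A D : ℕ → ℕ → Bool}
    {T : Qy →. ℕ} 

variable (u) in
noncomputable def lw (l : List En) : ℝ := (l.map fun e => wt u e.1).sum
variable (u A D) in
noncomputable def sucL (r τ : ℕ) (l : List En) : List En := l.filter fun e => !actB A D r τ e
variable (u A D) in
noncomputable def actL (r τ : ℕ) (l : List En) : List En := l.filter fun e => actB A D r τ e

theorem lw_split (r τ : ℕ) (l : List En) : lw u l = lw u (sucL A D r τ l) + lw u (actL A D r τ l) := by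
  unfold lw sucL actL
  induction l with
  | nil => simp
  | cons e l ih =>
    rw [List.map_cons, List.sum_cons, ih]
    rcases h : actB A D r τ e with _ | _
    · simp [h]; ring
    · simp [h]; ring

theorem lw_nonneg (l : List En) : 0 ≤ lw u l := by
  apply List.sum_nonneg
  intro x hx
  simp at hx
  obtain ⟨a, ⟨_, _, _⟩, rfl⟩ := hx
  exact wt_nonneg _

theorem pow_wt {t τ : ℕ} (h : zs u t = true) (hp : pl u t ≤ τ) : (2:ℝ)^(τ - pl u t) = 2^τ * wt u t := by
  rw [zs_wt h]
  obtain ⟨k, hk⟩ := Nat.exists_eq_add_of_le hp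
  rw [hk, Nat.add_sub_cancel_left, pow_add, mul_comm (2^_) (2^k), mul_assoc, ← mul_pow]
  norm_num

theorem Ctx.done_iff (H : Ctx U u X Y A D T) {k r ℓ t0 : ℕ} {S : LS} (I : Inv u A D T k r ℓ t0 S) :
    doneB u A D k r S = true ↔ (2:ℝ)^(cc k) ≤ lw u (sucL A D r S.1 S.2) := by
  have key : (sucN u A D r S : ℝ) = 2^S.1 * lw u (sucL A D r S.1 S.2) := by
    have h1 : ∀ e ∈ S.2, zs u e.1 = true ∧ pl u e.1 ≤ S.1 := by
      intro e he
      obtain ⟨h1, h2, h3, h4, h5, _⟩ := I.ent e he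
      exact ⟨h5, (H.hu.pl_le _).trans (by omega)⟩
    unfold sucN sucL lw
    generalize S.2 = l at h1 ⊢
    induction l with
    | nil => simp
    | cons e l ih =>
      have := ih fun e he => h1 e (List.mem_cons_of_mem _ he)
      rw [List.map_cons, List.sum_cons, Nat.cast_add, this]
      unfold sucT
      rcases h : actB A D r S.1 e with _ | _
      · simp only [cond_false, h, List.filter_cons, Bool.not_false, if_true, List.map_cons, List.sum_cons]
        push_cast
        rw [pow_wt (h1 e (by simp)).1 (h1 e (by simp)).2]; ring
      · simp [h]
  unfold doneB
  rw [decide_eq_true_iff, ← Nat.cast_le (α := ℝ), key]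
  push_cast
  rw [mul_comm]
  exact mul_le_mul_iff_right₀ (by positivity)

theorem Ctx.act_weight (H : Ctx U u X Y A D T) {r τ : ℕ} {l : List En} (j : ℕ)
    (hp : l.Pairwise fun e e' => e.1 = e'.1 → actB A D r τ e' = false) 
    (hj : ∀ e ∈ l, e.1 = j → actB A D r τ e = false) : lw u (actL A D r τ l) + wt u j ≤ 1 := by
  have h1 : ((actL A D r τ l).map fun e => e.1).Nodup := by
    unfold List.Nodup
    rw [List.pairwise_map]
    have := hp.filter (fun e => actB A D r τ e)
    refine List.Pairwise.imp_of_mem ?_ this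
    intro a b ha hb h e
    have := h e
    rw [(List.mem_filter.1 hb).2] at this; cases this
  have h2 : lw u (actL A D r τ l) = ∑ t ∈ ((actL A D r τ l).map fun e => e.1).toFinset, wt u t := by
    rw [List.sum_toFinset _ h1]
    unfold lw; rw [List.map_map]; rfl
  have h3 : j ∉ ((actL A D r τ l).map fun e => e.1).toFinset := by
    rw [List.mem_toFinset, List.mem_map]
    rintro ⟨e, he, he'⟩
    have := hj e (List.mem_filter.1 he).1 he'
    rw [(List.mem_filter.1 he).2] at this; cases this
  rw [h2, add_comm, ← Finset.sum_insert h3]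
  exact H.hu.kraft _

theorem Ctx.launch_weight (H : Ctx U u X Y A D T) {k r ℓ t0 i j : ℕ} {S : LS} 
    (hS : S ∈ LSn u A D T k r ℓ t0 i) (hl : launch u A D k r ℓ S = Option.some j) :
    lw u S.2 + wt u j ≤ 2^(cc k) + 1 := by
  have I := H.inv hS
  obtain ⟨h1, h2, h3, h4, h5⟩ := launch_some hl
  have h6 := H.act_weight j I.act h5
  have h7 : ¬ (2:ℝ)^(cc k) ≤ lw u (sucL A D r S.1 S.2) := by
    rw [← H.done_iff I, h1]; simp
  rw [lw_split (A := A) (D := D) r S.1]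
  linarith

theorem Ctx.sub_sum (H : Ctx U u X Y A D T) {k r ℓ t0 : ℕ} (I : Finset ℕ) (j : ℕ → ℕ)
    (h : ∀ i ∈ I, ∃ S ∈ LSn u A D T k r ℓ t0 i, launch u A D k r ℓ S = Option.some (j i)) :
    ∑ i ∈ I, wt u (j i) ≤ 2^(cc k) + 1 := by
  have claim : ∀ n, ∀ S ∈ LSn u A D T k r ℓ t0 n, ∑ i ∈ I.filter (· < n), wt u (j i) ≤ lw u S.2 := by
    intro n
    induction n with
    | zero => intro S _; simpa using lw_nonneg _
    | succ n ih =>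
      intro S' hS'
      obtain ⟨S, hS, hst⟩ := LSn_succ.1 hS'
      by_cases hn : n ∈ I
      · have e : I.filter (· < n+1) = insert n (I.filter (· < n)) := by
          ext x; simp only [Finset.mem_filter, Finset.mem_insert]
          constructor
          · rintro ⟨h1, h2⟩
            by_cases x = n <;> [left; right]
            · assumption
            · exact ⟨h1, by omega⟩
          · rintro (rfl | ⟨h1, h2⟩)
            · exact ⟨hn, by omega⟩
            · exact ⟨h1, by omega⟩
        rw [e, Finset.sum_insert (by simp)]
        obtain ⟨S0, hS0, hl⟩ := h n hn
        obtain rfl := Part.mem_unique hS hS0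
        rcases mem_stepP.1 hst with ⟨h1, -⟩ | ⟨j', t', hl', ht', rfl⟩
        · rw [hl] at h1; cases h1
        · rw [hl] at hl'
          cases hl'
          have := ih S hS
          simp only [lw, List.map_cons, List.sum_cons] at this ⊢
          linarith
      · have e : I.filter (· < n+1) = (I.filter (· < n)) := by
          ext x; simp only [Finset.mem_filter]
          refine and_congr_right fun hx => ?_
          have : x ≠ n := by rintro rfl; exact hn hx
          omega
        rw [e]
        refine (ih S hS).trans ?_
        rcases mem_stepP.1 hst with ⟨h1, rfl⟩ | ⟨j', t', hl', ht', rfl⟩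
        · unfold idle; rcases doneB u A D k r S with _ | _ <;> simp
        · have := wt_nonneg (u := u) j'
          simp only [lw, List.map_cons, List.sum_cons]
          linarith
  rcases I.eq_empty_or_nonempty with rfl | hne
  · simp; positivity
  · set N := I.max' hne
    have hN : N ∈ I := I.max'_mem hne
    have e : I = insert N (I.filter (· < N)) := by
      ext x; simp only [Finset.mem_filter, Finset.mem_insert]
      constructor
      · intro hx
        rcases eq_or_lt_of_le (I.le_max' x hx) with h | h
        · exact Or.inl h
        · exact Or.inr ⟨hx, h⟩
      · rintro (rfl | ⟨h1, h2⟩)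
        · exact hN
        · exact h1
    rw [e, Finset.sum_insert (by simp)]
    obtain ⟨S, hS, hl⟩ := h N hN
    have := claim N S hS
    have := H.launch_weight hS hl
    linarith

/-! calls -/
theorem Wn_succ {q : Qy} {L : List ℕ} {n : ℕ} {q' : Qy} : q' ∈ Wn u A D T q L (n+1) ↔
    ∃ q'' ∈ Wn u A D T q L n, q' ∈ subAt u A D T q'' (L[n]?.getD 0) := by
  show q' ∈ (Wn u A D T q L n).bind _ ↔ _
  simp only [Part.mem_bind_iff]

theorem Wn_cons {q : Qy} {i : ℕ} {L : List ℕ} {n : ℕ} : ∀ {q' : Qy}, q' ∈ Wn u A D T q (i :: L) (n+1) ↔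
    ∃ q'' ∈ subAt u A D T q i, q' ∈ Wn u A D T q'' L n := by
  induction n with
  | zero =>
    intro q'
    rw [Wn_succ]
    show (∃ q'' ∈ Part.some q, q' ∈ subAt u A D T q'' i) ↔ ∃ q'' ∈ subAt u A D T q i, q' ∈ Part.some q''
    simp
  | succ n ih =>
    intro q'
    rw [Wn_succ]
    simp only [ih, Wn_succ, List.getElem?_cons_succ]
    constructor
    · rintro ⟨a, ⟨b, h1, h2⟩, h3⟩; exact ⟨b, h1, a, h2, h3⟩
    · rintro ⟨b, h1, a, h2, h3⟩; exact ⟨a, ⟨b, h1, h2⟩, h3⟩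

theorem Ctx.call_sum (H : Ctx U u X Y A D T) (k : ℕ) : ∀ (r ℓ t0 : ℕ) (F : Finset (List ℕ)) (f : List ℕ → ℕ),
    (∀ L ∈ F, ∃ t, (k, 0, f L, t) ∈ Wn u A D T (k, r, ℓ, t0) L L.length) →
    ∑ L ∈ F, (1/2:ℝ)^(f L) ≤ (1/2:ℝ)^ℓ * (1 + (1/2)^(cc k))^r := by
  intro r
  induction r with
  | zero =>
    intro ℓ t0 F f hF
    have h1 : ∀ L ∈ F, L = [] ∧ f L = ℓ := by
      intro L hL
      obtain ⟨t, ht⟩ := hF L hL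
      rcases L with _ | ⟨i, L⟩
      · change _ ∈ Part.some _ at ht
        rw [Part.mem_some_iff] at ht
        simp only [Prod.mk.injEq] at ht
        exact ⟨rfl, ht.2.2.1⟩
      · rw [List.length_cons, Wn_cons] at ht
        obtain ⟨q'', h, -⟩ := ht
        exact absurd h not_mem_subAt_zero
    have h2 : F ⊆ {[]} := fun L hL => by simp [(h1 L hL).1]
    calc ∑ L ∈ F, (1/2:ℝ)^(f L) = ∑ L ∈ F, (1/2:ℝ)^ℓ := Finset.sum_congr rfl fun L hL => by rw [(h1 L hL).2]
      _ ≤ ∑ L ∈ ({[]} : Finset (List ℕ)), (1/2:ℝ)^ℓ := 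
        Finset.sum_le_sum_of_subset_of_nonneg h2 fun _ _ _ => by positivity
      _ = _ := by simp
  | succ r ih =>
    intro ℓ t0 F f hF
    have h1 : ∀ L ∈ F, ∃ i L', L = i :: L' ∧ ∃ S ∈ LSn u A D T k r ℓ t0 i, ∃ j,
        launch u A D k r ℓ S = Option.some j ∧ 
        ∃ t, (k, 0, f L, t) ∈ Wn u A D T (k, r, pl u j + ℓ + cc k, S.1) L' L'.length := by
      intro L hL
      obtain ⟨t, ht⟩ := hF L hL
      rcases L with _ | ⟨i, L'⟩
      · change _ ∈ Part.some _ at ht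
        rw [Part.mem_some_iff] at ht
        simp at ht
      · rw [List.length_cons, Wn_cons] at ht
        obtain ⟨q'', h, h'⟩ := ht
        obtain ⟨S, hS, j, hj, rfl⟩ := mem_subAt.1 h
        exact ⟨i, L', rfl, S, hS, j, hj, t, h'⟩
    set I := F.image fun L => L.headD 0 with hI
    have h2 : ∀ i ∈ I, ∃ j, ∃ S ∈ LSn u A D T k r ℓ t0 i, launch u A D k r ℓ S = Option.some j := by
      intro i hi
      obtain ⟨L, hL, rfl⟩ := Finset.mem_image.1 hi
      obtain ⟨i, L', rfl, S, hS, j, hj, -⟩ := h1 L hL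
      exact ⟨j, S, hS, hj⟩
    choose! j hj using h2
    have h3 : ∀ i ∈ I, ∑ L ∈ F.filter (fun L => L.headD 0 = i), (1/2:ℝ)^(f L) ≤ 
        wt u (j i) * (1/2:ℝ)^(ℓ + cc k) * (1 + (1/2)^(cc k))^r := by
      intro i hi
      obtain ⟨S, hS, hl⟩ := hj i hi
      have hFi : ∀ L ∈ F.filter (fun L => L.headD 0 = i), ∃ L', L = i :: L' ∧ 
          ∃ t, (k, 0, f L, t) ∈ Wn u A D T (k, r, pl u (j i) + ℓ + cc k, S.1) L' L'.length := by
        intro L hL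
        rw [Finset.mem_filter] at hL
        obtain ⟨hL, hL2⟩ := hL
        obtain ⟨i', L', rfl, S', hS', j', hj', t, ht⟩ := h1 L hL
        simp only [List.headD_cons] at hL2
        subst hL2
        obtain rfl := Part.mem_unique hS hS'
        rw [hl] at hj'
        cases hj'
        exact ⟨L', rfl, t, ht⟩
      have := ih (pl u (j i) + ℓ + cc k) S.1 ((F.filter (fun L => L.headD 0 = i)).image List.tail)
        (fun L' => f (i :: L')) (by
          intro L' hL'
          obtain ⟨L, hL, rfl⟩ := Finset.mem_image.1 hL'
          obtain ⟨L', rfl, t, ht⟩ := hFi L hL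
          exact ⟨t, ht⟩)
      rw [Finset.sum_image] at this
      · have e : ∑ L ∈ F.filter (fun L => L.headD 0 = i), (1/2:ℝ)^(f L) =
          ∑ L ∈ F.filter (fun L => L.headD 0 = i), (1/2:ℝ)^(f (i :: L.tail)) := by
          refine Finset.sum_congr rfl fun L hL => ?_
          obtain ⟨L', rfl, -⟩ := hFi L hL
          rfl
        rw [e]
        refine this.trans (le_of_eq ?_)
        rw [zs_wt (launch_some hl).2.2.1, ← pow_add, add_assoc]
      · intro L hL L2 hL2 he
        obtain ⟨L', rfl, -⟩ := hFi L hL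
        obtain ⟨L2', rfl, -⟩ := hFi L2 hL2
        simpa using he
    rw [← Finset.sum_fiberwise_of_maps_to (s := F) (t := I) (g := fun L => L.headD 0) 
      (fun L hL => Finset.mem_image_of_mem _ hL)]
    refine (Finset.sum_le_sum h3).trans ?_
    rw [← Finset.sum_mul, ← Finset.sum_mul]
    have h4 := H.sub_sum I j hj
    have h5 : (2:ℝ)^(cc k) * (1/2)^(cc k) = 1 := by rw [← mul_pow]; norm_num
    calc (∑ i ∈ I, wt u (j i)) * (1/2:ℝ)^(ℓ + cc k) * (1 + (1/2)^(cc k))^r 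
      ≤ (2^(cc k) + 1) * (1/2:ℝ)^(ℓ + cc k) * (1 + (1/2)^(cc k))^r := by gcongr
      _ = (1/2:ℝ)^ℓ * ((2:ℝ)^(cc k) * (1/2)^(cc k) + (1/2)^(cc k)) * (1 + (1/2)^(cc k))^r := by rw [pow_add]; ring
      _ = _ := by rw [h5, pow_succ]; ring
end sem


theorem union_list {ι : Type} (p : Prop) (φ : ι → ℕ) (w : ι → ℝ) (hw : ∀ x, 0 ≤ w x) (lo hi : En → ℕ) (v : En → ℝ)
    (Q : En → ι → Prop) : ∀ (l : List En), l.Pairwise (fun e e' => hi e' ≤ lo e) →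
    (∀ e ∈ l, ∃ F : Finset ι, (p → Set.InjOn φ F) ∧ (∀ x ∈ F, lo e ≤ φ x ∧ φ x < hi e ∧ Q e x) ∧ v e ≤ ∑ x ∈ F, w x) →
    ∃ F : Finset ι, (p → Set.InjOn φ F) ∧ (∀ x ∈ F, ∃ e ∈ l, lo e ≤ φ x ∧ φ x < hi e ∧ Q e x) ∧ 
      (l.map v).sum ≤ ∑ x ∈ F, w x := by
  intro l
  induction l with
  | nil => intro _ _; exact ⟨∅, by simp, by simp, by simp⟩
  | cons e l ih =>
    intro hp h
    rw [List.pairwise_cons] at hp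
    obtain ⟨F, h1, h2, h3⟩ := ih hp.2 fun e he => h e (List.mem_cons_of_mem _ he)
    obtain ⟨G, g1, g2, g3⟩ := h e (List.mem_cons_self)
    have hd : ∀ x ∈ F, ∀ y ∈ G, φ x < φ y := by
      intro x hx y hy
      obtain ⟨e', he', -, h5, -⟩ := h2 x hx
      exact h5.trans_le ((hp.1 e' he').trans (g2 y hy).1)
    refine ⟨G ∪ F, fun hh => ?_, ?_, ?_⟩
    · intro x hx y hy hxy
      simp only [Finset.coe_union, Set.mem_union, Finset.mem_coe] at hx hy
      rcases hx with hx | hx <;> rcases hy with hy | hy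
      · exact g1 hh hx hy hxy
      · have := hd y hy x hx; omega
      · have := hd x hx y hy; omega
      · exact h1 hh hx hy hxy
    · intro x hx
      rcases Finset.mem_union.1 hx with hx | hx
      · exact ⟨e, List.mem_cons_self, g2 x hx⟩
      · obtain ⟨e', he', h⟩ := h2 x hx
        exact ⟨e', List.mem_cons_of_mem _ he', h⟩
    · rw [List.map_cons, List.sum_cons, Finset.sum_union]
      · linarith
      · rw [Finset.disjoint_left]
        intro x hx hx'
        exact lt_irrefl _ (hd x hx' x hx)

section sem
variable {U : Str →. Str} {u : ℕ → Option (Str × Str)} {X Y : ℕ → Bool} {A D : ℕ → ℕ → Bool}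
    {T : Qy →. ℕ} 

variable (u A D T) in
def Adm (n0 k κ r ℓ t0 : ℕ) : Prop := n0 ≤ t0 ∧ ℓ + k ≤ t0 ∧ ∀ L ℓ' t', 
  (k, 0, ℓ', t') ∈ Wn u A D T (k, r, ℓ, t0) L L.length →
    ∃ j, zs u j = true ∧ sl u j = 2^(t'+1) ∧ pl u j ≤ ℓ' + κ

theorem Ctx.adm_sub (H : Ctx U u X Y A D T) {n0 k κ r ℓ t0 i ℓ' t' : ℕ} (h : Adm u A D T n0 k κ (r+1) ℓ t0)
    (hs : (k, r, ℓ', t') ∈ subAt u A D T (k, r+1, ℓ, t0) i) : Adm u A D T n0 k κ r ℓ' t' := by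
  obtain ⟨S, hS, j, hj, e⟩ := mem_subAt.1 hs
  simp only [Prod.mk.injEq, true_and] at e
  obtain ⟨rfl, rfl⟩ := e
  refine ⟨h.1.trans (H.inv hS).ge, (launch_some hj).2.2.2.1, fun L ℓ'' t'' hL => ?_⟩
  refine h.2.2 (i :: L) ℓ'' t'' ?_
  rw [List.length_cons]
  exact Wn_cons.2 ⟨_, hs, hL⟩

variable (u) in
def Puts (κ ℓ t0 t1 : ℕ) : Prop := ∃ Γ : Finset ℕ, Set.InjOn (sl u) Γ ∧ 
  (∀ x ∈ Γ, zs u x = true ∧ 2^(t0+1) ≤ sl u x ∧ sl u x < 2^(t1+1)) ∧ (1/2:ℝ)^(ℓ+κ) ≤ ∑ x ∈ Γ, wt u x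

theorem Ctx.puts_loop (H : Ctx U u X Y A D T) {n0 k κ r : ℕ} 
    (ih : ∀ ℓ t0 t1, Adm u A D T n0 k κ r ℓ t0 → t1 ∈ T (k, r, ℓ, t0) → Puts u κ ℓ t0 t1)
    {ℓ t0 i : ℕ} {S : LS} (ha : Adm u A D T n0 k κ (r+1) ℓ t0) (hS : S ∈ LSn u A D T k r ℓ t0 i)
    (hd : doneB u A D k r S = true) : Puts u κ ℓ t0 S.1 := by
  have I := H.inv hS
  have hd' := (H.done_iff I).1 hd
  obtain ⟨F, h1, h2, h3⟩ := union_list True (sl u) (wt u) wt_nonneg (fun e => 2^(e.2.1+1)) (fun e => 2^(e.2.2+1))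
    (fun e => wt u e.1 * (1/2:ℝ)^(ℓ + cc k + κ)) (fun _ x => zs u x = true) (sucL A D r S.1 S.2)
    ((I.pw.filter _).imp fun h => Nat.pow_le_pow_right (by norm_num) (by omega)) (by
      intro e he
      obtain ⟨h1, h2, h3, h4, h5, h6, h7, i', h8⟩ := I.ent e (List.mem_filter.1 he).1
      obtain ⟨Γ, g1, g2, g3⟩ := ih _ _ _ (H.adm_sub ha h8) h7
      refine ⟨Γ, fun _ => g1, fun x hx => ⟨(g2 x hx).2.1, (g2 x hx).2.2, (g2 x hx).1⟩, le_trans (le_of_eq ?_) g3⟩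
      rw [zs_wt h5, ← pow_add]
      congr 1; ring)
  refine ⟨F, h1 trivial, fun x hx => ?_, le_trans ?_ h3⟩
  · obtain ⟨e, he, g1, g2, g3⟩ := h2 x hx
    obtain ⟨f1, f2, f3, -⟩ := I.ent e (List.mem_filter.1 he).1
    exact ⟨g3, le_trans (Nat.pow_le_pow_right (by norm_num) (by omega)) g1, 
      g2.trans_le (Nat.pow_le_pow_right (by norm_num) (by omega))⟩
  · rw [List.sum_map_mul_right]
    have h5 : (2:ℝ)^(cc k) * (1/2)^(cc k) = 1 := by rw [← mul_pow]; norm_num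
    calc (1/2:ℝ)^(ℓ+κ) = (2:ℝ)^(cc k) * (1/2:ℝ)^(ℓ + cc k + κ) := by
          rw [show ℓ + cc k + κ = (ℓ + κ) + cc k by ring, pow_add _ (ℓ+κ)]
          linear_combination (- (1/2:ℝ)^(ℓ+κ)) * h5
      _ ≤ _ := by gcongr; exact hd'

theorem Ctx.puts (H : Ctx U u X Y A D T) {n0 k κ : ℕ} : ∀ r ℓ t0 t1, Adm u A D T n0 k κ r ℓ t0 →
    t1 ∈ T (k, r, ℓ, t0) → Puts u κ ℓ t0 t1 := by
  intro r
  induction r with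
  | zero =>
    intro ℓ t0 t1 ha ht
    have hlt := H.T_gt _ _ _ _ _ ht
    obtain ⟨j, h1, h2, h3⟩ := ha.2.2 [] ℓ t0 (Part.mem_some _)
    refine ⟨{j}, by simp, ?_, ?_⟩
    · intro x hx
      rw [Finset.mem_singleton] at hx
      subst hx
      exact ⟨h1, h2.ge, by rw [h2]; exact Nat.pow_lt_pow_right (by norm_num) (by omega)⟩
    · rw [Finset.sum_singleton, zs_wt h1]
      exact pow_le_pow_of_le_one (by norm_num) (by norm_num) h3
  | succ r ih =>
    intro ℓ t0 t1 ha ht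
    obtain ⟨τ0, h1, h2, -⟩ := H.mem_T ht
    obtain ⟨i, S, hS, hd, rfl⟩ := mem_start_succ h1
    obtain ⟨Γ, g1, g2, g3⟩ := H.puts_loop ih ha hS hd
    exact ⟨Γ, g1, fun x hx => ⟨(g2 x hx).1, (g2 x hx).2.1, (g2 x hx).2.2.trans_le 
      (Nat.pow_le_pow_right (by norm_num) (by omega))⟩, g3⟩

/-! responses -/
variable (u A D) in
def NoGap (b n0 : ℕ) : Prop := ∀ n ≥ n0, ∀ Γ : Finset ℕ, Set.InjOn (sl u) Γ → 
  (∀ x ∈ Γ, zs u x = true ∧ 2^(n+1) ≤ sl u x) → (2:ℝ)^b ≤ (∑ x ∈ Γ, wt u x) * 2^n →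
  ∃ᶠ s in atTop, (1/2:ℝ)^b * (∑ x ∈ Γ, wt u x) ≤ mR u A s (2^n) + mR u D s (2^n)

theorem UE.resp_iff (hu : UE U u) {k ℓ t0 τ : ℕ} : respB u A D k ℓ t0 τ = true ↔
    (1/2:ℝ)^(k+ℓ) ≤ mR u A τ (2^t0) + mR u D τ (2^t0) := by
  unfold respB
  rw [decide_eq_true_iff, ← Nat.cast_le (α := ℝ)]
  push_cast
  rw [hu.mN_eq, hu.mN_eq, one_div, inv_pow, inv_le_iff_one_le_mul₀ (by positivity), ← mul_add, mul_assoc]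
  exact le_mul_iff_one_le_right (by positivity)

theorem Ctx.respond (H : Ctx U u X Y A D T) {b n0 κ ℓ t0 τ0 t1 r : ℕ} (hN : NoGap u A D b n0)
    (h0 : n0 ≤ t0) (h1 : ℓ + (b + κ) ≤ t0) (hp : Puts u κ ℓ t0 t1) 
    (hs : τ0 ∈ startT u A D T (b+κ, r, ℓ, t0)) : ∃ t1, t1 ∈ T (b+κ, r, ℓ, t0) := by
  obtain ⟨Γ, g1, g2, g3⟩ := hp
  have := hN t0 h0 Γ g1 (fun x hx => ⟨(g2 x hx).1, (g2 x hx).2.1⟩) (by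
    have : (2:ℝ)^b ≤ (1/2:ℝ)^(ℓ+κ) * 2^t0 := by
      rw [one_div, inv_pow, inv_mul_eq_div, le_div_iff₀ (by positivity), ← pow_add]
      exact pow_le_pow_right₀ (by norm_num) (by omega)
    exact this.trans (by gcongr))
  obtain ⟨s, hs1, hs2⟩ := (this.and_eventually (eventually_gt_atTop τ0)).exists
  refine H.T_dom hs hs2 (H.hu.resp_iff.2 ?_)
  refine le_trans ?_ hs1
  calc (1/2:ℝ)^(b+κ+ℓ) = (1/2)^b * (1/2:ℝ)^(ℓ+κ) := by rw [← pow_add]; congr 1; ring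
    _ ≤ _ := by gcongr

/-! termination of loops -/
theorem ent_launch {k r ℓ t0 : ℕ} : ∀ {i : ℕ} {S : LS}, S ∈ LSn u A D T k r ℓ t0 i → ∀ e ∈ S.2, 
    ∃ i', ∃ S' ∈ LSn u A D T k r ℓ t0 i', launch u A D k r ℓ S' = Option.some e.1 ∧ 
      e.2.2 ∈ T (subQ u k r ℓ S' e.1) := by
  intro i
  induction i with
  | zero => 
    intro S hS
    change S ∈ Part.some (t0, []) at hS
    rw [Part.mem_some_iff] at hS
    subst hS
    simp
  | succ i ih =>
    intro S' hS' e he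
    obtain ⟨S, hS, hst⟩ := LSn_succ.1 hS'
    rcases mem_stepP.1 hst with ⟨-, rfl⟩ | ⟨j, t', hl, ht', rfl⟩
    · refine ih hS e ?_
      unfold idle at he
      rcases hb : doneB u A D k r S with _ | _ <;> rw [hb] at he <;> simpa using he
    · rcases List.mem_cons.1 he with rfl | he
      · exact ⟨i, S, hS, hl, ht'⟩
      · exact ih hS e he

theorem Ctx.req (H : Ctx U u X Y A D T) (hU : OptimalPF U) (k r ℓ t0 : ℕ) : 
    ∃ c, ∀ i, ∀ S ∈ LSn u A D T k r ℓ t0 i, ∀ j, launch u A D k r ℓ S = Option.some j → 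
      ∀ t' ∈ T (subQ u k r ℓ S j), KC U (restrSeq (zz A D r t') (sl u j)) ≤ (pl u j + c : ℕ) := by
  have : PR1 u := ⟨H.hu.pr⟩
  have : PR2 A := ⟨H.hA.pr⟩
  have : PR2 D := ⟨H.hD.pr⟩
  have hT : Partrec₂ fun (_ : ℕ) => T := H.pT.comp Computable.snd
  have h1 : Partrec fun i => LSn u A D T k r ℓ t0 i :=
    pa_LSn (γ := ℕ) (T := fun _ => T) (k := fun _ => k) (r := fun _ => r) (ℓ := fun _ => ℓ) (t0 := fun _ => t0)
      (n := fun i => i) hT (by fun_prop) (by fun_prop) (by fun_prop) (by fun_prop) (by fun_prop)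
  have h2 : Partrec₂ fun (i : ℕ) (S : LS) => Part.ofOption (launch u A D k r ℓ S) := 
    Computable.ofOption (f := fun p : ℕ × LS => launch u A D k r ℓ p.2) (Primrec.to_comp (by fun_prop))
  have h3 : Partrec fun p : (ℕ × LS) × ℕ => T (subQ u k r ℓ p.1.2 p.2) := 
    H.pT.comp (Primrec.to_comp (by fun_prop))
  have h4 : Partrec₂ fun (p : ℕ × LS) (j : ℕ) => 
      (T (subQ u k r ℓ p.2 j)).map fun t' => (pl u j + cc k + 1, rs2 A D r t' (sl u j)) := by
    refine Partrec.map (f := fun p : (ℕ × LS) × ℕ => T (subQ u k r ℓ p.1.2 p.2)) 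
      (g := fun p t' => (pl u p.2 + cc k + 1, rs2 A D r t' (sl u p.2))) h3 (Primrec.to_comp ?_)
    fun_prop
  have h5 : Partrec fun i => (LSn u A D T k r ℓ t0 i).bind fun S => (Part.ofOption (launch u A D k r ℓ S)).bind
     fun j => (T (subQ u k r ℓ S j)).map fun t' => (pl u j + cc k + 1, rs2 A D r t' (sl u j)) :=
    h1.bind (h2.bind h4)
  have hmem : ∀ i p, p ∈ ((LSn u A D T k r ℓ t0 i).bind fun S => (Part.ofOption (launch u A D k r ℓ S)).bind
     fun j => (T (subQ u k r ℓ S j)).map fun t' => (pl u j + cc k + 1, rs2 A D r t' (sl u j))) ↔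
     ∃ S ∈ LSn u A D T k r ℓ t0 i, ∃ j, launch u A D k r ℓ S = Option.some j ∧ ∃ t' ∈ T (subQ u k r ℓ S j),
       p = (pl u j + cc k + 1, restrSeq (zz A D r t') (sl u j)) := by
    intro i p
    simp only [Part.mem_bind_iff, Part.mem_ofOption, Option.mem_def, Part.mem_map_iff, rs2_eq]
    constructor
    · rintro ⟨S, hS, j, hj, t', ht', rfl⟩; exact ⟨S, hS, j, hj, t', ht', rfl⟩
    · rintro ⟨S, hS, j, hj, t', ht', rfl⟩; exact ⟨S, hS, j, hj, t', ht', rfl⟩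
  obtain ⟨c, hc⟩ := kc_opt_part hU h5 (by
    intro F f hF
    have : ∀ i ∈ F, ∃ j, f i = pl u j + cc k + 1 ∧ 
        ∃ S ∈ LSn u A D T k r ℓ t0 i, launch u A D k r ℓ S = Option.some j := by
      intro i hi
      obtain ⟨σ, hσ⟩ := hF i hi
      obtain ⟨S, hS, j, hj, t', ht', e⟩ := (hmem _ _).1 hσ
      simp only [Prod.mk.injEq] at e
      exact ⟨j, e.1, S, hS, hj⟩
    choose! j hj using this
    have h6 := H.sub_sum F j fun i hi => (hj i hi).2
    have h7 : ∑ i ∈ F, (1/2:ℝ)^(f i) = (∑ i ∈ F, wt u (j i)) * (1/2)^(cc k + 1) := by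
      rw [Finset.sum_mul]
      refine Finset.sum_congr rfl fun i hi => ?_
      obtain ⟨h8, S, hS, hl⟩ := hj i hi
      rw [h8, zs_wt (launch_some hl).2.2.1, ← pow_add, add_assoc]
    rw [h7]
    have h8 : (2:ℝ)^(cc k) * (1/2)^(cc k) = 1 := by rw [← mul_pow]; norm_num
    have h9 : (1/2:ℝ)^(cc k) ≤ 1 := pow_le_one₀ (by norm_num) (by norm_num)
    calc (∑ i ∈ F, wt u (j i)) * (1/2:ℝ)^(cc k + 1) ≤ (2^(cc k)+1) * (1/2:ℝ)^(cc k + 1) := by gcongr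
      _ = ((2:ℝ)^(cc k) * (1/2)^(cc k) + (1/2)^(cc k))/2 := by rw [pow_succ]; ring
      _ ≤ 1 := by rw [h8]; linarith)
  refine ⟨cc k + 1 + c, fun i S hS j hj t' ht' => ?_⟩
  have := hc i _ _ ((hmem i _).2 ⟨S, hS, j, hj, t', ht', rfl⟩)
  simpa only [add_assoc] using this

theorem Ctx.loop_term (H : Ctx U u X Y A D T) (hU : OptimalPF U) {k r ℓ t0 : ℕ} 
    (hnt : ¬ KTrivialSeq U (zz X Y r))
    (hsub : ∀ i, ∀ q ∈ subAt u A D T (k, r+1, ℓ, t0) i, ∃ t1, t1 ∈ T q) : 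
    ∃ i, ∃ S ∈ LSn u A D T k r ℓ t0 i, doneB u A D k r S = true := by
  by_contra hcon
  push Not at hcon
  have hdom : ∀ i, ∃ S, S ∈ LSn u A D T k r ℓ t0 i := by
    intro i
    induction i with
    | zero => exact ⟨_, Part.mem_some _⟩
    | succ i ih =>
      obtain ⟨S, hS⟩ := ih
      rcases hl : launch u A D k r ℓ S with _ | j
      · exact ⟨_, LSn_succ.2 ⟨S, hS, mem_stepP.2 (Or.inl ⟨hl, rfl⟩)⟩⟩
      · obtain ⟨t', ht'⟩ := hsub i _ (mem_subAt.2 ⟨S, hS, j, hl, rfl⟩)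
        exact ⟨_, LSn_succ.2 ⟨S, hS, mem_stepP.2 (Or.inr ⟨j, t', hl, ht', rfl⟩)⟩⟩
  choose S hS using hdom
  have hnd : ∀ i, doneB u A D k r (S i) = false := fun i => by simpa using hcon i _ (hS i)
  have hstep : ∀ i, (launch u A D k r ℓ (S i) = Option.none ∧ S (i+1) = ((S i).1+1, (S i).2)) ∨
      ∃ j t', launch u A D k r ℓ (S i) = Option.some j ∧ (S i).1 < t' ∧ S (i+1) = (t', (j, (S i).1, t') :: (S i).2) := by
    intro i
    obtain ⟨S0, hS0, hst⟩ := LSn_succ.1 (hS (i+1))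
    obtain rfl := Part.mem_unique (hS i) hS0
    rcases mem_stepP.1 hst with ⟨h1, h2⟩ | ⟨j, t', hl, ht', h2⟩
    · left; refine ⟨h1, ?_⟩
      rw [h2]; unfold idle; rw [hnd i]; rfl
    · right; exact ⟨j, t', hl, H.T_gt _ _ _ _ _ ht', h2⟩
  have hτ : ∀ i, i ≤ (S i).1 := by
    intro i
    induction i with
    | zero => omega
    | succ i ih =>
      rcases hstep i with ⟨-, h⟩ | ⟨j, t', -, h1, h⟩ <;> rw [h] <;> simp only <;> omega
  obtain ⟨c, hc⟩ := H.req hU k r ℓ t0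
  apply hnt
  refine ⟨c, fun n => KC_le_add fun m hm => ?_⟩
  obtain ⟨j, hj1, hj2, hj3⟩ := H.hu.zprog hm
  have hfin : ∀ j, zs u j = true → {i | launch u A D k r ℓ (S i) = Option.some j}.Finite := by
    intro j hj
    by_contra hinf
    obtain ⟨N, hN⟩ := exists_nat_gt (((2:ℝ)^(cc k)+1) / wt u j)
    obtain ⟨F, hF, hF2⟩ := Set.Infinite.exists_subset_card_eq hinf N
    have := H.sub_sum F (fun _ => j) fun i hi => ⟨S i, hS i, hF hi⟩
    rw [Finset.sum_const, hF2, nsmul_eq_mul] at this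
    have hw : 0 < wt u j := by rw [zs_wt hj]; positivity
    rw [div_lt_iff₀ hw] at hN
    linarith
  have hfin2 : {i | ∃ j' ≤ j, launch u A D k r ℓ (S i) = Option.some j'}.Finite := by
    have : {i | ∃ j' ≤ j, launch u A D k r ℓ (S i) = Option.some j'} ⊆ 
        ⋃ j' ∈ {j' | j' ≤ j}, {i | zs u j' = true ∧ launch u A D k r ℓ (S i) = Option.some j'} := by
      rintro i ⟨j', h1, h2⟩
      simp only [Set.mem_iUnion]
      exact ⟨j', h1, (launch_some h2).2.2.1, h2⟩
    refine (Set.Finite.biUnion (Set.finite_le_nat j) fun j' _ => ?_).subset this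
    by_cases hz : zs u j' = true
    · exact (hfin j' hz).subset fun i hi => hi.2
    · convert Set.finite_empty (α := ℕ)
      ext i; simp [hz]
  obtain ⟨B, hB⟩ := hfin2.bddAbove
  set i0 := B + 1 + j + (pl u j + ℓ + cc k + k) with hi0
  have hact : ∀ i ≥ i0, ∃ e ∈ (S i).2, e.1 = j ∧ actB A D r (S i).1 e = true := by
    intro i hi
    by_contra hno
    push Not at hno
    have := hτ i
    obtain ⟨j', h1, h2⟩ := launch_ne_none (k := k) (ℓ := ℓ) (j := j) (hnd i) (by omega) hj1 (by omega) 
      (fun e he h => by simpa using hno e he h)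
    have := hB (show i ∈ {i | ∃ j' ≤ j, launch u A D k r ℓ (S i) = Option.some j'} from ⟨j', h1, h2⟩)
    omega
  have hpers : ∀ i ≥ i0, ∀ e ∈ (S i).2, e.1 = j → e ∈ (S i0).2 := by
    intro i hi
    induction i, hi using Nat.le_induction with
    | base => exact fun e he _ => he
    | succ i hi ih =>
      intro e he hej
      rcases hstep i with ⟨-, h⟩ | ⟨j', t', h1, h2, h⟩
      · rw [h] at he; exact ih e he hej
      · rw [h] at he
        rcases List.mem_cons.1 he with rfl | he
        · subst hej
          have := hB (show i ∈ {i | ∃ j'' ≤ j', launch u A D k r ℓ (S i) = Option.some j''} from ⟨j', le_rfl, h1⟩)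
          omega
        · exact ih e he hej
  obtain ⟨s0, hs0⟩ := eventually_atTop.1 ((H.apx r).lim (2^(S i0).1))
  set i := max i0 s0
  obtain ⟨e, he, hej, hea⟩ := hact i (le_max_left _ _)
  have he0 := hpers i (le_max_left _ _) e he hej
  obtain ⟨f1, f2, f3, f4, -⟩ := (H.inv (hS i0)).ent e he0
  have hlim := hs0 (S i).1 ((le_max_right _ _).trans (hτ i))
  rw [actB_iff] at hea
  have hlim2 : restrSeq (zz A D r e.2.2) (2^e.2.1) = restrSeq (zz X Y r) (2^e.2.1) := by
    rw [← hea]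
    exact restr_eq_mono (Nat.pow_le_pow_right (by norm_num) (by omega)) hlim
  have hn : n ≤ 2^e.2.1 := by
    have := H.hu.sl_le j
    have := Nat.lt_two_pow_self (n := e.2.1)
    omega
  obtain ⟨i', S', hS', hl, ht⟩ := ent_launch (hS i) e he
  have := hc i' S' hS' e.1 hl _ ht
  rw [hej, hj2, restr_eq_mono hn hlim2] at this
  refine this.trans ?_
  exact_mod_cast (by omega : pl u j + c ≤ m + c)

theorem Ctx.term (H : Ctx U u X Y A D T) (hU : OptimalPF U) (hX : ¬ KTrivialSeq U X) (hY : ¬ KTrivialSeq U Y)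
    {b n0 κ : ℕ} (hN : NoGap u A D b n0) : ∀ r ℓ t0, Adm u A D T n0 (b+κ) κ r ℓ t0 → ∃ t1, t1 ∈ T (b+κ, r, ℓ, t0) := by
  intro r
  induction r with
  | zero =>
    intro ℓ t0 ha
    obtain ⟨j, h1, h2, h3⟩ := ha.2.2 [] ℓ t0 (Part.mem_some _)
    refine H.respond hN ha.1 ha.2.1 (t1 := t0 + 1) ?_ (mem_start_zero.2 rfl)
    refine ⟨{j}, by simp, ?_, ?_⟩
    · intro x hx
      rw [Finset.mem_singleton] at hx
      subst hx
      exact ⟨h1, h2.ge, by rw [h2]; exact Nat.pow_lt_pow_right (by norm_num) (by omega)⟩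
    · rw [Finset.sum_singleton, zs_wt h1]
      exact pow_le_pow_of_le_one (by norm_num) (by norm_num) h3
  | succ r ih =>
    intro ℓ t0 ha
    obtain ⟨i, S, hS, hd⟩ := H.loop_term hU (k := b+κ) (r := r) (ℓ := ℓ) (t0 := t0) 
      (by unfold zz; split_ifs <;> assumption) (by
        intro i q hq
        obtain ⟨S, hS, j, hj, rfl⟩ := mem_subAt.1 hq
        exact ih _ _ (H.adm_sub ha hq))
    obtain ⟨τ0, hτ0⟩ := start_succ_dom hS hd
    exact H.respond hN ha.1 ha.2.1 (H.puts_loop (H.puts r) ha hS hd) hτ0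
end sem

section sem
variable {U : Str →. Str} {u : ℕ → Option (Str × Str)} {X Y : ℕ → Bool} {A D : ℕ → ℕ → Bool}
    {T : Qy →. ℕ} 

/-- side selector -/
def zb {α : Type} (A D : α) (b : Bool) : α := if b = true then D else A

theorem zz_eq_zb {α : Type} (A D : α) (r : ℕ) : zz A D r = zb A D (decide (r % 2 = 1)) := by
  unfold zz zb
  rcases Nat.mod_two_eq_zero_or_one r with h | h <;> simp [h]

theorem cur_restr {Z : ℕ → ℕ → Bool} {s s' t : ℕ} (h : cur u Z s t = true) (h' : cur u Z s' t = true) :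
    restrSeq (Z s) (sl u t) = restrSeq (Z s') (sl u t) := by
  obtain ⟨ρ, h⟩ := cur_iff.1 h
  obtain ⟨ρ', h'⟩ := cur_iff.1 h'
  rw [h] at h'
  simp only [Option.some.injEq, Prod.mk.injEq] at h'
  exact h'.2

theorem cur_of_restr {Z : ℕ → ℕ → Bool} {s s' t : ℕ} (h : cur u Z s t = true) 
    (h' : restrSeq (Z s) (sl u t) = restrSeq (Z s') (sl u t)) : cur u Z s' t = true := by
  obtain ⟨ρ, h⟩ := cur_iff.1 h
  exact cur_iff.2 ⟨ρ, by rw [h, h']⟩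

theorem Ctx.dead (H : Ctx U u X Y A D T) {r τ s s' x : ℕ} {e : En} (ha : actB A D r τ e = false)
    (h1 : s ≤ e.2.2) (h2 : e.2.2 ≤ τ) (h3 : τ ≤ s') (hx : 2^e.2.1 ≤ sl u x)
    (hc : cur u (zz A D r) s x = true) : cur u (zz A D r) s' x = false := by
  by_contra hh
  rw [Bool.not_eq_false] at hh
  have h4 := cur_restr hc hh
  have h5 := (H.apx r).noret _ _ _ _ (h1.trans h2) h3 h4
  have h6 := (H.apx r).noret _ _ _ _ h1 (h2.trans h3) h4
  have : actB A D r τ e = true := actB_iff.2 (restr_eq_mono hx (h5.trans h6.symm))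
  rw [ha] at this; cases this

variable (u A D) in
def Spend (k r ℓ t0 t1 : ℕ) : Prop := ∃ F : Finset (ℕ × Bool), (∀ x ∈ F, 2^t0 ≤ sl u x.1 ∧ sl u x.1 < 2^t1 ∧
  (∃ s ≤ t1, cur u (zb A D x.2) s x.1 = true) ∧ 
  (r % 2 = 1 → x.2 = false → ∀ s ≥ t1, cur u (zb A D x.2) s x.1 = false)) ∧
  ((r / 2 : ℕ) + 1 : ℝ) * (1/2:ℝ)^(k+ℓ) ≤ ∑ x ∈ F, wt u x.1

theorem Ctx.spend_loop (H : Ctx U u X Y A D T) {k r : ℕ} 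
    (ih : ∀ ℓ t0 t1, t1 ∈ T (k, r, ℓ, t0) → Spend u A D k r ℓ t0 t1)
    {ℓ t0 i : ℕ} {S : LS} (hS : S ∈ LSn u A D T k r ℓ t0 i)
    (hd : doneB u A D k r S = true) : ∃ F : Finset (ℕ × Bool), (∀ x ∈ F, 2^t0 ≤ sl u x.1 ∧ sl u x.1 < 2^S.1 ∧
  (∃ s ≤ S.1, cur u (zb A D x.2) s x.1 = true) ∧ 
  (x.2 = decide (r % 2 = 1) → ∀ s ≥ S.1, cur u (zb A D x.2) s x.1 = false) ∧
  (r % 2 = 1 → x.2 = false → ∀ s ≥ S.1, cur u (zb A D x.2) s x.1 = false)) ∧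
  ((r / 2 : ℕ) + 1 : ℝ) * (1/2:ℝ)^(k+ℓ) ≤ ∑ x ∈ F, wt u x.1 := by
  have I := H.inv hS
  have hd' := (H.done_iff I).1 hd
  obtain ⟨F, -, h2, h3⟩ := union_list False (fun x : ℕ × Bool => sl u x.1) (fun x => wt u x.1) (fun _ => wt_nonneg _) 
    (fun e => 2^e.2.1) (fun e => 2^e.2.2)
    (fun e => wt u e.1 * (((r / 2 : ℕ) + 1 : ℝ) * (1/2:ℝ)^(k+(ℓ + cc k)))) 
    (fun e x => (∃ s ≤ e.2.2, cur u (zb A D x.2) s x.1 = true) ∧ 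
      (r % 2 = 1 → x.2 = false → ∀ s ≥ e.2.2, cur u (zb A D x.2) s x.1 = false)) (sucL A D r S.1 S.2)
    ((I.pw.filter _).imp fun h => Nat.pow_le_pow_right (by norm_num) (by omega)) (by
      intro e he
      obtain ⟨h1, h2, h3, h4, h5, h6, h7, i', h8⟩ := I.ent e (List.mem_filter.1 he).1
      obtain ⟨Γ, g1, g2⟩ := ih _ _ _ h7
      refine ⟨Γ, fun h => h.elim, fun x hx => g1 x hx, le_trans (le_of_eq ?_) g2⟩
      rw [zs_wt h5, mul_left_comm, ← pow_add]
      congr 2; ring)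
  refine ⟨F, fun x hx => ?_, le_trans ?_ h3⟩
  · obtain ⟨e, he, g1, g2, ⟨s, hs, hc⟩, g4⟩ := h2 x hx
    have he' := List.mem_filter.1 he
    obtain ⟨f1, f2, f3, -⟩ := I.ent e he'.1
    refine ⟨le_trans (Nat.pow_le_pow_right (by norm_num) (by omega)) g1, 
      g2.trans_le (Nat.pow_le_pow_right (by norm_num) (by omega)), ⟨s, by omega, hc⟩, ?_, ?_⟩
    · intro hx s' hs'
      rw [hx, ← zz_eq_zb] at hc ⊢
      exact H.dead (by simpa using he'.2) hs f3 hs' g1 hc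
    · intro a b s' hs'
      exact g4 a b s' (le_trans f3 hs')
  · rw [List.sum_map_mul_right]
    have h5 : (2:ℝ)^(cc k) * (1/2)^(cc k) = 1 := by rw [← mul_pow]; norm_num
    calc ((r / 2 : ℕ) + 1 : ℝ) * (1/2:ℝ)^(k+ℓ) 
        = (2:ℝ)^(cc k) * (((r / 2 : ℕ) + 1 : ℝ) * (1/2:ℝ)^(k+(ℓ + cc k))) := by
          rw [← add_assoc, pow_add _ (k+ℓ)]
          linear_combination (- ((r / 2 : ℕ) + 1 : ℝ) * (1/2:ℝ)^(k+ℓ)) * h5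
      _ ≤ _ := by gcongr; exact hd'

theorem Ctx.current (H : Ctx U u X Y A D T) {k r ℓ t0 t1 : ℕ} (h : t1 ∈ T (k, r, ℓ, t0)) :
    ∃ F : Finset (ℕ × Bool), (∀ x ∈ F, 2^t0 ≤ sl u x.1 ∧ sl u x.1 < 2^t1 ∧
      cur u (zb A D x.2) t1 x.1 = true) ∧ (1/2:ℝ)^(k+ℓ) ≤ ∑ x ∈ F, wt u x.1 := by
  obtain ⟨τ0, -, -, h3⟩ := H.mem_T h
  rw [H.hu.resp_iff] at h3
  refine ⟨((Finset.range t1).filter fun t => cur u A t1 t = true ∧ 2^t0 ≤ sl u t) ×ˢ {false} ∪ 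
    ((Finset.range t1).filter fun t => cur u D t1 t = true ∧ 2^t0 ≤ sl u t) ×ˢ {true}, ?_, ?_⟩
  · rintro ⟨x, b⟩ hx
    have hlt : x < t1 → sl u x < 2^t1 := fun h => ((H.hu.sl_le x).trans_lt h).trans Nat.lt_two_pow_self
    simp only [Finset.mem_union, Finset.mem_product, Finset.mem_filter, Finset.mem_range, Finset.mem_singleton] at hx
    rcases hx with ⟨⟨h1, h2, h3⟩, rfl⟩ | ⟨⟨h1, h2, h3⟩, rfl⟩
    · exact ⟨h3, hlt h1, by simpa [zb] using h2⟩
    · exact ⟨h3, hlt h1, by simpa [zb] using h2⟩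
  · rw [Finset.sum_union, Finset.sum_product, Finset.sum_product]
    · simpa [mR] using h3
    · rw [Finset.disjoint_left]
      rintro ⟨x, b⟩ h1 h2
      simp at h1 h2
      rw [h1.2] at h2; simp at h2

theorem Ctx.spend (H : Ctx U u X Y A D T) {k : ℕ} : ∀ r ℓ t0 t1, t1 ∈ T (k, r, ℓ, t0) → Spend u A D k r ℓ t0 t1 := by
  intro r
  induction r with
  | zero =>
    intro ℓ t0 t1 h
    obtain ⟨F, h1, h2⟩ := H.current h
    exact ⟨F, fun x hx => ⟨(h1 x hx).1, (h1 x hx).2.1, ⟨t1, le_rfl, (h1 x hx).2.2⟩, fun h => by simp at h⟩, by simpa using h2⟩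
  | succ r ih =>
    intro ℓ t0 t1 h
    obtain ⟨τ0, h1, h2, -⟩ := H.mem_T h
    obtain ⟨i, S, hS, hd, rfl⟩ := mem_start_succ h1
    obtain ⟨F, f1, f2⟩ := H.spend_loop ih hS hd
    have hlt : ∀ x ∈ F, sl u x.1 < 2^t1 := fun x hx => (f1 x hx).2.1.trans_le (Nat.pow_le_pow_right (by norm_num) h2.le)
    rcases Nat.mod_two_eq_zero_or_one r with hr | hr
    · refine ⟨F, fun x hx => ?_, ?_⟩
      · obtain ⟨a1, a2, ⟨s, a3, a4⟩, a5, a6⟩ := f1 x hx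
        refine ⟨a1, hlt x hx, ⟨s, by omega, a4⟩, fun _ hf s' hs' => a5 ?_ s' (by omega)⟩
        rw [hf]; simp [hr]
      · rw [show (r+1)/2 = r/2 by omega]; exact f2
    · obtain ⟨G, g1, g2⟩ := H.current h
      refine ⟨F ∪ G, fun x hx => ?_, ?_⟩
      · have hodd : ¬ (r+1) % 2 = 1 := by omega
        rcases Finset.mem_union.1 hx with hx | hx
        · obtain ⟨a1, a2, ⟨s, a3, a4⟩, a5, a6⟩ := f1 x hx
          exact ⟨a1, hlt x hx, ⟨s, by omega, a4⟩, fun h => absurd h hodd⟩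
        · exact ⟨(g1 x hx).1, (g1 x hx).2.1, ⟨t1, le_rfl, (g1 x hx).2.2⟩, fun h => absurd h hodd⟩
      · rw [Finset.sum_union]
        · rw [show (r+1)/2 = r/2 + 1 by omega]
          push_cast
          linarith
        · rw [Finset.disjoint_left]
          intro x hx hx'
          obtain ⟨a1, a2, ⟨s, a3, a4⟩, a5, a6⟩ := f1 x hx
          have h4 := (g1 x hx').2.2
          have h5 : cur u (zb A D x.2) t1 x.1 = false := by
            rcases hb : x.2 with _ | _
            · have := a6 hr hb t1 h2.le; rwa [hb] at this
            · have := a5 (by rw [hb]; simp [hr]) t1 h2.le; rwa [hb] at this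
          rw [h5] at h4; cases h4

theorem UE.kraft2 (hu : UE U u) (F : Finset (ℕ × Bool)) : ∑ x ∈ F, wt u x.1 ≤ 2 := by
  have h1 : F ⊆ F.image Prod.fst ×ˢ Finset.univ := by
    intro x hx
    simp only [Finset.mem_product, Finset.mem_image, Finset.mem_univ, and_true]
    exact ⟨x, hx, rfl⟩
  refine (Finset.sum_le_sum_of_subset_of_nonneg h1 fun _ _ _ => wt_nonneg _).trans ?_
  rw [Finset.sum_product]
  have := hu.kraft (F.image Prod.fst)
  simp only [Finset.sum_const, Finset.card_univ, Fintype.card_bool, nsmul_eq_mul]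
  rw [← Finset.mul_sum]
  push_cast
  linarith

theorem Ctx.no_top (H : Ctx U u X Y A D T) {k t0 t1 : ℕ} : t1 ∉ T (k, cc k, 0, t0) := by
  intro h
  obtain ⟨F, -, h2⟩ := H.spend _ _ _ _ h
  have h3 := H.hu.kraft2 F
  have h4 : cc k / 2 = 2^(k+1) := by unfold cc; rw [pow_succ 2 (k+1)]; omega
  rw [h4, add_zero] at h2
  push_cast at h2
  have h5 : (2:ℝ)^k * (1/2)^k = 1 := by rw [← mul_pow]; norm_num
  have h6 : 0 < (1/2:ℝ)^k := by positivity
  rw [pow_succ] at h2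
  nlinarith
end sem


theorem one_add_pow_le (c : ℕ) : (1 + (1/2:ℝ)^c)^c ≤ 4 := by
  have h1 : (1 + (1/2:ℝ)^c) ≤ Real.exp ((1/2:ℝ)^c) := by
    have := Real.add_one_le_exp ((1/2:ℝ)^c); linarith
  have h2 : (c:ℝ) * (1/2:ℝ)^c ≤ 1 := by
    have h3 : (c:ℝ) ≤ 2^c := by exact_mod_cast Nat.lt_two_pow_self.le
    have h5 : (2:ℝ)^c * (1/2)^c = 1 := by rw [← mul_pow]; norm_num
    calc (c:ℝ) * (1/2:ℝ)^c ≤ 2^c * (1/2:ℝ)^c := by gcongr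
      _ = 1 := h5
  calc (1 + (1/2:ℝ)^c)^c ≤ (Real.exp ((1/2:ℝ)^c))^c := by gcongr
    _ = Real.exp (c * (1/2:ℝ)^c) := by rw [← Real.exp_nat_mul]
    _ ≤ Real.exp 1 := Real.exp_le_exp.2 h2
    _ ≤ 4 := by have := Real.exp_one_lt_d9; linarith

theorem sum_half (F : Finset ℕ) : ∑ d ∈ F, (1/2:ℝ)^(d+1) ≤ 1 := by
  have h1 : ∀ n, ∑ d ∈ Finset.range n, (1/2:ℝ)^(d+1) = 1 - (1/2)^n := by
    intro n
    induction n with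
    | zero => simp
    | succ n ih => rw [Finset.sum_range_succ, ih, pow_succ]; ring
  have h2 : F ⊆ Finset.range (F.sup id + 1) := by
    intro x hx
    have := Finset.le_sup (f := id) hx
    simp at this ⊢; omega
  refine (Finset.sum_le_sum_of_subset_of_nonneg h2 fun _ _ _ => by positivity).trans ?_
  rw [h1]
  have : 0 < (1/2:ℝ)^(F.sup id + 1) := by positivity
  linarith

section sem
variable {U : Str →. Str} {u : ℕ → Option (Str × Str)} {X Y : ℕ → Bool} {A D : ℕ → ℕ → Bool}
    {T : Qy →. ℕ} 

def topQ (b n0 d : ℕ) : Qy := (b+(2*d+3), cc (b+(2*d+3)), 0, n0 + (b+(2*d+3)))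
def outQ (b d : ℕ) (q : Qy) : Option (ℕ × Str) := 
  bif decide (q.1 = b+(2*d+3)) && decide (q.2.1 = 0) then Option.some (q.2.2.1 + d + 3, zeroStr (2^(q.2.2.2+1))) else Option.none
@[fun_prop] theorem pr_outQ {γ : Type} [Primcodable γ] {b d : γ → ℕ} {q : γ → Qy} (hb : Primrec b) (hd : Primrec d)
    (hq : Primrec q) : Primrec fun x => outQ (b x) (d x) (q x) := by unfold outQ; fun_prop
variable (u A D T) in
def gL (b n0 : ℕ) (x : ℕ) : Part (ℕ × Str) :=
  (Wn u A D T (topQ b n0 (Denumerable.ofNat (ℕ × List ℕ) x).1) (Denumerable.ofNat (ℕ × List ℕ) x).2 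
    (Denumerable.ofNat (ℕ × List ℕ) x).2.length).bind fun q => 
      Part.ofOption (outQ b (Denumerable.ofNat (ℕ × List ℕ) x).1 q)

theorem Ctx.pa_gL (H : Ctx U u X Y A D T) (b n0 : ℕ) : Partrec (gL u A D T b n0) := by
  have : PR1 u := ⟨H.hu.pr⟩
  have : PR2 A := ⟨H.hA.pr⟩
  have : PR2 D := ⟨H.hD.pr⟩
  have hT : Partrec₂ fun (_ : ℕ) => T := H.pT.comp Computable.snd
  have h0 : Primrec (Denumerable.ofNat (ℕ × List ℕ)) := Primrec.ofNat _
  have hd : Primrec fun x => (Denumerable.ofNat (ℕ × List ℕ) x).1 := Primrec.fst.comp h0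
  have hL : Primrec fun x => (Denumerable.ofNat (ℕ × List ℕ) x).2 := Primrec.snd.comp h0
  have hn : Primrec fun x => (Denumerable.ofNat (ℕ × List ℕ) x).2.length := Primrec.list_length.comp hL
  have hq : Primrec fun x => topQ b n0 (Denumerable.ofNat (ℕ × List ℕ) x).1 := by
    have : Primrec (topQ b n0) := by unfold topQ; fun_prop
    exact this.comp hd
  have h1 : Partrec fun x => Wn u A D T (topQ b n0 (Denumerable.ofNat (ℕ × List ℕ) x).1) (Denumerable.ofNat (ℕ × List ℕ) x).2 
    (Denumerable.ofNat (ℕ × List ℕ) x).2.length := 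
    pa_Wn (γ := ℕ) (T := fun _ => T) (q := fun x => topQ b n0 (Denumerable.ofNat (ℕ × List ℕ) x).1)
      (L := fun x => (Denumerable.ofNat (ℕ × List ℕ) x).2) (n := fun x => (Denumerable.ofNat (ℕ × List ℕ) x).2.length) hT hq hL hn
  have h2 : Partrec₂ fun (x : ℕ) (q : Qy) => (Part.ofOption (outQ b (Denumerable.ofNat (ℕ × List ℕ) x).1 q) : Part (ℕ × Str)) :=
    Computable.ofOption (f := fun p : ℕ × Qy => outQ b (Denumerable.ofNat (ℕ × List ℕ) p.1).1 p.2) 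
      (Primrec.to_comp (pr_outQ (b := fun _ => b) (d := fun p : ℕ × Qy => (Denumerable.ofNat (ℕ × List ℕ) p.1).1)
        (q := fun p => p.2) (by fun_prop) (hd.comp Primrec.fst) Primrec.snd))
  exact Partrec.bind h1 h2

theorem mem_gL {b n0 x ℓ : ℕ} {σ : Str} : (ℓ, σ) ∈ gL u A D T b n0 x ↔ 
    ∃ ℓ' t, (b+(2*(Denumerable.ofNat (ℕ × List ℕ) x).1+3), 0, ℓ', t) ∈ 
      Wn u A D T (topQ b n0 (Denumerable.ofNat (ℕ × List ℕ) x).1) (Denumerable.ofNat (ℕ × List ℕ) x).2 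
    (Denumerable.ofNat (ℕ × List ℕ) x).2.length ∧ ℓ = ℓ' + (Denumerable.ofNat (ℕ × List ℕ) x).1 + 3 ∧
      σ = zeroStr (2^(t+1)) := by
  unfold gL
  generalize (Denumerable.ofNat (ℕ × List ℕ) x) = y
  rw [Part.mem_bind_iff]
  constructor
  · rintro ⟨⟨q1, q2, q3, q4⟩, h1, h2⟩
    rw [Part.mem_ofOption, Option.mem_def] at h2
    unfold outQ at h2
    rcases h3 : decide (q1 = b+(2*y.1+3)) && decide (q2 = 0) with _ | _
    · simp only [h3, cond_false] at h2; cases h2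
    · simp only [h3, cond_true] at h2
      simp only [Bool.and_eq_true, decide_eq_true_eq] at h3
      obtain ⟨rfl, rfl⟩ := h3
      simp only [Option.some.injEq, Prod.mk.injEq] at h2
      exact ⟨q3, q4, h1, h2.1.symm, h2.2.symm⟩
  · rintro ⟨ℓ', t, h1, rfl, rfl⟩
    refine ⟨_, h1, ?_⟩
    simp [outQ]

theorem Ctx.sum_gL (H : Ctx U u X Y A D T) (b n0 : ℕ) (F : Finset ℕ) (ℓ : ℕ → ℕ)
    (h : ∀ x ∈ F, ∃ σ, (ℓ x, σ) ∈ gL u A D T b n0 x) : ∑ x ∈ F, (1/2:ℝ)^ℓ x ≤ 1 := by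
  set dd : ℕ → ℕ := fun x => (Denumerable.ofNat (ℕ × List ℕ) x).1 with hdd
  rw [← Finset.sum_fiberwise_of_maps_to (t := F.image dd) (g := dd) fun x hx => Finset.mem_image_of_mem _ hx]
  refine le_trans (Finset.sum_le_sum fun d _ => ?_) (sum_half (F.image dd))
  have hinj : Function.Injective (Encodable.encode : ℕ × List ℕ → ℕ) := Encodable.encode_injective
  set G : Finset (List ℕ) := (F.filter fun x => dd x = d).image fun x => (Denumerable.ofNat (ℕ × List ℕ) x).2 with hG
  set f : List ℕ → ℕ := fun L => ℓ (Encodable.encode (d, L)) - d - 3 with hf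
  have hback : ∀ x, dd x = d → x = Encodable.encode (d, (Denumerable.ofNat (ℕ × List ℕ) x).2) := by
    intro x hx
    rw [← hx]
    exact (Denumerable.encode_ofNat (α := ℕ × List ℕ) x).symm
  have hm : ∀ x ∈ F, dd x = d → (∃ t, (b+(2*d+3), 0, f (Denumerable.ofNat (ℕ × List ℕ) x).2, t) ∈
      Wn u A D T (topQ b n0 d) (Denumerable.ofNat (ℕ × List ℕ) x).2 (Denumerable.ofNat (ℕ × List ℕ) x).2.length) ∧
      ℓ x = f (Denumerable.ofNat (ℕ × List ℕ) x).2 + d + 3 := by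
    intro x hx hxd
    obtain ⟨σ, hσ⟩ := h x hx
    obtain ⟨ℓ', t, h1, h2, -⟩ := mem_gL.1 hσ
    have e : f (Denumerable.ofNat (ℕ × List ℕ) x).2 = ℓ' := by
      rw [hf]; simp only
      rw [← hback x hxd, h2]
      change _ = d at hxd
      simp only [hdd] at hxd
      omega
    rw [e]
    rw [← hxd]
    exact ⟨⟨t, h1⟩, h2⟩
  have hsum : ∑ x ∈ F.filter (fun x => dd x = d), (1/2:ℝ)^ℓ x = ∑ L ∈ G, (1/2:ℝ)^(f L + d + 3) := by
    rw [hG, Finset.sum_image]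
    · refine Finset.sum_congr rfl fun x hx => ?_
      rw [Finset.mem_filter] at hx
      rw [(hm x hx.1 hx.2).2]
    · intro x hx y hy hxy
      simp only [Finset.coe_filter, Set.mem_setOf_eq] at hx hy
      simp only at hxy
      rw [hback x hx.2, hback y hy.2, hxy]
  rw [hsum]
  have h5 := H.call_sum (b+(2*d+3)) (cc (b+(2*d+3))) 0 (n0 + (b+(2*d+3))) G f (by
    intro L hL
    rw [hG, Finset.mem_image] at hL
    obtain ⟨x, hx, rfl⟩ := hL
    rw [Finset.mem_filter] at hx
    exact (hm x hx.1 hx.2).1)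
  have h6 := one_add_pow_le (cc (b+(2*d+3)))
  calc ∑ L ∈ G, (1/2:ℝ)^(f L + d + 3) = (1/2)^(d+3) * ∑ L ∈ G, (1/2:ℝ)^(f L) := by
        rw [Finset.mul_sum]
        refine Finset.sum_congr rfl fun L _ => ?_
        rw [← pow_add]; congr 1; ring
    _ ≤ (1/2)^(d+3) * 4 := by
        gcongr
        rw [pow_zero, one_mul] at h5
        exact h5.trans h6
    _ = (1/2)^(d+1) := by rw [show d+3 = d+1+2 by ring, pow_add _ (d+1)]; ring

theorem Ctx.not_noGap (H : Ctx U u X Y A D T) (hU : OptimalPF U) (hX : ¬ KTrivialSeq U X) (hY : ¬ KTrivialSeq U Y)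
    (b n0 : ℕ) : ¬ NoGap u A D b n0 := by
  intro hN
  obtain ⟨d, hd⟩ := kc_opt_part hU (H.pa_gL b n0) (H.sum_gL b n0)
  have ha : Adm u A D T n0 (b+(2*d+3)) (2*d+3) (cc (b+(2*d+3))) 0 (n0 + (b+(2*d+3))) := by
    refine ⟨by omega, by omega, fun L ℓ' t' hL => ?_⟩
    have h1 := hd (Encodable.encode (d, L)) (ℓ' + d + 3) (zeroStr (2^(t'+1))) (by
      rw [mem_gL, Denumerable.ofNat_encode]
      exact ⟨ℓ', t', hL, rfl, rfl⟩)
    obtain ⟨j, j1, j2, j3⟩ := H.hu.zprog h1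
    exact ⟨j, j1, j2, by omega⟩
  obtain ⟨t1, ht1⟩ := H.term hU hX hY hN _ _ _ ha
  exact H.no_top ht1

theorem exists_gap (hU : OptimalPF U) (hu : UE U u) (hA : Apx X A) (hD : Apx Y D) (hX : ¬ KTrivialSeq U X) 
    (hY : ¬ KTrivialSeq U Y) (b : ℕ) : ∃ n, ∃ Γ : Finset ℕ, Set.InjOn (sl u) Γ ∧ 
  (∀ x ∈ Γ, zs u x = true ∧ 2^(n+1) ≤ sl u x) ∧ (2:ℝ)^b ≤ (∑ x ∈ Γ, wt u x) * 2^n ∧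
  ∀ᶠ s in atTop, mR u A s (2^n) + mR u D s (2^n) < (1/2:ℝ)^b * (∑ x ∈ Γ, wt u x) := by
  obtain ⟨T, hT, hT'⟩ := exists_T hu.pr hA.pr hD.pr
  have H : Ctx U u X Y A D T := ⟨hu, hA, hD, hT, hT'⟩
  have := H.not_noGap hU hX hY b 0
  unfold NoGap at this
  push Not at this
  obtain ⟨n, -, Γ, h1, h2, h3, h4⟩ := this
  exact ⟨n, Γ, h1, h2, h3, by simpa using h4⟩
end sem


/-! ### construction of the common lower bound -/
def cd (κ : ℕ) : ℕ × ℕ × List ℕ := Denumerable.ofNat (ℕ × ℕ × List ℕ) κ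
@[fun_prop] theorem pr_cd {γ : Type} [Primcodable γ] {k : γ → ℕ} (hk : Primrec k) : Primrec fun x => cd (k x) :=
  (Primrec.ofNat (ℕ × ℕ × List ℕ)).comp hk

abbrev Hs := List (Option ℕ)
def inBlk (n : ℕ) (o : Option ℕ) : Bool := o.elim false fun κ => decide ((cd κ).2.1 = n)
def cntB (h : Hs) (n : ℕ) : ℕ := (h.filter fun o => inBlk n o).length
def xb (h : Hs) (i : ℕ) : Bool := 
  (List.range (i+1)).any fun n => decide (2^n ≤ i) && (decide (i < 2^n + cntB h n) && decide (i < 2^(n+1)))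
def xstr (h : Hs) (n : ℕ) : Str := restrSeq (xb h) n

section
variable {γ : Type} [Primcodable γ] {h : γ → Hs} {n : γ → ℕ} {o : γ → Option ℕ}
@[fun_prop] theorem pr_inBlk (hn : Primrec n) (ho : Primrec o) : Primrec fun x => inBlk (n x) (o x) := by unfold inBlk; fun_prop
@[fun_prop] theorem pr_cntB (hh : Primrec h) (hn : Primrec n) : Primrec fun x => cntB (h x) (n x) := by unfold cntB; fun_prop
@[fun_prop] theorem pr_xb (hh : Primrec h) (hn : Primrec n) : Primrec fun x => xb (h x) (n x) := by unfold xb; fun_prop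
@[fun_prop] theorem pr_xstr (hh : Primrec h) (hn : Primrec n) : Primrec fun x => xstr (h x) (n x) := by unfold xstr; fun_prop
end

section defs
variable (u : ℕ → Option (Str × Str)) (A D : ℕ → ℕ → Bool)
def memB (G : List ℕ) (t : ℕ) : Bool := G.any fun x => decide (x = t)
def GN (s : ℕ) (G : List ℕ) : ℕ := ∑ t ∈ Finset.range s, bif memB G t then 2^(s - pl u t) else 0
def okB (s n : ℕ) (G : List ℕ) : Bool := G.all fun t => decide (t < s) && (zs u t && decide (2^(n+1) ≤ sl u t))
def injB (G : List ℕ) : Bool := G.all fun t => G.all fun t' => decide (t = t') || !decide (sl u t = sl u t')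
def progB (σ : Str) (k t : ℕ) : Bool := (ap1 u t).elim false fun p => decide (p.2 = σ) && decide (p.1.length ≤ k)
def paidB (h : Hs) (e t : ℕ) : Bool := (List.range h.length).any fun t' => progB u (xstr h (sl u t)) (pl u t + e) t'
def bigB (s e n : ℕ) (G : List ℕ) : Bool := decide (2^(e+1) * 2^s ≤ GN u s G * 2^n)
def lowB (s e n : ℕ) (G : List ℕ) : Bool := decide ((mN u A s (2^n) + mN u D s (2^n)) * 2^e ≤ GN u s G)
def valB (h : Hs) (κ : ℕ) : Bool :=
  okB u h.length (cd κ).2.1 (cd κ).2.2 && (injB u (cd κ).2.2 && (bigB u h.length (cd κ).1 (cd κ).2.1 (cd κ).2.2 &&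
    (lowB u A D h.length (cd κ).1 (cd κ).2.1 (cd κ).2.2 && 
      (((cd κ).2.2.all fun t => paidB u h (cd κ).1 t) && decide (cntB h (cd κ).2.1 < 2^(cd κ).2.1)))))
def evS (h : Hs) : Option ℕ := (List.range h.length).find? fun κ => valB u A D h κ
def hs (s : ℕ) : Hs := hist (evS u A D) s
def ev (s : ℕ) : Option ℕ := evS u A D (hs u A D s)
def XS (s i : ℕ) : Bool := xb (hs u A D s) i

variable {u A D} [PR1 u] [PR2 A] [PR2 D] {γ : Type} [Primcodable γ] {h : γ → Hs} {s e n t k : γ → ℕ} {G : γ → List ℕ}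
  {σ : γ → Str}
@[fun_prop] theorem pr_memB (hG : Primrec G) (ht : Primrec t) : Primrec fun x => memB (G x) (t x) := by unfold memB; fun_prop
@[fun_prop] theorem pr_GN (hs : Primrec s) (hG : Primrec G) : Primrec fun x => GN u (s x) (G x) := by unfold GN; fun_prop
@[fun_prop] theorem pr_okB (hs : Primrec s) (hn : Primrec n) (hG : Primrec G) : Primrec fun x => okB u (s x) (n x) (G x) := by
  unfold okB; fun_prop
@[fun_prop] theorem pr_injB (hG : Primrec G) : Primrec fun x => injB u (G x) := by unfold injB; fun_prop
@[fun_prop] theorem pr_progB (hG : Primrec σ) (hk : Primrec k) (ht : Primrec t) : Primrec fun x => progB u (σ x) (k x) (t x) := by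
  unfold progB; fun_prop
@[fun_prop] theorem pr_paidB (hh : Primrec h) (he : Primrec e) (ht : Primrec t) : Primrec fun x => paidB u (h x) (e x) (t x) := by 
  unfold paidB; fun_prop
@[fun_prop] theorem pr_bigB (hs : Primrec s) (he : Primrec e) (hn : Primrec n) (hG : Primrec G) : 
    Primrec fun x => bigB u (s x) (e x) (n x) (G x) := by unfold bigB; fun_prop
@[fun_prop] theorem pr_lowB (hs : Primrec s) (he : Primrec e) (hn : Primrec n) (hG : Primrec G) : 
    Primrec fun x => lowB u A D (s x) (e x) (n x) (G x) := by unfold lowB; fun_prop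
@[fun_prop] theorem pr_valB (hh : Primrec h) (hk : Primrec k) : Primrec fun x => valB u A D (h x) (k x) := by
  unfold valB; fun_prop
@[fun_prop] theorem pr_evS (hh : Primrec h) : Primrec fun x => evS u A D (h x) := by unfold evS; fun_prop
@[fun_prop] theorem pr_hs (hs0 : Primrec s) : Primrec fun x => hs u A D (s x) := by
  have h1 : Primrec fun h => evS u A D h := by fun_prop
  exact (pr_hist h1).comp hs0
@[fun_prop] theorem pr_ev (hs : Primrec s) : Primrec fun x => ev u A D (s x) := by unfold ev; fun_prop
@[fun_prop] theorem pr_XS (hs : Primrec s) (hn : Primrec n) : Primrec fun x => XS u A D (s x) (n x) := by unfold XS; fun_prop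
end defs

section cons
variable {U : Str →. Str} {u : ℕ → Option (Str × Str)} {A D : ℕ → ℕ → Bool}

theorem hs_length (s : ℕ) : (hs u A D s).length = s := hist_length _ _
theorem hs_succ (s : ℕ) : hs u A D (s+1) = hs u A D s ++ [ev u A D s] := rfl

variable (u A D) in
def cnt (s n : ℕ) : ℕ := cntB (hs u A D s) n

theorem cnt_succ (s n : ℕ) : cnt u A D (s+1) n = cnt u A D s n + if inBlk n (ev u A D s) = true then 1 else 0 := by
  unfold cnt cntB
  rw [hs_succ, List.filter_append, List.length_append]
  congr 1
  rcases h : inBlk n (ev u A D s) with _ | _ <;> simp [h]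

theorem cnt_mono {s s' n : ℕ} (h : s ≤ s') : cnt u A D s n ≤ cnt u A D s' n := by
  induction s', h using Nat.le_induction with
  | base => rfl
  | succ s' h ih => rw [cnt_succ]; omega

theorem XS_iff {s i : ℕ} : XS u A D s i = true ↔ ∃ n, 2^n ≤ i ∧ i < 2^n + cnt u A D s n ∧ i < 2^(n+1) := by
  unfold XS xb cnt
  simp only [List.any_eq_true, Bool.and_eq_true, decide_eq_true_eq, List.mem_range]
  exact ⟨fun ⟨n, _, h⟩ => ⟨n, h⟩, fun ⟨n, h⟩ => ⟨n, by have := @Nat.lt_two_pow_self n; omega, h⟩⟩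

theorem XS_mono {s s' i : ℕ} (h : s ≤ s') (hx : XS u A D s i = true) : XS u A D s' i = true := by
  rw [XS_iff] at hx ⊢
  obtain ⟨n, h1, h2, h3⟩ := hx
  exact ⟨n, h1, h2.trans_le (by have := cnt_mono (u := u) (A := A) (D := D) (n := n) h; omega), h3⟩

theorem blk_unique {n m i : ℕ} (h1 : 2^n ≤ i) (h2 : i < 2^(n+1)) (h3 : 2^m ≤ i) (h4 : i < 2^(m+1)) : n = m := by
  have a : n < m + 1 := (Nat.pow_lt_pow_iff_right (by norm_num : 1 < 2)).1 (h1.trans_lt h4)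
  have b : m < n + 1 := (Nat.pow_lt_pow_iff_right (by norm_num : 1 < 2)).1 (h3.trans_lt h2)
  omega

variable (u A D) in
noncomputable def Gs (κ : ℕ) : Finset ℕ := (cd κ).2.2.toFinset

variable (u A D) in
structure Val (s κ : ℕ) : Prop where
  ok : ∀ t ∈ Gs κ, t < s ∧ zs u t = true ∧ 2^((cd κ).2.1+1) ≤ sl u t
  inj : Set.InjOn (sl u) (Gs κ)
  big : (2:ℝ)^((cd κ).1+1) ≤ (∑ t ∈ Gs κ, wt u t) * 2^(cd κ).2.1
  low : mR u A s (2^(cd κ).2.1) + mR u D s (2^(cd κ).2.1) ≤ (1/2:ℝ)^(cd κ).1 * ∑ t ∈ Gs κ, wt u t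
  paid : ∀ t ∈ Gs κ, ∃ t' < s, ∃ ρ, u t' = Option.some (ρ, restrSeq (XS u A D s) (sl u t)) ∧ pl u t' ≤ pl u t + (cd κ).1
  cap : cnt u A D s (cd κ).2.1 < 2^(cd κ).2.1

theorem progB_iff {σ : Str} {k t : ℕ} : progB u σ k t = true ↔ ∃ ρ, u t = Option.some (ρ, σ) ∧ pl u t ≤ k := by
  unfold progB pl ap1
  rcases h : u t with _ | ⟨ρ, σ'⟩
  · simp
  · simp only [Option.elim, Option.some.injEq, Prod.mk.injEq, Bool.and_eq_true]
    exact ⟨fun h => ⟨ρ, ⟨rfl, of_decide_eq_true h.1⟩, of_decide_eq_true h.2⟩, 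
      fun ⟨_, h, h'⟩ => ⟨decide_eq_true h.2, decide_eq_true h'⟩⟩

theorem GN_eq (hu : UE U u) {s : ℕ} {G : List ℕ} (h : ∀ t ∈ G, t < s ∧ zs u t = true) : 
    (GN u s G : ℝ) = 2^s * ∑ t ∈ G.toFinset, wt u t := by
  unfold GN
  have e : G.toFinset = (Finset.range s).filter fun t => memB G t = true := by
    ext t
    simp only [List.mem_toFinset, Finset.mem_filter, Finset.mem_range, memB, List.any_eq_true, decide_eq_true_eq, exists_eq_right]
    exact ⟨fun h' => ⟨(h t h').1, h'⟩, fun h' => h'.2⟩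
  rw [e, Finset.mul_sum, Finset.sum_filter]
  push_cast
  refine Finset.sum_congr rfl fun t ht => ?_
  rcases hm : memB G t with _ | _
  · simp
  · have hz : t ∈ G := by simpa [memB] using hm
    simp only [cond_true, if_true]
    push_cast
    exact pow_wt (h t hz).2 ((hu.pl_le t).trans (h t hz).1.le)

theorem val_iff (hu : UE U u) {s κ : ℕ} : valB u A D (hs u A D s) κ = true ↔ Val u A D s κ := by
  unfold valB
  simp only [Bool.and_eq_true, hs_length]
  have h1 : okB u s (cd κ).2.1 (cd κ).2.2 = true ↔ ∀ t ∈ Gs κ, t < s ∧ zs u t = true ∧ 2^((cd κ).2.1+1) ≤ sl u t := by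
    unfold okB Gs
    simp only [List.all_eq_true, Bool.and_eq_true, decide_eq_true_eq, List.mem_toFinset]
  have h2 : injB u (cd κ).2.2 = true ↔ Set.InjOn (sl u) (Gs κ) := by
    unfold injB Gs
    simp only [List.all_eq_true, Bool.or_eq_true, Bool.not_eq_true', decide_eq_true_eq, decide_eq_false_iff_not]
    constructor
    · intro h t ht t' ht' e
      simp only [List.coe_toFinset, Set.mem_setOf_eq] at ht ht'
      exact (h t ht t' ht').resolve_right fun h => h e
    · intro h t ht t' ht'
      by_cases e : sl u t = sl u t'
      · exact Or.inl (h (by simpa using ht) (by simpa using ht') e)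
      · exact Or.inr e
  have hG : (∀ t ∈ Gs κ, t < s ∧ zs u t = true ∧ 2^((cd κ).2.1+1) ≤ sl u t) → 
      (GN u s (cd κ).2.2 : ℝ) = 2^s * ∑ t ∈ Gs κ, wt u t := fun h => 
    GN_eq hu fun t ht => ⟨(h t (List.mem_toFinset.2 ht)).1, (h t (List.mem_toFinset.2 ht)).2.1⟩
  have h3 : (∀ t ∈ Gs κ, t < s ∧ zs u t = true ∧ 2^((cd κ).2.1+1) ≤ sl u t) → 
      (bigB u s (cd κ).1 (cd κ).2.1 (cd κ).2.2 = true ↔ 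
        (2:ℝ)^((cd κ).1+1) ≤ (∑ t ∈ Gs κ, wt u t) * 2^(cd κ).2.1) := by
    intro h
    unfold bigB
    rw [decide_eq_true_iff, ← Nat.cast_le (α := ℝ)]
    push_cast
    rw [hG h, mul_comm, mul_assoc]
    exact mul_le_mul_iff_right₀ (by positivity)
  have h4 : (∀ t ∈ Gs κ, t < s ∧ zs u t = true ∧ 2^((cd κ).2.1+1) ≤ sl u t) → 
      (lowB u A D s (cd κ).1 (cd κ).2.1 (cd κ).2.2 = true ↔ 
        mR u A s (2^(cd κ).2.1) + mR u D s (2^(cd κ).2.1) ≤ (1/2:ℝ)^(cd κ).1 * ∑ t ∈ Gs κ, wt u t) := by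
    intro h
    unfold lowB
    rw [decide_eq_true_iff, ← Nat.cast_le (α := ℝ)]
    push_cast
    rw [hG h, hu.mN_eq, hu.mN_eq, ← mul_add, mul_assoc, mul_le_mul_iff_right₀ (by positivity), one_div, inv_pow,
      inv_mul_eq_div, le_div_iff₀ (by positivity)]
  have h5 : ((cd κ).2.2.all fun t => paidB u (hs u A D s) (cd κ).1 t) = true ↔ 
      ∀ t ∈ Gs κ, ∃ t' < s, ∃ ρ, u t' = Option.some (ρ, restrSeq (XS u A D s) (sl u t)) ∧ pl u t' ≤ pl u t + (cd κ).1 := by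
    unfold Gs paidB
    simp only [List.all_eq_true, List.any_eq_true, List.mem_range, List.mem_toFinset, hs_length, progB_iff]
    rfl
  rw [decide_eq_true_iff]
  constructor
  · rintro ⟨a1, a2, a3, a4, a5, a6⟩
    have a1' := h1.1 a1
    exact ⟨a1', h2.1 a2, (h3 a1').1 a3, (h4 a1').1 a4, h5.1 a5, a6⟩
  · rintro ⟨a1, a2, a3, a4, a5, a6⟩
    exact ⟨h1.2 a1, h2.2 a2, (h3 a1).2 a3, (h4 a1).2 a4, h5.2 a5, a6⟩

theorem ev_val (hu : UE U u) {s κ : ℕ} (h : ev u A D s = Option.some κ) : Val u A D s κ :=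
  (val_iff hu).1 (List.find?_some h)

theorem val_ev (hu : UE U u) {s κ : ℕ} (h : Val u A D s κ) (hk : κ < s) : ∃ κ' ≤ κ, ev u A D s = Option.some κ' := by
  have h' := (val_iff hu).2 h
  unfold ev evS
  rw [hs_length]
  rcases hf : (List.range s).find? (fun κ => valB u A D (hs u A D s) κ) with _ | κ'
  · rw [List.find?_eq_none] at hf
    exact absurd h' (hf κ (by simpa using hk))
  · refine ⟨κ', ?_, rfl⟩
    rw [List.find?_range_eq_some] at hf
    by_contra hh
    have := hf.2.2 κ (by omega)
    rw [h'] at this; simp at this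

/-- an event changes the real below `2^(n+1)` -/
theorem ev_change (hu : UE U u) {s s' m κ : ℕ} (h : ev u A D s = Option.some κ) (hs : s < s') (hm : 2^((cd κ).2.1+1) ≤ m) :
    restrSeq (XS u A D s) m ≠ restrSeq (XS u A D s') m := by
  intro he
  have v := (ev_val hu h).cap
  set n := (cd κ).2.1 with hn
  set i := 2^n + cnt u A D s n with hi
  have hi2 : i < 2^(n+1) := by rw [pow_succ]; omega
  have h1 : XS u A D s' i = true := by
    refine XS_mono (s := s+1) hs (XS_iff.2 ⟨n, by omega, ?_, hi2⟩)
    rw [cnt_succ, if_pos (by simp [inBlk, h, hn])]; omega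
  have h2 : XS u A D s i ≠ true := by
    intro hc
    obtain ⟨n', b1, b2, b3⟩ := XS_iff.1 hc
    obtain rfl := blk_unique b1 b3 (by omega : 2^n ≤ i) hi2
    omega
  exact h2 ((restr_eq_iff.1 he i (by omega)).trans h1)

/-- nothing below `m` changes unless there is an event in a low block -/
theorem no_change {s m : ℕ} (h : ∀ κ, ev u A D s = Option.some κ → m ≤ 2^(cd κ).2.1) :
    restrSeq (XS u A D (s+1)) m = restrSeq (XS u A D s) m := by
  rw [restr_eq_iff]
  intro i hi
  have h1 : XS u A D (s+1) i = true → XS u A D s i = true := by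
    intro hx
    obtain ⟨n, b1, b2, b3⟩ := XS_iff.1 hx
    refine XS_iff.2 ⟨n, b1, ?_, b3⟩
    rw [cnt_succ] at b2
    rcases hh : inBlk n (ev u A D s) with _ | _
    · rw [hh] at b2; simpa using b2
    · rcases he : ev u A D s with _ | κ
      · rw [he] at hh; simp [inBlk] at hh
      · have := h κ he
        rw [he] at hh; simp [inBlk] at hh
        rw [hh] at this; omega
  have h2 : XS u A D s i = true → XS u A D (s+1) i = true := XS_mono (by omega)
  exact Bool.eq_iff_iff.2 ⟨h1, h2⟩

variable (u A D) in
noncomputable def evG (s : ℕ) : Finset ℕ := (ev u A D s).elim ∅ Gs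
variable (u A D) in
noncomputable def evE (s : ℕ) : ℕ := (ev u A D s).elim 0 fun κ => (cd κ).1

theorem pay_sum (hu : UE U u) (F : Finset ℕ) : ∑ s ∈ F, ∑ t ∈ evG u A D s, (1/2:ℝ)^(evE u A D s) * wt u t ≤ 1 := by
  have hw : ∀ s t, t ∈ evG u A D s → ∃ t' ρ, u t' = Option.some (ρ, restrSeq (XS u A D s) (sl u t)) ∧ 
      pl u t' ≤ pl u t + evE u A D s := by
    intro s t ht
    unfold evG at ht
    rcases h : ev u A D s with _ | κ
    · rw [h] at ht; simp at ht
    · rw [h] at ht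
      obtain ⟨t', -, ρ, h1, h2⟩ := (ev_val hu h).paid t ht
      exact ⟨t', ρ, h1, by simpa [evE, h] using h2⟩
  choose! w ρ hw1 hw2 using hw
  rw [Finset.sum_sigma']
  have hinj : Set.InjOn (fun x : (_ : ℕ) × ℕ => w x.1 x.2) (F.sigma fun s => evG u A D s) := by
    have key : ∀ s t s' t', t ∈ evG u A D s → t' ∈ evG u A D s' → s < s' → w s t ≠ w s' t' := by
      intro s t s' t' ht ht' hs he
      have h1 := hw1 s t ht
      have h2 := hw1 s' t' ht'
      rw [he, h2] at h1
      simp only [Option.some.injEq, Prod.mk.injEq] at h1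
      have e1 : sl u t' = sl u t := by have := congrArg List.length h1.2; simpa using this
      rw [e1] at h1
      unfold evG at ht
      rcases h : ev u A D s with _ | κ
      · rw [h] at ht; simp at ht
      · rw [h] at ht
        exact ev_change hu h hs ((ev_val hu h).ok t ht).2.2 h1.2.symm
    rintro ⟨s, t⟩ hx ⟨s', t'⟩ hy he
    simp only [Finset.coe_sigma, Set.mem_sigma_iff, Finset.mem_coe] at hx hy
    simp only at he
    rcases lt_trichotomy s s' with hlt | rfl | hlt
    · exact absurd he (key _ _ _ _ hx.2 hy.2 hlt)
    · have h1 := hw1 s t hx.2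
      have h2 := hw1 s t' hy.2
      rw [he, h2] at h1
      simp only [Option.some.injEq, Prod.mk.injEq] at h1
      have e1 : sl u t' = sl u t := by have := congrArg List.length h1.2; simpa using this
      have ht := hx.2
      have ht' := hy.2
      unfold evG at ht ht'
      rcases h : ev u A D s with _ | κ
      · rw [h] at ht; simp at ht
      · rw [h] at ht ht'
        have : t' = t := (ev_val hu h).inj ht' ht e1
        rw [this]
    · exact absurd he.symm (key _ _ _ _ hy.2 hx.2 hlt)
  refine le_trans (Finset.sum_le_sum (g := fun x => wt u (w x.1 x.2)) ?_) ?_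
  · rintro ⟨s, t⟩ hx
    have ht := (Finset.mem_sigma.1 hx).2
    simp only at ht ⊢
    have hz : zs u t = true := by
      unfold evG at ht
      rcases h : ev u A D s with _ | κ
      · rw [h] at ht; simp at ht
      · rw [h] at ht; exact ((ev_val hu h).ok t ht).2.1
    rw [zs_wt hz, wt_eq (hw1 s t ht), ← pow_add]
    exact pow_le_pow_of_le_one (by norm_num) (by norm_num) (by have := hw2 s t ht; omega)
  · rw [← Finset.sum_image (f := fun t => wt u t) hinj]
    exact hu.kraft _

variable (u A D) in
noncomputable def pay (s : ℕ) : ℝ := ∑ t ∈ evG u A D s, (1/2:ℝ)^(evE u A D s) * wt u t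

theorem pay_nonneg (s : ℕ) : 0 ≤ pay u A D s := Finset.sum_nonneg fun t _ => mul_nonneg (by positivity) (wt_nonneg _)

theorem pay_eq {s κ : ℕ} (h : ev u A D s = Option.some κ) : pay u A D s = (1/2:ℝ)^(cd κ).1 * ∑ t ∈ Gs κ, wt u t := by
  unfold pay evE evG
  rw [h, Finset.mul_sum]; rfl

theorem pay_ge (hu : UE U u) {s κ : ℕ} (h : ev u A D s = Option.some κ) : 2 * (1/2:ℝ)^(cd κ).2.1 ≤ pay u A D s := by
  rw [pay_eq h]
  have := (ev_val hu h).big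
  rw [one_div, inv_pow, inv_pow, inv_mul_eq_div, le_div_iff₀ (by positivity), mul_assoc, mul_comm, mul_assoc, 
    inv_mul_eq_div, div_le_iff₀ (by positivity)]
  rw [pow_succ] at this
  linarith

theorem cnt_le (hu : UE U u) (s n : ℕ) : 2 * cnt u A D s n ≤ 2^n := by
  have h1 : ∀ s, (cnt u A D s n : ℝ) * (2 * (1/2:ℝ)^n) ≤ ∑ s' ∈ Finset.range s, pay u A D s' := by
    intro s
    induction s with
    | zero => simp [cnt, cntB, hs, hist]
    | succ s ih =>
      rw [cnt_succ, Finset.sum_range_succ]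
      rcases h : inBlk n (ev u A D s) with _ | _
      · have := pay_nonneg (u := u) (A := A) (D := D) s
        simp only [Bool.false_eq_true, if_false, add_zero]
        linarith
      · rcases he : ev u A D s with _ | κ
        · rw [he] at h; simp [inBlk] at h
        · rw [he] at h; simp [inBlk] at h
          have := pay_ge hu he
          rw [h] at this
          simp only [if_true]
          push_cast
          linarith
  have h2 := (h1 s).trans (pay_sum hu (Finset.range s))
  have h3 : (2:ℝ)^n * (1/2)^n = 1 := by rw [← mul_pow]; norm_num
  have h4 : 0 < (2:ℝ)^n := by positivity
  have : (2 * cnt u A D s n : ℝ) ≤ 2^n := by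
    calc (2 * cnt u A D s n : ℝ) = 2^n * (cnt u A D s n * (2 * (1/2:ℝ)^n)) := by linear_combination (-2 * cnt u A D s n : ℝ) * h3
      _ ≤ 2^n * 1 := by gcongr
      _ = 2^n := mul_one _
  exact_mod_cast this

end cons

section cons
variable {U : Str →. Str} {u : ℕ → Option (Str × Str)} {A D : ℕ → ℕ → Bool}

variable (u A D) in
noncomputable def XL (i : ℕ) : Bool := decide (∃ s, XS u A D s i = true)

theorem XL_iff {i : ℕ} : XL u A D i = true ↔ ∃ s, XS u A D s i = true := by unfold XL; exact decide_eq_true_iff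

theorem XL_ce [PR1 u] [PR2 A] [PR2 D] : CEReal (XL u A D) := by
  refine ceReal_of_ce (a := XS u A D) ?_ (fun s t i h1 h2 => XS_mono h1 h2) fun i => XL_iff
  fun_prop

theorem XL_lim (m : ℕ) : ∃ S, ∀ s ≥ S, restrSeq (XS u A D s) m = restrSeq (XL u A D) m := by
  induction m with
  | zero => exact ⟨0, fun s _ => by simp [restrSeq]⟩
  | succ m ih =>
    obtain ⟨S, hS⟩ := ih
    have : ∃ S', ∀ s ≥ S', XS u A D s m = XL u A D m := by
      by_cases h : ∃ s, XS u A D s m = true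
      · obtain ⟨s0, h0⟩ := h
        exact ⟨s0, fun s hs => by rw [XS_mono hs h0, XL_iff.2 ⟨s0, h0⟩]⟩
      · refine ⟨0, fun s _ => ?_⟩
        refine Bool.eq_iff_iff.2 ⟨fun hh => absurd ⟨s, hh⟩ h, fun hh => absurd (XL_iff.1 hh) h⟩
    obtain ⟨S', hS'⟩ := this
    refine ⟨max S S', fun s hs => ?_⟩
    have h1 := restr_eq_iff.1 (hS s (le_trans (le_max_left _ _) hs))
    rw [restr_eq_iff]
    intro i hi
    rcases Nat.lt_succ_iff_lt_or_eq.1 hi with hi | rfl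
    · exact h1 i hi
    · exact hS' s (le_trans (le_max_right _ _) hs)

/-! #### not trivial -/
theorem XL_nontriv {X Y : ℕ → Bool} (hU : OptimalPF U) (hu : UE U u) (hA : Apx X A) (hD : Apx Y D) (hX : ¬ KTrivialSeq U X)
    (hY : ¬ KTrivialSeq U Y) : ¬ KTrivialSeq U (XL u A D) := by
  rintro ⟨e, he⟩
  obtain ⟨n, Γ, g1, g2, g3, g4⟩ := exists_gap hU hu hA hD hX hY (e+1)
  set κ := Encodable.encode ((e, n, Γ.toList) : ℕ × ℕ × List ℕ) with hκ
  have hcd : cd κ = (e, n, Γ.toList) := by unfold cd; rw [hκ, Denumerable.ofNat_encode]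
  have hGs : Gs κ = Γ := by unfold Gs; rw [hcd]; simp
  have hpaid : ∀ t ∈ Γ, ∃ t' ρ, u t' = Option.some (ρ, restrSeq (XL u A D) (sl u t)) ∧ pl u t' ≤ pl u t + e := by
    intro t ht
    obtain ⟨ρ, h1⟩ := zs_iff.1 (g2 t ht).1
    have h2 := hu.KC_le h1
    have h3 : KC U (restrSeq (XL u A D) (sl u t)) ≤ (pl u t + e : ℕ) := by
      refine (he _).trans ?_
      push_cast
      gcongr
    obtain ⟨t', ρ', h4, h5⟩ := hu.prog h3
    exact ⟨t', ρ', h4, by simpa [pl, ap1, h4] using h5⟩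
  have hev : ∀ t ∈ Γ, ∀ᶠ s in atTop, t < s ∧ ∃ t' < s, ∃ ρ, u t' = Option.some (ρ, restrSeq (XS u A D s) (sl u t)) ∧ 
      pl u t' ≤ pl u t + e := by
    intro t ht
    obtain ⟨t', ρ, h1, h2⟩ := hpaid t ht
    obtain ⟨S, hS⟩ := XL_lim (u := u) (A := A) (D := D) (sl u t)
    filter_upwards [eventually_gt_atTop t, eventually_gt_atTop t', eventually_ge_atTop S] with s a1 a2 a3
    exact ⟨a1, t', a2, ρ, by rw [h1, hS s a3], h2⟩
  have hev' := (Filter.eventually_all_finset Γ).2 hev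
  have hval : ∀ᶠ s in atTop, Val u A D s κ := by
    filter_upwards [hev', g4] with s h1 h2
    refine ⟨?_, ?_, ?_, ?_, ?_, ?_⟩
    · rw [hGs, hcd]; exact fun t ht => ⟨(h1 t ht).1, g2 t ht⟩
    · rw [hGs]; exact g1
    · rw [hGs, hcd]; exact g3
    · rw [hGs, hcd]
      refine h2.le.trans ?_
      have : 0 ≤ ∑ t ∈ Γ, wt u t := Finset.sum_nonneg fun t _ => wt_nonneg _
      exact mul_le_mul_of_nonneg_right (pow_le_pow_of_le_one (by norm_num) (by norm_num) (by omega)) this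
    · rw [hGs, hcd]; exact fun t ht => (h1 t ht).2
    · have h5 := cnt_le (A := A) (D := D) hu s (cd κ).2.1
      have : 0 < 2^(cd κ).2.1 := by positivity
      omega
  obtain ⟨S, hS⟩ := eventually_atTop.1 (hval.and (eventually_gt_atTop κ))
  set N := (Finset.range (κ+1)).sup fun κ' => (cd κ').2.1 with hN
  have hpay : ∀ s ≥ S, (1/2:ℝ)^N ≤ pay u A D s := by
    intro s hs
    obtain ⟨κ', hk, hk'⟩ := val_ev hu (hS s hs).1 (hS s hs).2
    refine le_trans ?_ (pay_ge hu hk')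
    have h1 : (cd κ').2.1 ≤ N := Finset.le_sup (f := fun κ' => (cd κ').2.1) (Finset.mem_range.2 (by omega))
    have h2 : (1/2:ℝ)^N ≤ (1/2:ℝ)^(cd κ').2.1 := pow_le_pow_of_le_one (by norm_num) (by norm_num) h1
    have : 0 < (1/2:ℝ)^(cd κ').2.1 := by positivity
    linarith
  have h1 := pay_sum (A := A) (D := D) hu (Finset.Ico S (S + (2^N+1)))
  have h2 : ∑ s ∈ Finset.Ico S (S + (2^N+1)), (1/2:ℝ)^N ≤ 1 := 
    (Finset.sum_le_sum fun s hs => hpay s (Finset.mem_Ico.1 hs).1).trans h1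
  rw [Finset.sum_const, Nat.card_Ico, Nat.add_sub_cancel_left, nsmul_eq_mul] at h2
  push_cast at h2
  have h3 : (2:ℝ)^N * (1/2)^N = 1 := by rw [← mul_pow]; norm_num
  have : 0 < (1/2:ℝ)^N := by positivity
  nlinarith

/-! #### below both -/
section red
variable (u A D)
variable (Z : ℕ → ℕ → Bool)
def newB (t s : ℕ) : Bool := !(decide (t < s) && cur u Z s t)
def hitB (t s : ℕ) : Bool := (ev u A D s).elim false fun κ => decide (2^(cd κ).2.1 ≤ sl u t)
def reqB (t s : ℕ) : Bool := decide (t ≤ s) && (cur u Z (s+1) t && (newB u Z t s || hitB u A D t s))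
def reqX (x : ℕ) : Option (ℕ × Str) := 
  bif reqB u A D Z x.unpair.1 x.unpair.2 then 
    Option.some (pl u x.unpair.1 + 1, xstr (hs u A D (x.unpair.2+1)) (sl u x.unpair.1)) else Option.none

theorem pr_reqX [PR1 u] [PR2 A] [PR2 D] [PR2 Z] : Primrec (reqX u A D Z) := by
  have h1 : Primrec fun x : ℕ × ℕ => newB u Z x.1 x.2 := by unfold newB; fun_prop
  have h2 : Primrec fun x : ℕ × ℕ => hitB u A D x.1 x.2 := by unfold hitB; fun_prop
  have h3 : Primrec fun x : ℕ × ℕ => reqB u A D Z x.1 x.2 := by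
    unfold reqB; fun_prop
  have h4 : Primrec fun x : ℕ => reqB u A D Z x.unpair.1 x.unpair.2 := h3.comp Primrec.unpair
  unfold reqX
  exact pr_cond h4 (by fun_prop) (by fun_prop)
end red

variable {Z : ℕ → ℕ → Bool} {Y : ℕ → Bool}

theorem new_sum (hu : UE U u) (hZ : Apx Y Z) (F : Finset (ℕ × ℕ)) 
    (hF : ∀ x ∈ F, x.1 ≤ x.2 ∧ cur u Z (x.2+1) x.1 = true ∧ newB u Z x.1 x.2 = true) : ∑ x ∈ F, wt u x.1 ≤ 1 := by
  have key : ∀ t s s', (t, s) ∈ F → (t, s') ∈ F → ¬ s < s' := by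
    intro t s s' h1 h2 hlt
    obtain ⟨a1, a2, -⟩ := hF _ h1
    obtain ⟨b1, b2, b3⟩ := hF _ h2
    simp only at a1 a2 b1 b2 b3
    have := cur_of_restr a2 (hZ.noret _ _ _ _ (by omega : s+1 ≤ s') (by omega : s' ≤ s'+1) (cur_restr a2 b2)).symm
    unfold newB at b3
    rw [this, decide_eq_true (by omega : t < s')] at b3
    simp at b3
  have hinj : Set.InjOn (fun x : ℕ × ℕ => x.1) F := by
    rintro ⟨t, s⟩ hx ⟨t', s'⟩ hy he
    simp only at he
    subst he
    have a := key _ _ _ hx hy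
    have b := key _ _ _ hy hx
    rw [show s = s' by omega]
  rw [← Finset.sum_image (f := fun t => wt u t) hinj]
  exact hu.kraft _

theorem hit_sum (hu : UE U u) (hle : ∀ s n, mR u Z s n ≤ mR u A s n + mR u D s n) (F : Finset (ℕ × ℕ)) 
    (hF : ∀ x ∈ F, x.1 < x.2 ∧ cur u Z x.2 x.1 = true ∧ hitB u A D x.1 x.2 = true) : ∑ x ∈ F, wt u x.1 ≤ 1 := by
  rw [← Finset.sum_fiberwise_of_maps_to (t := F.image Prod.snd) (g := Prod.snd) fun x hx => Finset.mem_image_of_mem _ hx]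
  refine le_trans (Finset.sum_le_sum fun s hs => ?_) (pay_sum (A := A) (D := D) hu (F.image Prod.snd))
  change _ ≤ pay u A D s
  obtain ⟨x, hx, rfl⟩ := Finset.mem_image.1 hs
  obtain ⟨-, -, h3⟩ := hF x hx
  unfold hitB at h3
  rcases he : ev u A D x.2 with _ | κ
  · rw [he] at h3; simp at h3
  rw [pay_eq he]
  refine le_trans ?_ ((hle _ _).trans (ev_val hu he).low)
  unfold mR
  have hinj : Set.InjOn (fun y : ℕ × ℕ => y.1) (F.filter fun y => y.2 = x.2) := by
    rintro ⟨t, s⟩ hx ⟨t', s'⟩ hy h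
    simp at hx hy h
    rw [h, hx.2, hy.2]
  rw [← Finset.sum_image (f := fun t => wt u t) hinj]
  refine Finset.sum_le_sum_of_subset_of_nonneg ?_ fun _ _ _ => wt_nonneg _
  intro t ht
  obtain ⟨y, hy, rfl⟩ := Finset.mem_image.1 ht
  rw [Finset.mem_filter] at hy
  obtain ⟨b1, b2, b3⟩ := hF y hy.1
  rw [hy.2] at b1 b2 b3
  unfold hitB at b3
  rw [he] at b3
  simp only [Option.elim, decide_eq_true_eq] at b3
  rw [Finset.mem_filter, Finset.mem_range]
  exact ⟨b1, b2, b3⟩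

theorem reqX_some {x ℓ : ℕ} {σ : Str} (h : reqX u A D Z x = Option.some (ℓ, σ)) : 
    reqB u A D Z x.unpair.1 x.unpair.2 = true ∧ ℓ = pl u x.unpair.1 + 1 := by
  unfold reqX at h
  rcases hb : reqB u A D Z x.unpair.1 x.unpair.2 with _ | _
  · rw [hb] at h; simp at h
  · rw [hb] at h
    simp only [cond_true, Option.some.injEq, Prod.mk.injEq] at h
    exact ⟨rfl, h.1.symm⟩

theorem req_sum (hu : UE U u) (hZ : Apx Y Z) (hle : ∀ s n, mR u Z s n ≤ mR u A s n + mR u D s n) (F : Finset (ℕ × ℕ)) 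
    (hF : ∀ x ∈ F, reqB u A D Z x.1 x.2 = true) : ∑ x ∈ F, wt u x.1 ≤ 2 := by
  have h1 : ∑ x ∈ F.filter (fun x => newB u Z x.1 x.2 = true), wt u x.1 ≤ 1 := by
    refine new_sum hu hZ _ fun x hx => ?_
    rw [Finset.mem_filter] at hx
    have := hF x hx.1
    unfold reqB at this
    simp only [Bool.and_eq_true, decide_eq_true_eq] at this
    exact ⟨this.1, this.2.1, hx.2⟩
  have h2 : ∑ x ∈ F.filter (fun x => ¬ newB u Z x.1 x.2 = true), wt u x.1 ≤ 1 := by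
    refine hit_sum hu hle _ fun x hx => ?_
    rw [Finset.mem_filter] at hx
    have h3 := hF x hx.1
    unfold reqB at h3
    simp only [Bool.and_eq_true, decide_eq_true_eq, Bool.or_eq_true] at h3
    have h4 := hx.2
    unfold newB at h4
    simp only [Bool.not_eq_true', Bool.not_eq_false, Bool.and_eq_true, decide_eq_true_eq] at h4
    exact ⟨h4.1, h4.2, h3.2.2.resolve_left hx.2⟩
  have := Finset.sum_filter_add_sum_filter_not F (fun x => newB u Z x.1 x.2 = true) fun x => wt u x.1
  linarith

theorem req_ok {t : ℕ} : ∀ s, t ≤ s → cur u Z (s+1) t = true → ∃ s' ≤ s, reqB u A D Z t s' = true ∧ 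
    restrSeq (XS u A D (s'+1)) (sl u t) = restrSeq (XS u A D (s+1)) (sl u t) := by
  intro s
  induction s with
  | zero => 
    intro h1 h2
    refine ⟨0, le_rfl, ?_, rfl⟩
    unfold reqB newB
    rw [h2]; simp; omega
  | succ s ih =>
    intro h1 h2
    by_cases hr : reqB u A D Z t (s+1) = true
    · exact ⟨s+1, le_rfl, hr, rfl⟩
    · have hn : newB u Z t (s+1) = false ∧ hitB u A D t (s+1) = false := by
        unfold reqB at hr
        rw [h2, decide_eq_true h1] at hr
        simpa using hr
      obtain ⟨hn, hh⟩ := hn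
      unfold newB at hn
      simp only [Bool.not_eq_false', Bool.and_eq_true, decide_eq_true_eq] at hn
      obtain ⟨s', a1, a2, a3⟩ := ih (by omega) hn.2
      refine ⟨s', by omega, a2, a3.trans (no_change fun κ hκ => ?_).symm⟩
      unfold hitB at hh
      rw [hκ] at hh
      simp only [Option.elim, decide_eq_false_iff_not] at hh
      omega

theorem XL_le [PR1 u] [PR2 A] [PR2 D] (hU : OptimalPF U) (hu : UE U u) (hZ : Apx Y Z) 
    (hle : ∀ s n, mR u Z s n ≤ mR u A s n + mR u D s n) : KLeSeq U (XL u A D) Y := by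
  have : PR2 Z := ⟨hZ.pr⟩
  obtain ⟨c, hc⟩ := kc_opt_part hU (g := fun x => Part.ofOption (reqX u A D Z x)) 
    (Computable.ofOption (pr_reqX u A D Z).to_comp) (by
      intro F ℓ hF
      have h1 : ∀ x ∈ F, reqB u A D Z x.unpair.1 x.unpair.2 = true ∧ ℓ x = pl u x.unpair.1 + 1 := by
        intro x hx
        obtain ⟨σ, hσ⟩ := hF x hx
        rw [Part.mem_ofOption, Option.mem_def] at hσ
        exact reqX_some hσ
      have h2 : ∑ x ∈ F, (1/2:ℝ)^ℓ x = (1/2) * ∑ y ∈ F.image Nat.unpair, wt u y.1 := by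
        rw [Finset.sum_image (fun a _ b _ h => by rw [← Nat.pair_unpair a, h, Nat.pair_unpair b]), Finset.mul_sum]
        refine Finset.sum_congr rfl fun x hx => ?_
        obtain ⟨b1, b2⟩ := h1 x hx
        have b3 : cur u Z (x.unpair.2+1) x.unpair.1 = true := by
          unfold reqB at b1
          simp only [Bool.and_eq_true] at b1
          exact b1.2.1
        rw [b2, cur_wt b3, pow_succ]; ring
      have h3 := req_sum hu hZ hle (F.image Nat.unpair) (by
        intro y hy
        obtain ⟨x, hx, rfl⟩ := Finset.mem_image.1 hy
        exact (h1 x hx).1)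
      rw [h2]; linarith)
  refine ⟨c+1, fun n => ?_⟩
  refine KC_le_add fun k hk => ?_
  obtain ⟨t, ρ, ht, hρ⟩ := hu.prog hk
  have hsl : sl u t = n := by simp [sl, ap1, ht]
  obtain ⟨S, hS⟩ := XL_lim (u := u) (A := A) (D := D) n
  obtain ⟨S', hS'⟩ := eventually_atTop.1 (hZ.lim n)
  set s := max t (max S S') with hs
  have hc1 : cur u Z (s+1) t = true := cur_iff.2 ⟨ρ, by rw [hsl, hS' (s+1) (by omega), ht]⟩
  obtain ⟨s', -, h2, h3⟩ := req_ok (A := A) (D := D) s (by omega) hc1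
  have h4 := hc (Nat.pair t s') (pl u t + 1) (restrSeq (XL u A D) n) (by
    rw [Part.mem_ofOption, Option.mem_def]
    unfold reqX
    rw [Nat.unpair_pair]
    simp only [h2, cond_true]
    rw [hsl] at h3 ⊢
    rw [← hS (s+1) (by omega), ← h3]
    rfl)
  refine h4.trans ?_
  have : pl u t = ρ.length := by simp [pl, ap1, ht]
  exact_mod_cast (by omega : pl u t + 1 + c ≤ k + (c+1))
end cons

theorem mR_nonneg {u : ℕ → Option (Str × Str)} {Z : ℕ → ℕ → Bool} (s n : ℕ) : 0 ≤ mR u Z s n := 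
  Finset.sum_nonneg fun _ _ => wt_nonneg _

theorem part2 {U : Str →. Str} (hU : OptimalPF U) : ¬ (∃ A D : ℕ → Bool, CEReal A ∧ CEReal D ∧ 
    ¬ KTrivialSeq U A ∧ ¬ KTrivialSeq U D ∧ 
    ∀ X : ℕ → Bool, CEReal X → KLeSeq U X A → KLeSeq U X D → KTrivialSeq U X) := by
  rintro ⟨X, Y, hX, hY, hX', hY', h⟩
  obtain ⟨A, hA⟩ := ceReal_apx hX
  obtain ⟨D, hD⟩ := ceReal_apx hY
  obtain ⟨u, hu⟩ := exists_UE hU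
  have : PR1 u := ⟨hu.pr⟩
  have : PR2 A := ⟨hA.pr⟩
  have : PR2 D := ⟨hD.pr⟩
  refine XL_nontriv hU hu hA hD hX' hY' (h (XL u A D) XL_ce (XL_le hU hu hA ?_) (XL_le hU hu hD ?_))
  · intro s n; have := mR_nonneg (u := u) (Z := D) s n; linarith
  · intro s n; have := mR_nonneg (u := u) (Z := A) s n; linarith

/-- The `C`-degrees of c.e. reals and the `K`-degrees of c.e. reals
are not elementarily equivalent: the former contain a minimal pair, the latter do not. -/
theorem stmt9 (V : Str →. Str) (hV : OptimalPlain V) (U : Str →. Str) (hU : OptimalPF U) :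
    (∃ A D : ℕ → Bool, CEReal A ∧ CEReal D ∧ ¬ CTrivialSeq V A ∧ ¬ CTrivialSeq V D ∧
        ∀ X : ℕ → Bool, CEReal X → CLeSeq V X A → CLeSeq V X D → CTrivialSeq V X) ∧
    ¬ (∃ A D : ℕ → Bool, CEReal A ∧ CEReal D ∧ ¬ KTrivialSeq U A ∧ ¬ KTrivialSeq U D ∧
        ∀ X : ℕ → Bool, CEReal X → KLeSeq U X A → KLeSeq U X D → KTrivialSeq U X) := by
  exact ⟨part1 hV, part2 hU⟩

end KPaper
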